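/- arXiv:1008.2089 — 13 statements merged into one kernel-verified Lean document; each statement's English description precedes it below -/
import Mathlib

section
/- Let M be a symmetric real 2×2 matrix with rank M = 2 (so both eigenvalues are nonzero). Then there exist vectors a, b ∈ ℝ² with M = a ⊙ b if and only if the two eigenvalues of M have opposite signs (equivalently, det M < 0). -/
/-- The symmetric tensor product `a ⊙ b = ½(a bᵀ + b aᵀ)` of two vectors. -/
noncomputable def symTensor {d : ℕ} (a b : Fin d → ℝ) : Matrix (Fin d) (Fin d) ℝ :=
  fun i j => (a i * b j + b i * a j) / 2

theorem Matrix.det_ne_zero_of_rank_eq_card {n K : Type*} [Fintype n] [DecidableEq n] [Field K]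
    {M : Matrix n n K} (h : M.rank = Fintype.card n) : M.det ≠ 0 := by
  rw [Matrix.rank_eq_finrank_span_row, ← Set.finrank, eq_comm,
    ← linearIndependent_iff_card_eq_finrank_span,
    Matrix.linearIndependent_rows_iff_isUnit] at h
  exact ((Matrix.isUnit_iff_isUnit_det M).1 h).ne_zero

theorem det_symTensor_fin_two (a b : Fin 2 → ℝ) :
    (symTensor a b).det = -((a 0 * b 1 - b 0 * a 1) / 2) ^ 2 := by
  simp only [Matrix.det_fin_two, symTensor]
  ring

theorem exists_eq_symTensor_of_det_nonpos {M : Matrix (Fin 2) (Fin 2) ℝ}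
    (hsymm : M.IsSymm) (hdet : M.det ≤ 0) : ∃ a b : Fin 2 → ℝ, M = symTensor a b := by
  have h10 : M 1 0 = M 0 1 := hsymm.apply 0 1
  rw [Matrix.det_fin_two, h10] at hdet
  by_cases h00 : M 0 0 = 0
  · refine ⟨![0, 1], ![2 * M 0 1, M 1 1], ?_⟩
    ext i j
    fin_cases i <;> fin_cases j <;> simp [symTensor, h00, h10]
  · have hs := Real.sq_sqrt (show 0 ≤ M 0 1 * M 0 1 - M 0 0 * M 1 1 by linarith)
    set s := √(M 0 1 * M 0 1 - M 0 0 * M 1 1)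
    refine ⟨![1, (M 0 1 + s) / M 0 0], ![M 0 0, M 0 1 - s], ?_⟩
    ext i j
    fin_cases i <;> fin_cases j <;> simp [symTensor, h10] <;> field_simp <;> linarith

/-- A symmetric real 2×2 matrix of rank 2 can be written as a symmetric
tensor product `a ⊙ b` if and only if its two (nonzero) eigenvalues have opposite signs,
equivalently `det M < 0`. -/
theorem rank_two_symm_eq_symTensor_iff_det_neg (M : Matrix (Fin 2) (Fin 2) ℝ)
    (hsymm : M.IsSymm) (hrank : M.rank = 2) :
    (∃ a b : Fin 2 → ℝ, M = symTensor a b) ↔ M.det < 0 := by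
  refine ⟨?_, fun h => exists_eq_symTensor_of_det_nonpos hsymm h.le⟩
  rintro ⟨a, b, rfl⟩
  refine lt_of_le_of_ne ?_ (Matrix.det_ne_zero_of_rank_eq_card (by simpa using hrank))
  rw [det_symTensor_fin_two]
  exact neg_nonpos.2 (sq_nonneg _)
end

section
/- Let u : ℝ^d → ℝ^d be continuously differentiable. Then 𝓔u(x) = 0 for every x ∈ ℝ^d if and only if u is a rigid deformation, i.e. there exist u₀ ∈ ℝ^d and a skew-symmetric matrix R ∈ ℝ^{d×d} (Rᵀ = −R) such that u(x) = u₀ + R x for all x ∈ ℝ^d. -/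
/-- The symmetrized gradient `𝓔u(x) = ½(Du(x) + Du(x)ᵀ)`, with entries
`(𝓔u(x))_{ij} = ½(∂_j u^i(x) + ∂_i u^j(x))`. -/
noncomputable def symGrad {d : ℕ} (u : (Fin d → ℝ) → (Fin d → ℝ)) (x : Fin d → ℝ) :
    Matrix (Fin d) (Fin d) ℝ :=
  fun i j => (fderiv ℝ u x (Pi.single j 1) i + fderiv ℝ u x (Pi.single i 1) j) / 2

open Matrix in
/-- If the symmetrized gradient vanishes then increments of `u` are orthogonal to the
displacement. -/
theorem dotProduct_sub_eq_zero_of_symGrad_eq_zero {d : ℕ} {u : (Fin d → ℝ) → (Fin d → ℝ)}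
    (hu : Differentiable ℝ u) (h : ∀ x, symGrad u x = 0) (x y : Fin d → ℝ) :
    (x - y) ⬝ᵥ (u x - u y) = 0 := by
  have skew (z w : Fin d → ℝ) : w ⬝ᵥ fderiv ℝ u z w = 0 := by
    have hw : fderiv ℝ u z w = ∑ j, w j • fderiv ℝ u z (Pi.single j 1) := by
      conv_lhs => rw [pi_eq_sum_univ' w]
      simp [map_sum]
    have hexp : w ⬝ᵥ fderiv ℝ u z w =
        ∑ i, ∑ j, w i * w j * fderiv ℝ u z (Pi.single j 1) i := by
      rw [hw]
      simp [dotProduct, Finset.sum_apply, Finset.mul_sum, mul_assoc]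
    have hneg : w ⬝ᵥ fderiv ℝ u z w = -(w ⬝ᵥ fderiv ℝ u z w) := by
      conv_lhs => rw [hexp, Finset.sum_comm]
      rw [hexp]
      simp only [← Finset.sum_neg_distrib]
      refine Finset.sum_congr rfl fun i _ => Finset.sum_congr rfl fun j _ => ?_
      have hij : (fderiv ℝ u z (Pi.single j 1) i + fderiv ℝ u z (Pi.single i 1) j) / 2 = 0 :=
        congrFun (congrFun (h z) i) j
      linear_combination 2 * w i * w j * hij
    linarith
  have hderiv (t : ℝ) :
      HasDerivAt (fun t : ℝ => (x - y) ⬝ᵥ u (y + t • (x - y))) 0 t := by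
    have hline : HasDerivAt (fun t : ℝ => y + t • (x - y)) (x - y) t := by
      simpa using ((hasDerivAt_id t).smul_const (x - y)).const_add y
    have hcomp := (hu (y + t • (x - y))).hasFDerivAt.comp_hasDerivAt t hline
    rw [← skew (y + t • (x - y)) (x - y)]
    exact HasDerivAt.fun_sum fun i _ => (hasDerivAt_pi.1 hcomp i).const_mul _
  have hconst := is_const_of_deriv_eq_zero (fun t => (hderiv t).differentiableAt)
    (fun t => (hderiv t).deriv) 1 0
  rw [dotProduct_sub, sub_eq_zero]
  simpa using hconst

/-- For a continuously differentiable `u : ℝ^d → ℝ^d`, the symmetrized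
gradient `𝓔u` vanishes identically if and only if `u` is a rigid deformation,
i.e. `u(x) = u₀ + R x` with `R` skew-symmetric. -/
theorem symGrad_eq_zero_iff_rigid {d : ℕ} (u : (Fin d → ℝ) → (Fin d → ℝ))
    (hu : ContDiff ℝ 1 u) :
    (∀ x, symGrad u x = 0) ↔
      ∃ (u₀ : Fin d → ℝ) (R : Matrix (Fin d) (Fin d) ℝ),
        R.transpose = -R ∧ ∀ x, u x = u₀ + R.mulVec x := by
  constructor
  · intro h
    have hdot := dotProduct_sub_eq_zero_of_symGrad_eq_zero (hu.differentiable one_ne_zero) h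
    have hpol (x y : Fin d → ℝ) : dotProduct x (u y - u 0) = -dotProduct y (u x - u 0) := by
      have hx := hdot x 0
      have hy := hdot y 0
      have hxy := hdot x y
      simp only [sub_zero, dotProduct_sub, sub_dotProduct] at hx hy hxy ⊢
      linarith
    refine ⟨u 0, Matrix.of fun i j => -(u (Pi.single i 1) - u 0) j, ?_, fun x => ?_⟩
    · ext i j
      have hij := hpol (Pi.single i 1) (Pi.single j 1)
      simp only [single_dotProduct, one_mul] at hij
      simp only [Matrix.transpose_apply, Matrix.of_apply, Matrix.neg_apply]
      rw [hij]
    · ext i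
      have hi := hpol (Pi.single i 1) x
      simp only [single_dotProduct, one_mul, Pi.sub_apply] at hi
      have hR : (Matrix.of fun i j => -(u (Pi.single i 1) - u 0) j).mulVec x i =
          -dotProduct x (u (Pi.single i 1) - u 0) := by
        simp only [Matrix.mulVec, dotProduct, Matrix.of_apply, ← Finset.sum_neg_distrib]
        exact Finset.sum_congr rfl fun j _ => by ring
      rw [Pi.add_apply, hR]
      linarith
  · rintro ⟨u₀, R, hR, hux⟩ x
    have hfd : HasFDerivAt u (LinearMap.toContinuousLinearMap R.mulVecLin) x := by
      rw [funext hux]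
      exact (LinearMap.toContinuousLinearMap R.mulVecLin).hasFDerivAt.const_add u₀
    ext i j
    have hij : R j i = -R i j := congrFun (congrFun hR i) j
    simp [symGrad, hfd.fderiv, hij]
end

section
/- Let d ≥ 2 and set p := d/(d−1). Let P₀ be a symmetric real d×d matrix such that P₀ ≠ a ⊙ b for all vectors a, b ∈ ℝ^d, and let φ : ℝ^d → ℝ be smooth with compact support K. Then there exists a constant C > 0 (depending only on d, P₀ and φ) such that for every smooth v : ℝ^d → ℝ^d satisfying 𝓔v(x) ∈ span{P₀} for all x ∈ ℝ^d, one has ‖𝓔(φ v)‖_{L^p(ℝ^d)} ≤ C ‖v‖_{L^p(K)}. -/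
open MeasureTheory

/-- The Frobenius norm of a matrix. -/
noncomputable def frobNorm {d : ℕ} (A : Matrix (Fin d) (Fin d) ℝ) : ℝ :=
  Real.sqrt (∑ i, ∑ j, (A i j) ^ 2)

/-- The Euclidean norm of a vector in `ℝ^d`. -/
noncomputable def eucNorm {d : ℕ} (v : Fin d → ℝ) : ℝ :=
  Real.sqrt (∑ i, (v i) ^ 2)

open Matrix in
/-- A symmetric matrix which is not a symmetric tensor product is a nonzero multiple of the
Euclidean metric on some two-dimensional subspace. -/
lemma exists_conformal_pair {d : ℕ} (P : Matrix (Fin d) (Fin d) ℝ) (hP : P.IsSymm)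
    (hne : ∀ a b : Fin d → ℝ, P ≠ symTensor a b) :
    ∃ (a b : Fin d → ℝ) (σ : ℝ), σ ≠ 0 ∧ a ⬝ᵥ P *ᵥ a = σ ∧ b ⬝ᵥ P *ᵥ b = σ ∧
      a ⬝ᵥ P *ᵥ b = 0 := by
  have hH : P.IsHermitian := by
    rw [Matrix.IsHermitian, Matrix.conjTranspose_eq_transpose_of_trivial]; exact hP
  set ev := hH.eigenvalues
  have hmul : ∀ i, P *ᵥ (hH.eigenvectorBasis i : Fin d → ℝ) =
      ev i • (hH.eigenvectorBasis i : Fin d → ℝ) := fun i => hH.mulVec_eigenvectorBasis i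
  have hortho : ∀ i j, (hH.eigenvectorBasis i : Fin d → ℝ) ⬝ᵥ
      (hH.eigenvectorBasis j : Fin d → ℝ) = if i = j then 1 else 0 := by
    intro i j
    have := orthonormal_iff_ite.mp hH.eigenvectorBasis.orthonormal j i
    rw [EuclideanSpace.inner_eq_star_dotProduct] at this
    simpa [eq_comm] using this
  by_cases hex : ∃ i j, i ≠ j ∧ 0 < ev i * ev j
  · obtain ⟨i, j, hij, hpos⟩ := hex
    have hi : ev i ≠ 0 := left_ne_zero_of_mul hpos.ne'
    have hj : ev j ≠ 0 := right_ne_zero_of_mul hpos.ne'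
    have hr : 0 < ev i / ev j := by
      have : ev i / ev j = ev i * ev j / (ev j) ^ 2 := by field_simp
      rw [this]; positivity
    refine ⟨hH.eigenvectorBasis i, Real.sqrt (ev i / ev j) • (hH.eigenvectorBasis j : Fin d → ℝ),
      ev i, hi, ?_, ?_, ?_⟩
    · rw [hmul, dotProduct_smul, hortho]; simp
    · rw [mulVec_smul, hmul, dotProduct_smul, smul_dotProduct, dotProduct_smul, hortho]
      have := Real.mul_self_sqrt hr.le
      simp only [if_true, smul_eq_mul, mul_one]
      rw [← mul_assoc, this, div_mul_cancel₀ _ hj]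
    · rw [mulVec_smul, hmul, dotProduct_smul, dotProduct_smul, hortho]; simp [hij]
  · exfalso
    push Not at hex
    set x : Fin d → ℝ := fun m => ∑ k, Real.sqrt (ev k) * hH.eigenvectorBasis k m
    set y : Fin d → ℝ := fun m => ∑ k, Real.sqrt (-ev k) * hH.eigenvectorBasis k m
    refine hne (x + y) (x - y) ?_
    ext m n
    have hPmn : P m n = ∑ k, ev k * (hH.eigenvectorBasis k m * hH.eigenvectorBasis k n) := by
      conv_lhs => rw [hH.spectral_theorem]
      simp [Unitary.conjStarAlgAut_apply, Matrix.mul_apply, Matrix.diagonal_apply,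
        Matrix.IsHermitian.eigenvectorUnitary_apply, Matrix.star_apply]
      exact Finset.sum_congr rfl fun k _ => by ring
    have hsq : ∀ k l, Real.sqrt (ev k) * Real.sqrt (ev l) - Real.sqrt (-ev k) * Real.sqrt (-ev l)
        = if k = l then ev k else 0 := by
      intro k l
      split_ifs with h
      · subst h
        rcases le_total 0 (ev k) with h0 | h0
        · rw [Real.mul_self_sqrt h0, Real.sqrt_eq_zero_of_nonpos (x := -ev k) (by linarith)]; simp
        · rw [Real.sqrt_eq_zero_of_nonpos h0, Real.mul_self_sqrt (by linarith)]; simp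
      · have hkl := hex k l h
        have h1 : Real.sqrt (ev k) * Real.sqrt (ev l) = 0 := by
          by_contra hc
          have := Real.sqrt_ne_zero'.mp (left_ne_zero_of_mul hc)
          have := Real.sqrt_ne_zero'.mp (right_ne_zero_of_mul hc)
          have := mul_pos ‹0 < ev k› this
          linarith
        have h2 : Real.sqrt (-ev k) * Real.sqrt (-ev l) = 0 := by
          by_contra hc
          have := Real.sqrt_ne_zero'.mp (left_ne_zero_of_mul hc)
          have := Real.sqrt_ne_zero'.mp (right_ne_zero_of_mul hc)
          nlinarith
        rw [h1, h2, sub_zero]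
    have hxy : x m * x n - y m * y n = P m n := by
      rw [hPmn]
      simp only [x, y, Finset.sum_mul_sum]
      rw [← Finset.sum_sub_distrib]
      refine Finset.sum_congr rfl fun k _ => ?_
      rw [← Finset.sum_sub_distrib]
      have : ∀ l, Real.sqrt (ev k) * hH.eigenvectorBasis k m *
          (Real.sqrt (ev l) * hH.eigenvectorBasis l n) -
          Real.sqrt (-ev k) * hH.eigenvectorBasis k m *
          (Real.sqrt (-ev l) * hH.eigenvectorBasis l n) =
          (if k = l then ev k else 0) * (hH.eigenvectorBasis k m * hH.eigenvectorBasis l n) := by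
        intro l; rw [← hsq]; ring
      simp [this]
    simp only [symTensor, Pi.add_apply, Pi.sub_apply]
    linarith

open Real in
/-- Cauchy's estimate for the derivative, with the mean over the circle in place of the maximum. -/
lemma norm_deriv_zero_le_setAverage {F : ℂ → ℂ} (hF : Differentiable ℂ F) {r : ℝ} (hr : 0 < r) :
    ‖deriv F 0‖ ≤ r⁻¹ * ⨍ θ in Set.Ioc 0 (2 * π), ‖F (circleMap 0 r θ)‖ := by
  have h := hF.differentiableOn.deriv_eq_smul_circleIntegral (c := 0) hr
  have h2 : ‖∮ z in C(0, r), (1 / (z - 0) ^ 2) • F z‖ = (2 * π) * ‖deriv F 0‖ := by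
    rw [h]; simp [abs_of_pos pi_pos]
  have h3 : ‖∮ z in C(0, r), (1 / (z - 0) ^ 2) • F z‖ ≤
      ∫ θ in (0 : ℝ)..2 * π, r⁻¹ * ‖F (circleMap 0 r θ)‖ := by
    rw [circleIntegral]
    refine (intervalIntegral.norm_integral_le_integral_norm two_pi_pos.le).trans (le_of_eq ?_)
    refine intervalIntegral.integral_congr fun θ _ => ?_
    simp [abs_of_pos hr]
    field_simp
  rw [h2, intervalIntegral.integral_of_le two_pi_pos.le, integral_const_mul] at h3
  rw [setAverage_eq]
  simp only [measureReal_def, volume_Ioc, sub_zero, ENNReal.toReal_ofReal two_pi_pos.le,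
    smul_eq_mul]
  rw [mul_left_comm, inv_mul_eq_div (2 * π), le_div_iff₀' two_pi_pos]
  exact h3

/-- A Lipschitz perturbation of the identity distorts volume by at most `2 ^ d`. -/
lemma map_restrict_le_of_antilipschitz {d : ℕ} {T : (Fin d → ℝ) → (Fin d → ℝ)}
    (hT : AntilipschitzWith 2 T) (hTm : Measurable T) {K : Set (Fin d → ℝ)}
    (hTK : Set.MapsTo T K K) :
    (volume.restrict K).map T ≤ (2 : ENNReal) ^ d • volume.restrict K := by
  refine Measure.le_iff.mpr fun s hs => ?_
  rw [Measure.map_apply hTm hs, Measure.restrict_apply (hTm hs), Measure.smul_apply,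
    Measure.restrict_apply hs]
  have h := hT.hausdorffMeasure_preimage_le (d := (d : ℝ)) (by positivity) (s ∩ K)
  have hv : (Measure.hausdorffMeasure (d : ℝ) : Measure (Fin d → ℝ)) = volume := by
    simpa using hausdorffMeasure_pi_real (ι := Fin d)
  rw [hv] at h
  refine (measure_mono ?_).trans (h.trans (le_of_eq (by simp)))
  exact fun x hx => ⟨hx.1, hTK hx.2⟩

open Real in
/-- Integrated Jensen inequality along a family of antilipschitz self-maps of a compact set. -/
lemma setIntegral_setAverage_rpow_le {d : ℕ} {K : Set (Fin d → ℝ)} (hK : IsCompact K)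
    {T : (Fin d → ℝ) → ℝ → (Fin d → ℝ)} (hTc : Continuous (Function.uncurry T))
    (hT : ∀ θ, AntilipschitzWith 2 fun x => T x θ) (hTK : ∀ θ, Set.MapsTo (T · θ) K K)
    {w : (Fin d → ℝ) → ℝ} (hw : Continuous w) (hw0 : ∀ x, 0 ≤ w x) {p : ℝ} (hp : 1 ≤ p) :
    IntegrableOn (fun x => ⨍ θ in Set.Ioc 0 (2 * π), w (T x θ) ^ p) K ∧
    ∫ x in K, ⨍ θ in Set.Ioc 0 (2 * π), w (T x θ) ^ p ≤ 2 ^ d * ∫ x in K, w x ^ p := by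
  have hp0 : 0 ≤ p := by linarith
  have hwp : Continuous fun x => w x ^ p := hw.rpow_const fun _ => Or.inr hp0
  have hc : Continuous (Function.uncurry fun x θ => w (T x θ) ^ p) := hwp.comp hTc
  have hint : Integrable (Function.uncurry fun x θ => w (T x θ) ^ p)
      ((volume.restrict K).prod (volume.restrict (Set.Ioc 0 (2 * π)))) := by
    rw [Measure.prod_restrict]
    exact (hc.continuousOn.integrableOn_compact (hK.prod (isCompact_Icc (a := 0) (b := 2 * π)))
      ).mono_set (Set.prod_mono_right Set.Ioc_subset_Icc_self)
  have hθ : ∀ θ, ∫ x in K, w (T x θ) ^ p ≤ 2 ^ d * ∫ x in K, w x ^ p := by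
    intro θ
    have hTθ : Continuous fun x => T x θ := hTc.comp (Continuous.prodMk_left θ)
    have hle := map_restrict_le_of_antilipschitz (hT θ) hTθ.measurable (hTK θ)
    have hi : IntegrableOn (fun x => w x ^ p) K := hwp.continuousOn.integrableOn_compact hK
    calc ∫ x in K, w (T x θ) ^ p
        = ∫ y, w y ^ p ∂((volume.restrict K).map fun x => T x θ) :=
          (integral_map hTθ.aemeasurable hwp.aestronglyMeasurable).symm
      _ ≤ ∫ y, w y ^ p ∂((2 : ENNReal) ^ d • volume.restrict K) :=
          integral_mono_measure hle (Filter.Eventually.of_forall fun x => rpow_nonneg (hw0 x) p)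
            (hi.smul_measure (by finiteness))
      _ = 2 ^ d * ∫ x in K, w x ^ p := by rw [integral_smul_measure]; simp
  have hav : ∀ x, ⨍ θ in Set.Ioc 0 (2 * π), w (T x θ) ^ p =
      (2 * π)⁻¹ * ∫ θ in Set.Ioc 0 (2 * π), w (T x θ) ^ p := by
    intro x
    rw [setAverage_eq]
    simp [measureReal_def, pi_pos.le]
  simp only [hav]
  refine ⟨hint.integral_prod_left.const_mul _, ?_⟩
  rw [integral_const_mul, integral_integral_swap hint, inv_mul_le_iff₀ two_pi_pos]
  calc ∫ θ in Set.Ioc 0 (2 * π), ∫ x in K, w (T x θ) ^ p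
      ≤ ∫ θ in Set.Ioc 0 (2 * π), 2 ^ d * ∫ x in K, w x ^ p :=
        integral_mono hint.integral_prod_right (integrable_const _) hθ
    _ = _ := by simp [measureReal_def, pi_pos.le]

lemma continuous_eucNorm {d : ℕ} : Continuous (eucNorm : (Fin d → ℝ) → ℝ) := by
  unfold eucNorm; fun_prop

lemma eucNorm_nonneg {d : ℕ} (v : Fin d → ℝ) : 0 ≤ eucNorm v := Real.sqrt_nonneg _

lemma abs_apply_le_eucNorm {d : ℕ} (v : Fin d → ℝ) (i : Fin d) : |v i| ≤ eucNorm v := by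
  rw [eucNorm, ← Real.sqrt_sq_eq_abs]
  exact Real.sqrt_le_sqrt
    (Finset.single_le_sum (f := fun i => v i ^ 2) (fun j _ => sq_nonneg _) (Finset.mem_univ i))

lemma frobNorm_le_sum_abs {d : ℕ} (A : Matrix (Fin d) (Fin d) ℝ) :
    frobNorm A ≤ ∑ i, ∑ j, |A i j| := by
  rw [frobNorm, ← Finset.sum_product', ← Finset.sum_product']
  refine Real.sqrt_le_iff.mpr ⟨Finset.sum_nonneg fun _ _ => abs_nonneg _, ?_⟩
  simp_rw [← sq_abs (A _ _)]
  exact Finset.sum_sq_le_sq_sum_of_nonneg fun _ _ => abs_nonneg _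

open Matrix in
lemma dotProduct_symGrad_mulVec {d : ℕ} (v : (Fin d → ℝ) → (Fin d → ℝ)) (x a b : Fin d → ℝ) :
    a ⬝ᵥ symGrad v x *ᵥ b = (a ⬝ᵥ fderiv ℝ v x b + b ⬝ᵥ fderiv ℝ v x a) / 2 := by
  have key : ∀ a b : Fin d → ℝ, a ⬝ᵥ fderiv ℝ v x b =
      ∑ i, ∑ j, a i * b j * fderiv ℝ v x (Pi.single j 1) i := by
    intro a b
    have hb : fderiv ℝ v x b = ∑ j, b j • fderiv ℝ v x (Pi.single j 1) := by
      conv_lhs => rw [pi_eq_sum_univ' b]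
      simp [map_sum]
    rw [hb]
    simp [dotProduct, Finset.mul_sum, mul_assoc]
  rw [key a b, key b a, Finset.sum_comm (γ := Fin d) (f := fun i j => b i * a j * _),
    ← Finset.sum_add_distrib, Finset.sum_div]
  simp only [dotProduct, mulVec, Finset.mul_sum]
  refine Finset.sum_congr rfl fun i _ => ?_
  rw [← Finset.sum_add_distrib, Finset.sum_div]
  refine Finset.sum_congr rfl fun j _ => ?_
  simp only [symGrad]
  ring

/-- The parametrization `z ↦ Re z • a + Im z • b` of the plane spanned by `a` and `b`. -/
noncomputable def planeMap {d : ℕ} (a b : Fin d → ℝ) : ℂ →L[ℝ] (Fin d → ℝ) :=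
  Complex.reCLM.smulRight a + Complex.imCLM.smulRight b

/-- The complex covector `w ↦ a · w + i b · w`. -/
noncomputable def planeCovector {d : ℕ} (a b : Fin d → ℝ) : (Fin d → ℝ) →L[ℝ] ℂ :=
  ∑ i, (ContinuousLinearMap.proj (R := ℝ) (φ := fun _ : Fin d => ℝ) i).smulRight
    ((a i : ℂ) + b i * Complex.I)

lemma planeCovector_apply {d : ℕ} (a b w : Fin d → ℝ) :
    planeCovector a b w = ((a ⬝ᵥ w : ℝ) : ℂ) + ((b ⬝ᵥ w : ℝ) : ℂ) * Complex.I := by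
  simp only [planeCovector, sum_apply, ContinuousLinearMap.smulRight_apply,
    ContinuousLinearMap.proj_apply, Complex.real_smul, dotProduct, Complex.ofReal_sum,
    Complex.ofReal_mul, Finset.sum_mul, ← Finset.sum_add_distrib]
  exact Finset.sum_congr rfl fun i _ => by ring

lemma norm_planeCovector_apply_le {d : ℕ} (a b w : Fin d → ℝ) :
    ‖planeCovector a b w‖ ≤ (∑ i, ‖(a i : ℂ) + b i * Complex.I‖) * eucNorm w := by
  simp only [planeCovector, sum_apply, ContinuousLinearMap.smulRight_apply,
    ContinuousLinearMap.proj_apply, Finset.sum_mul]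
  refine (norm_sum_le _ _).trans (Finset.sum_le_sum fun i _ => ?_)
  rw [norm_smul, mul_comm, Real.norm_eq_abs]
  gcongr
  exact abs_apply_le_eucNorm w i

open Real in
/-- Interior estimate: along a plane on which `P` is conformal, the equation `𝓔v = t P` is the
Cauchy-Riemann system, so `t` is controlled by circular means of `v`. -/
lemma abs_le_setAverage_of_symGrad_eq {d : ℕ} {P : Matrix (Fin d) (Fin d) ℝ} {a b : Fin d → ℝ}
    {σ : ℝ} (hσ : σ ≠ 0) (haa : a ⬝ᵥ P.mulVec a = σ) (hbb : b ⬝ᵥ P.mulVec b = σ)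
    (hab : a ⬝ᵥ P.mulVec b = 0) {v : (Fin d → ℝ) → (Fin d → ℝ)} (hv : Differentiable ℝ v)
    {t : (Fin d → ℝ) → ℝ} (ht : ∀ x, symGrad v x = t x • P) (x : Fin d → ℝ) {r : ℝ}
    (hr : 0 < r) :
    |t x| ≤ (|σ|⁻¹ * ∑ i, ‖(a i : ℂ) + b i * Complex.I‖) *
      (r⁻¹ * ⨍ θ in Set.Ioc 0 (2 * π), eucNorm (v (x + planeMap a b (circleMap 0 r θ)))) := by
  set F : ℂ → ℂ := fun z => planeCovector a b (v (x + planeMap a b z))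
  have hFd : ∀ z, HasFDerivAt F ((planeCovector a b).comp
      ((fderiv ℝ v (x + planeMap a b z)).comp (planeMap a b))) z := fun z =>
    (planeCovector a b).hasFDerivAt.comp z
      ((hv _).hasFDerivAt.comp z ((planeMap a b).hasFDerivAt.const_add x))
  have h1 : planeMap a b 1 = a := by simp [planeMap]
  have hI : planeMap a b Complex.I = b := by simp [planeMap]
  have hFaa : ∀ y, a ⬝ᵥ fderiv ℝ v y a = t y * σ := by
    intro y
    have := dotProduct_symGrad_mulVec v y a a
    rw [ht, Matrix.smul_mulVec, dotProduct_smul, haa, smul_eq_mul] at this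
    linarith
  have hFbb : ∀ y, b ⬝ᵥ fderiv ℝ v y b = t y * σ := by
    intro y
    have := dotProduct_symGrad_mulVec v y b b
    rw [ht, Matrix.smul_mulVec, dotProduct_smul, hbb, smul_eq_mul] at this
    linarith
  have hFab : ∀ y, a ⬝ᵥ fderiv ℝ v y b = -(b ⬝ᵥ fderiv ℝ v y a) := by
    intro y
    have := dotProduct_symGrad_mulVec v y a b
    rw [ht, Matrix.smul_mulVec, dotProduct_smul, hab, smul_zero] at this
    linarith
  have hhol : Differentiable ℂ F := by
    intro z
    refine differentiableAt_complex_iff_differentiableAt_real.mpr ⟨(hFd z).differentiableAt, ?_⟩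
    rw [(hFd z).fderiv]
    simp only [ContinuousLinearMap.comp_apply, h1, hI, planeCovector_apply, hFaa, hFbb, hFab]
    rw [smul_eq_mul, mul_add, mul_left_comm Complex.I, Complex.I_mul_I]
    push_cast
    ring
  have hderiv : (deriv F 0).re = t x * σ := by
    have h := (hhol 0).hasFDerivAt.restrictScalars ℝ
    have h2 := congrArg (fun L : ℂ →L[ℝ] ℂ => L 1) (h.unique (hFd 0))
    simp only [ContinuousLinearMap.comp_apply, h1, planeCovector_apply, map_zero, add_zero,
      hFaa, ContinuousLinearMap.coe_restrictScalars', fderiv_apply_one_eq_deriv] at h2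
    rw [h2]
    simp
  set c := ∑ i, ‖(a i : ℂ) + b i * Complex.I‖
  have hmean := norm_deriv_zero_le_setAverage hhol hr
  have hcircle : Continuous fun θ => v (x + planeMap a b (circleMap 0 r θ)) :=
    hv.continuous.comp
      (continuous_const.add ((planeMap a b).continuous.comp (continuous_circleMap 0 r)))
  have hintOn : ∀ {f : ℝ → ℝ}, Continuous f → IntegrableOn f (Set.Ioc 0 (2 * π)) := fun hf =>
    (hf.continuousOn.integrableOn_compact isCompact_Icc).mono_set Set.Ioc_subset_Icc_self
  have hle : ⨍ θ in Set.Ioc 0 (2 * π), ‖F (circleMap 0 r θ)‖ ≤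
      c * ⨍ θ in Set.Ioc 0 (2 * π), eucNorm (v (x + planeMap a b (circleMap 0 r θ))) := by
    rw [setAverage_eq, setAverage_eq, smul_eq_mul, smul_eq_mul, mul_left_comm,
      ← integral_const_mul c]
    refine mul_le_mul_of_nonneg_left (integral_mono ?_ ?_ fun θ => ?_)
      (inv_nonneg.mpr measureReal_nonneg)
    · exact hintOn ((planeCovector a b).continuous.comp hcircle).norm
    · exact hintOn (continuous_const.mul (continuous_eucNorm.comp hcircle))
    · exact norm_planeCovector_apply_le a b _
  have hσ' : 0 < |σ| := abs_pos.mpr hσ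
  have hre : |t x| * |σ| ≤ ‖deriv F 0‖ := by
    rw [← abs_mul, ← hderiv]; exact Complex.abs_re_le_norm _
  rw [mul_assoc, inv_mul_eq_div, le_div_iff₀ hσ', mul_left_comm]
  exact hre.trans (hmean.trans (mul_le_mul_of_nonneg_left hle (inv_nonneg.mpr hr.le)))

lemma frobNorm_symGrad_smul_le {d : ℕ} {P : Matrix (Fin d) (Fin d) ℝ}
    {φ : (Fin d → ℝ) → ℝ} {v : (Fin d → ℝ) → (Fin d → ℝ)} {x : Fin d → ℝ}
    (hφ : DifferentiableAt ℝ φ x) (hv : DifferentiableAt ℝ v x) {L s : ℝ}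
    (hL : ‖fderiv ℝ φ x‖ ≤ L) (hs : symGrad v x = s • P) :
    frobNorm (symGrad (fun y => φ y • v y) x) ≤
      |φ x| * |s| * ∑ i, ∑ j, |P i j| + d ^ 2 * L * eucNorm (v x) := by
  have hpart : ∀ i j, |fderiv ℝ φ x (Pi.single j 1) * v x i| ≤ L * eucNorm (v x) := by
    intro i j
    have h1 : |fderiv ℝ φ x (Pi.single j 1)| ≤ L := by
      refine ((fderiv ℝ φ x).le_opNorm _).trans ?_
      simpa [Pi.norm_single] using hL
    rw [abs_mul]
    exact mul_le_mul h1 (abs_apply_le_eucNorm _ _) (abs_nonneg _) ((norm_nonneg _).trans hL)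
  refine (frobNorm_le_sum_abs _).trans ?_
  have hterm : ∀ i j, |symGrad (fun y => φ y • v y) x i j| ≤
      |φ x| * |s| * |P i j| + L * eucNorm (v x) := by
    intro i j
    have hsij : symGrad v x i j = s * P i j := by rw [hs]; rfl
    have heq : symGrad (fun y => φ y • v y) x i j = φ x * (s * P i j) +
        (fderiv ℝ φ x (Pi.single j 1) * v x i + fderiv ℝ φ x (Pi.single i 1) * v x j) / 2 := by
      rw [← hsij]
      simp only [symGrad]
      rw [fderiv_fun_smul hφ hv]
      simp
      ring
    rw [heq]
    refine (abs_add_le _ _).trans (add_le_add (by rw [abs_mul, abs_mul, mul_assoc]) ?_)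
    rw [abs_div, abs_two, div_le_iff₀ two_pos]
    refine (abs_add_le _ _).trans ?_
    linarith [hpart i j, hpart j i]
  refine (Finset.sum_le_sum fun i _ => Finset.sum_le_sum fun j _ => hterm i j).trans
    (le_of_eq ?_)
  simp only [Finset.sum_add_distrib, ← Finset.mul_sum, Finset.sum_const, Finset.card_univ,
    Fintype.card_fin, nsmul_eq_mul]
  ring

/-- The circle of radius proportional to the distance to `Kᶜ`, centred at `x` and contained in the
plane through `x` parallel to the range of `Λ`. -/
noncomputable def innerCircleMap {d : ℕ} (Λ : ℂ →L[ℝ] (Fin d → ℝ)) (K : Set (Fin d → ℝ))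
    (x : Fin d → ℝ) (θ : ℝ) : Fin d → ℝ :=
  x + Λ (circleMap 0 ((2 * (‖Λ‖ + 1))⁻¹ * Metric.infDist x Kᶜ) θ)

lemma norm_map_circleMap_sub_le {d : ℕ} (Λ : ℂ →L[ℝ] (Fin d → ℝ)) (s s' θ : ℝ) :
    ‖Λ (circleMap 0 ((2 * (‖Λ‖ + 1))⁻¹ * s) θ) - Λ (circleMap 0 ((2 * (‖Λ‖ + 1))⁻¹ * s') θ)‖ ≤
      |s - s'| / 2 := by
  have h0 := norm_nonneg Λ
  have hρ : (0 : ℝ) < (2 * (‖Λ‖ + 1))⁻¹ := by positivity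
  have heq : ‖circleMap 0 ((2 * (‖Λ‖ + 1))⁻¹ * s) θ - circleMap 0 ((2 * (‖Λ‖ + 1))⁻¹ * s') θ‖ =
      (2 * (‖Λ‖ + 1))⁻¹ * |s - s'| := by
    rw [circleMap_zero, circleMap_zero, ← sub_mul, norm_mul, Complex.norm_exp_ofReal_mul_I,
      mul_one, ← Complex.ofReal_sub, ← mul_sub, Complex.norm_real, Real.norm_eq_abs, abs_mul,
      abs_of_pos hρ]
  rw [← map_sub]
  refine (Λ.le_opNorm _).trans ?_
  rw [heq, ← mul_assoc, div_eq_inv_mul]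
  refine mul_le_mul_of_nonneg_right ?_ (abs_nonneg _)
  rw [mul_inv, mul_left_comm]
  exact mul_le_of_le_one_right (by norm_num)
    ((mul_inv_le_iff₀ (by positivity)).mpr (by linarith))

lemma continuous_uncurry_innerCircleMap {d : ℕ} (Λ : ℂ →L[ℝ] (Fin d → ℝ))
    (K : Set (Fin d → ℝ)) : Continuous (Function.uncurry (innerCircleMap Λ K)) := by
  have hδ : Continuous fun q : (Fin d → ℝ) × ℝ => Metric.infDist q.1 Kᶜ :=
    (Metric.continuous_infDist_pt _).comp continuous_fst
  unfold Function.uncurry innerCircleMap circleMap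
  fun_prop

lemma antilipschitzWith_innerCircleMap {d : ℕ} (Λ : ℂ →L[ℝ] (Fin d → ℝ))
    (K : Set (Fin d → ℝ)) (θ : ℝ) : AntilipschitzWith 2 fun x => innerCircleMap Λ K x θ := by
  refine AntilipschitzWith.of_le_mul_dist fun x y => ?_
  have h := norm_map_circleMap_sub_le Λ (Metric.infDist x Kᶜ) (Metric.infDist y Kᶜ) θ
  have hlip := (Metric.lipschitz_infDist_pt Kᶜ).dist_le_mul x y
  rw [Real.dist_eq, NNReal.coe_one, one_mul] at hlip
  have htri := norm_sub_le (innerCircleMap Λ K x θ - innerCircleMap Λ K y θ)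
    (Λ (circleMap 0 ((2 * (‖Λ‖ + 1))⁻¹ * Metric.infDist x Kᶜ) θ) -
      Λ (circleMap 0 ((2 * (‖Λ‖ + 1))⁻¹ * Metric.infDist y Kᶜ) θ))
  have heq : innerCircleMap Λ K x θ - innerCircleMap Λ K y θ -
    (Λ (circleMap 0 ((2 * (‖Λ‖ + 1))⁻¹ * Metric.infDist x Kᶜ) θ) -
      Λ (circleMap 0 ((2 * (‖Λ‖ + 1))⁻¹ * Metric.infDist y Kᶜ) θ)) = x - y := by
    unfold innerCircleMap; abel
  rw [heq, ← dist_eq_norm, ← dist_eq_norm] at htri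
  simp only [NNReal.coe_ofNat]
  linarith

lemma mapsTo_innerCircleMap {d : ℕ} (Λ : ℂ →L[ℝ] (Fin d → ℝ)) (K : Set (Fin d → ℝ)) (θ : ℝ) :
    Set.MapsTo (innerCircleMap Λ K · θ) K K := by
  intro x hx
  by_contra hy
  have h1 := Metric.infDist_le_dist_of_mem (x := x) (s := Kᶜ) hy
  have h2 := norm_map_circleMap_sub_le Λ (Metric.infDist x Kᶜ) 0 θ
  have h3 : dist x (innerCircleMap Λ K x θ) ≤ Metric.infDist x Kᶜ / 2 := by
    simpa [innerCircleMap, dist_eq_norm, abs_of_nonneg Metric.infDist_nonneg] using h2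
  have h4 : Metric.infDist x Kᶜ = 0 :=
    le_antisymm (by linarith) Metric.infDist_nonneg
  exact hy (by simpa [innerCircleMap, h4] using hx)

lemma abs_le_mul_infDist_compl_tsupport {d : ℕ} [NeZero d] {φ : (Fin d → ℝ) → ℝ} {L : NNReal}
    (hL : LipschitzWith L φ) (hφ : HasCompactSupport φ) (x : Fin d → ℝ) :
    |φ x| ≤ L * Metric.infDist x (tsupport φ)ᶜ := by
  have hne : (tsupport φ)ᶜ.Nonempty := Set.nonempty_compl.mpr hφ.isCompact.ne_univ
  obtain ⟨y₀, hy₀⟩ := hne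
  have hbd : ∀ y ∈ (tsupport φ)ᶜ, |φ x| ≤ L * dist x y := by
    intro y hy
    have h := hL.dist_le_mul x y
    rwa [image_eq_zero_of_notMem_tsupport hy, Real.dist_eq, sub_zero] at h
  rcases eq_or_lt_of_le (zero_le (a := L)) with h0 | h0
  · have := hbd y₀ hy₀
    simpa [← h0] using this
  · have hL0 : (0 : ℝ) < L := h0
    rw [← div_le_iff₀' hL0]
    exact (Metric.le_infDist ⟨y₀, hy₀⟩).mpr fun {y} hy => (div_le_iff₀' hL0).mpr (hbd y hy)

lemma real_add_rpow_le {x y p : ℝ} (hx : 0 ≤ x) (hy : 0 ≤ y) (hp : 1 ≤ p) :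
    (x + y) ^ p ≤ 2 ^ (p - 1) * (x ^ p + y ^ p) := by
  lift x to NNReal using hx
  lift y to NNReal using hy
  exact_mod_cast NNReal.rpow_add_le_mul_rpow_add_rpow x y hp

open Real in
lemma setAverage_rpow_le {f : ℝ → ℝ} (hf : Continuous f) (hf0 : ∀ θ, 0 ≤ f θ) {p : ℝ}
    (hp : 1 ≤ p) :
    (⨍ θ in Set.Ioc 0 (2 * π), f θ) ^ p ≤ ⨍ θ in Set.Ioc 0 (2 * π), f θ ^ p := by
  have hintOn : ∀ {f : ℝ → ℝ}, Continuous f → IntegrableOn f (Set.Ioc 0 (2 * π)) := fun hf =>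
    (hf.continuousOn.integrableOn_compact isCompact_Icc).mono_set Set.Ioc_subset_Icc_self
  have hp0 : 0 ≤ p := by linarith
  refine (convexOn_rpow hp).map_set_average_le (f := f)
    (continuous_id.rpow_const fun _ => Or.inr hp0).continuousOn isClosed_Ici ?_ ?_
    (Filter.Eventually.of_forall hf0) (hintOn hf)
    (hintOn (hf.rpow_const fun _ => Or.inr hp0))
  · simp [pi_pos]
  · exact measure_Ioc_lt_top.ne

open Real in
/-- Let `d ≥ 2`, `p = d/(d−1)`, let `P₀` be a symmetric matrix which is not
a symmetric tensor product `a ⊙ b`, and let `φ` be smooth with compact support `K`. Then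
there is `C > 0` such that every smooth `v` with `𝓔v(x) ∈ span{P₀}` everywhere satisfies
`‖𝓔(φ v)‖_{L^p(ℝ^d)} ≤ C ‖v‖_{L^p(K)}`. -/
theorem symGrad_multiplier_estimate {d : ℕ} (hd : 2 ≤ d)
    (P₀ : Matrix (Fin d) (Fin d) ℝ) (hP₀symm : P₀.IsSymm)
    (hP₀ : ∀ a b : Fin d → ℝ, P₀ ≠ symTensor a b)
    (φ : (Fin d → ℝ) → ℝ) (hφ : ContDiff ℝ (⊤ : ℕ∞) φ) (hφsupp : HasCompactSupport φ) :
    ∃ C > 0, ∀ v : (Fin d → ℝ) → (Fin d → ℝ), ContDiff ℝ (⊤ : ℕ∞) v →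
      (∀ x, ∃ t : ℝ, symGrad v x = t • P₀) →
      (∫ x : Fin d → ℝ, frobNorm (symGrad (fun y => φ y • v y) x) ^ ((d : ℝ) / ((d : ℝ) - 1)))
          ^ (((d : ℝ) - 1) / (d : ℝ))
        ≤ C * (∫ x in tsupport φ, eucNorm (v x) ^ ((d : ℝ) / ((d : ℝ) - 1)))
            ^ (((d : ℝ) - 1) / (d : ℝ)) := by
  have : NeZero d := ⟨by omega⟩
  obtain ⟨a, b, σ, hσ, haa, hbb, hab⟩ := exists_conformal_pair P₀ hP₀symm hP₀
  obtain ⟨L, hL⟩ := hφ.lipschitzWith_of_hasCompactSupport hφsupp (by simp)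
  have hd2 : (2 : ℝ) ≤ d := by exact_mod_cast hd
  have hinv : ((d : ℝ) - 1) / d = ((d : ℝ) / ((d : ℝ) - 1))⁻¹ := (inv_div _ _).symm
  rw [hinv]
  have hp : 1 ≤ (d : ℝ) / ((d : ℝ) - 1) := (one_le_div (by linarith)).mpr (by linarith)
  set p : ℝ := (d : ℝ) / ((d : ℝ) - 1)
  have hp0 : 0 < p := by linarith
  set Λ := planeMap a b
  set K := tsupport φ
  have hKc : IsCompact K := hφsupp.isCompact
  set c : ℝ := |σ|⁻¹ * ∑ i, ‖(a i : ℂ) + b i * Complex.I‖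
  have hc : 0 ≤ c := by positivity
  set N : ℝ := ∑ i, ∑ j, |P₀ i j|
  have hN : 0 ≤ N := by positivity
  set ρ : ℝ := (2 * (‖Λ‖ + 1))⁻¹
  have hρ : 0 < ρ := by positivity
  set A : ℝ := L * c * ρ⁻¹ * N
  have hA : 0 ≤ A := by positivity
  set B : ℝ := d ^ 2 * L
  have hB : 0 ≤ B := by positivity
  set D : ℝ := 2 ^ (p - 1) * (A ^ p * 2 ^ d + B ^ p)
  have hD : 0 ≤ D := by positivity
  refine ⟨D ^ p⁻¹ + 1, by positivity, fun v hv hsym => ?_⟩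
  choose t ht using hsym
  have hvd : Differentiable ℝ v := hv.differentiable (by simp)
  set w : (Fin d → ℝ) → ℝ := fun x => eucNorm (v x)
  have hw : Continuous w := continuous_eucNorm.comp hv.continuous
  have hw0 : ∀ x, 0 ≤ w x := fun x => eucNorm_nonneg _
  set T := innerCircleMap Λ K
  have hTc : Continuous (Function.uncurry T) := continuous_uncurry_innerCircleMap Λ K
  have hwT : ∀ x, Continuous fun θ => w (T x θ) := fun x =>
    hw.comp (hTc.comp (Continuous.prodMk_right x))
  have hav0 : ∀ x, 0 ≤ ⨍ θ in Set.Ioc 0 (2 * π), w (T x θ) := fun x => by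
    rw [setAverage_eq]
    exact smul_nonneg (inv_nonneg.mpr measureReal_nonneg) (integral_nonneg fun θ => hw0 _)
  have hφt : ∀ x, |φ x| * |t x| ≤ L * c * ρ⁻¹ * ⨍ θ in Set.Ioc 0 (2 * π), w (T x θ) := by
    intro x
    have hδ := abs_le_mul_infDist_compl_tsupport hL hφsupp x
    rcases eq_or_lt_of_le (Metric.infDist_nonneg (x := x) (s := Kᶜ)) with h0 | h0
    · rw [← h0, mul_zero] at hδ
      rw [le_antisymm hδ (abs_nonneg _), zero_mul]
      exact mul_nonneg (by positivity) (hav0 x)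
    · have h := abs_le_setAverage_of_symGrad_eq hσ haa hbb hab hvd ht x (mul_pos hρ h0)
      refine (mul_le_mul hδ h (abs_nonneg _) (by positivity)).trans (le_of_eq ?_)
      change L * Metric.infDist x Kᶜ * (c * ((ρ * Metric.infDist x Kᶜ)⁻¹ *
        ⨍ θ in Set.Ioc 0 (2 * π), w (T x θ))) = _
      field_simp
  have hpt : ∀ x, frobNorm (symGrad (fun y => φ y • v y) x) ^ p ≤
      2 ^ (p - 1) * (A ^ p * (⨍ θ in Set.Ioc 0 (2 * π), w (T x θ) ^ p) + B ^ p * w x ^ p) := by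
    intro x
    have h1 : frobNorm (symGrad (fun y => φ y • v y) x) ≤
        A * (⨍ θ in Set.Ioc 0 (2 * π), w (T x θ)) + B * w x := by
      refine (frobNorm_symGrad_smul_le (hφ.differentiable (by simp) x) (hvd x)
        (norm_fderiv_le_of_lipschitz ℝ hL) (ht x)).trans (add_le_add ?_ le_rfl)
      refine (mul_le_mul_of_nonneg_right (hφt x) hN).trans (le_of_eq ?_)
      ring
    have hA0 : 0 ≤ A * (⨍ θ in Set.Ioc 0 (2 * π), w (T x θ)) := mul_nonneg hA (hav0 x)
    have hB0 : 0 ≤ B * w x := mul_nonneg hB (hw0 x)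
    refine (rpow_le_rpow (Real.sqrt_nonneg _) h1 hp0.le).trans
      ((real_add_rpow_le hA0 hB0 hp).trans ?_)
    rw [mul_rpow hA (hav0 x), mul_rpow hB (hw0 x)]
    gcongr
    exact setAverage_rpow_le (hwT x) (fun θ => hw0 _) hp
  have hzero : ∀ x, x ∉ K → frobNorm (symGrad (fun y => φ y • v y) x) ^ p = 0 := by
    intro x hx
    have hev : (fun y => φ y • v y) =ᶠ[nhds x] fun _ => 0 := by
      filter_upwards [(isClosed_tsupport φ).isOpen_compl.mem_nhds hx] with y hy
      rw [image_eq_zero_of_notMem_tsupport hy, zero_smul]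
    simp [frobNorm, symGrad, hev.fderiv_eq, zero_rpow hp0.ne']
  obtain ⟨hTi, hTle⟩ := setIntegral_setAverage_rpow_le hKc hTc
    (antilipschitzWith_innerCircleMap Λ K) (mapsTo_innerCircleMap Λ K) hw hw0 hp
  have hwi : IntegrableOn (fun x => w x ^ p) K :=
    (hw.rpow_const fun _ => Or.inr hp0.le).continuousOn.integrableOn_compact hKc
  have hwI : 0 ≤ ∫ x in K, w x ^ p := integral_nonneg fun x => rpow_nonneg (hw0 x) p
  have hmain : ∫ x, frobNorm (symGrad (fun y => φ y • v y) x) ^ p ≤ D * ∫ x in K, w x ^ p := by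
    rw [← setIntegral_eq_integral_of_forall_compl_eq_zero hzero]
    calc _ ≤ ∫ x in K, 2 ^ (p - 1) * (A ^ p * (⨍ θ in Set.Ioc 0 (2 * π), w (T x θ) ^ p) +
            B ^ p * w x ^ p) :=
          integral_mono_of_nonneg
            (Filter.Eventually.of_forall fun x => rpow_nonneg (Real.sqrt_nonneg _) p)
            (((hTi.const_mul _).add (hwi.const_mul _)).const_mul _)
            (Filter.Eventually.of_forall hpt)
      _ = 2 ^ (p - 1) * (A ^ p * (∫ x in K, ⨍ θ in Set.Ioc 0 (2 * π), w (T x θ) ^ p) +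
            B ^ p * ∫ x in K, w x ^ p) := by
          rw [integral_const_mul, integral_add (hTi.const_mul _) (hwi.const_mul _),
            integral_const_mul, integral_const_mul]
      _ ≤ 2 ^ (p - 1) * (A ^ p * (2 ^ d * ∫ x in K, w x ^ p) + B ^ p * ∫ x in K, w x ^ p) := by
          gcongr
      _ = _ := by ring
  calc _ ≤ (D * ∫ x in K, w x ^ p) ^ p⁻¹ :=
        rpow_le_rpow (integral_nonneg fun x => rpow_nonneg (Real.sqrt_nonneg _) p) hmain
          (inv_nonneg.mpr hp0.le)
    _ = D ^ p⁻¹ * (∫ x in K, w x ^ p) ^ p⁻¹ := mul_rpow hD hwI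
    _ ≤ _ := mul_le_mul_of_nonneg_right (by linarith) (rpow_nonneg hwI _)
end

section
/- Let a, b ∈ ℝ² be linearly independent vectors and let u : ℝ² → ℝ² be smooth. Then 𝓔u(x) ∈ span{a ⊙ b} for every x ∈ ℝ² if and only if there exist smooth functions h₁, h₂ : ℝ → ℝ such that u(x) = h₁(x·a) b + h₂(x·b) a for all x ∈ ℝ². -/
open Matrix in
/-- The quadratic form of the symmetrized gradient is that of the full derivative. -/
theorem dotProduct_symGrad_mulVec_self {d : ℕ} (u : (Fin d → ℝ) → (Fin d → ℝ))
    (x v : Fin d → ℝ) : v ⬝ᵥ (symGrad u x *ᵥ v) = v ⬝ᵥ fderiv ℝ u x v := by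
  have hv : fderiv ℝ u x v = ∑ j, v j • fderiv ℝ u x (Pi.single j 1) := by
    have hs : v = ∑ j, v j • Pi.single j (1 : ℝ) := by
      ext i
      simp [Finset.sum_apply, Pi.single_apply]
    conv_lhs => rw [hs]
    simp only [map_sum, map_smul]
  have h : v ⬝ᵥ fderiv ℝ u x v =
      ∑ i, ∑ j, v i * v j * fderiv ℝ u x (Pi.single j 1) i := by
    rw [hv]
    simp [dotProduct, Finset.mul_sum, mul_assoc]
  have h' : v ⬝ᵥ fderiv ℝ u x v =
      ∑ i, ∑ j, v i * v j * fderiv ℝ u x (Pi.single i 1) j := by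
    rw [h, Finset.sum_comm]
    simp only [mul_comm (v _) (v _)]
  have hs : v ⬝ᵥ (symGrad u x *ᵥ v) = (v ⬝ᵥ fderiv ℝ u x v + v ⬝ᵥ fderiv ℝ u x v) / 2 := by
    nth_rewrite 1 [h]
    rw [h']
    simp only [dotProduct, mulVec, symGrad, Finset.mul_sum, ← Finset.sum_add_distrib,
      Finset.sum_div]
    refine Finset.sum_congr rfl fun i _ => Finset.sum_congr rfl fun j _ => ?_
    ring
  rw [hs]
  ring

open Matrix in
/-- If `v · ∂ᵥu` vanishes identically then `v · u` is constant along lines of direction `v`. -/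
theorem dotProduct_add_smul_eq_of_fderiv {d : ℕ} {u : (Fin d → ℝ) → (Fin d → ℝ)}
    (hu : Differentiable ℝ u) {v : Fin d → ℝ} (h : ∀ x, v ⬝ᵥ fderiv ℝ u x v = 0)
    (x : Fin d → ℝ) (c : ℝ) : v ⬝ᵥ u (x + c • v) = v ⬝ᵥ u x := by
  have hd : ∀ t : ℝ, HasDerivAt (fun t : ℝ => v ⬝ᵥ u (x + t • v)) 0 t := fun t => by
    have hl : HasDerivAt (fun t : ℝ => x + t • v) v t := by
      simpa using ((hasDerivAt_id t).smul_const v).const_add x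
    have hc := (hu (x + t • v)).hasFDerivAt.comp_hasDerivAt t hl
    rw [← h (x + t • v)]
    exact HasDerivAt.fun_sum fun i _ => ((hasDerivAt_pi.1 hc) i).const_mul (v i)
  simpa using is_const_of_deriv_eq_zero (fun t => (hd t).differentiableAt)
    (fun t => (hd t).deriv) c 0

open Matrix in
/-- The quadratic form of `a ⊙ b` is `v ↦ (v · a) (v · b)`. -/
theorem dotProduct_symTensor_mulVec_self {d : ℕ} (a b v : Fin d → ℝ) :
    v ⬝ᵥ (symTensor a b *ᵥ v) = (v ⬝ᵥ a) * (v ⬝ᵥ b) := by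
  have h : v ⬝ᵥ (symTensor a b *ᵥ v) =
      ((v ⬝ᵥ a) * (v ⬝ᵥ b) + (v ⬝ᵥ b) * (v ⬝ᵥ a)) / 2 := by
    simp only [dotProduct, mulVec, symTensor, Finset.sum_mul_sum]
    simp only [Finset.mul_sum, ← Finset.sum_add_distrib, Finset.sum_div]
    refine Finset.sum_congr rfl fun i _ => Finset.sum_congr rfl fun j _ => ?_
    ring
  rw [h]
  ring

/-- The symmetrized gradient of `x ↦ h₁(x·a) b + h₂(x·b) a` is `(h₁'(x·a) + h₂'(x·b)) a ⊙ b`. -/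
theorem symGrad_planeWaves {d : ℕ} (a b : Fin d → ℝ) {h₁ h₂ : ℝ → ℝ}
    (hh₁ : Differentiable ℝ h₁) (hh₂ : Differentiable ℝ h₂) (x : Fin d → ℝ) :
    symGrad (fun x => h₁ (∑ i, x i * a i) • b + h₂ (∑ i, x i * b i) • a) x =
      (deriv h₁ (∑ i, x i * a i) + deriv h₂ (∑ i, x i * b i)) • symTensor a b := by
  have hl : ∀ c : Fin d → ℝ, HasFDerivAt (fun x : Fin d → ℝ => ∑ i, x i * c i)
      (∑ i, c i • ContinuousLinearMap.proj (R := ℝ) (φ := fun _ : Fin d => ℝ) i) x := fun c =>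
    HasFDerivAt.fun_sum fun i _ => (hasFDerivAt_apply i x).mul_const (c i)
  have hf : HasFDerivAt
      (fun x : Fin d → ℝ => h₁ (∑ i, x i * a i) • b + h₂ (∑ i, x i * b i) • a) _ x :=
    (((hh₁ _).hasDerivAt.comp_hasFDerivAt x (hl a)).smul_const b).add
    (((hh₂ _).hasDerivAt.comp_hasFDerivAt x (hl b)).smul_const a)
  ext i j
  simp only [symGrad, hf.fderiv]
  simp [symTensor, Pi.single_apply]
  ring

/-- Let `a, b ∈ ℝ²` be linearly independent and `u : ℝ² → ℝ²` smooth. Then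
`𝓔u(x) ∈ span{a ⊙ b}` everywhere iff `u(x) = h₁(x·a) b + h₂(x·b) a` for smooth
`h₁, h₂ : ℝ → ℝ`. -/
theorem symGrad_span_symTensor_iff {a b : Fin 2 → ℝ}
    (hab : LinearIndependent ℝ ![a, b])
    (u : (Fin 2 → ℝ) → (Fin 2 → ℝ)) (hu : ContDiff ℝ (⊤ : ℕ∞) u) :
    (∀ x, ∃ t : ℝ, symGrad u x = t • symTensor a b) ↔
      ∃ h₁ h₂ : ℝ → ℝ, ContDiff ℝ (⊤ : ℕ∞) h₁ ∧ ContDiff ℝ (⊤ : ℕ∞) h₂ ∧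
        ∀ x, u x = h₁ (∑ i, x i * a i) • b + h₂ (∑ i, x i * b i) • a := by
  constructor
  · intro h
    have hD : a 0 * b 1 - a 1 * b 0 ≠ 0 := by
      have hu : IsUnit (Matrix.of ![a, b]) := Matrix.linearIndependent_rows_iff_isUnit.1 hab
      have hdet := ((Matrix.isUnit_iff_isUnit_det _).1 hu).ne_zero
      simpa [Matrix.det_fin_two] using hdet
    set D := a 0 * b 1 - a 1 * b 0 with hDdef
    have hconst : ∀ v : Fin 2 → ℝ, (v ⬝ᵥ a) * (v ⬝ᵥ b) = 0 → ∀ x (c : ℝ),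
        v ⬝ᵥ u (x + c • v) = v ⬝ᵥ u x := fun v hv =>
      dotProduct_add_smul_eq_of_fderiv (hu.differentiable (by simp)) fun y => by
        obtain ⟨t, ht⟩ := h y
        rw [← dotProduct_symGrad_mulVec_self, ht, Matrix.smul_mulVec, dotProduct_smul,
          dotProduct_symTensor_mulVec_self, hv, smul_zero]
    -- `e, f` is the basis dual to `a, b`.
    let e : Fin 2 → ℝ := ![b 1 / D, -b 0 / D]
    let f : Fin 2 → ℝ := ![-a 1 / D, a 0 / D]
    have he : e ⬝ᵥ b = 0 := by
      simp [e, dotProduct, Fin.sum_univ_two]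
      ring
    have hf : f ⬝ᵥ a = 0 := by
      simp [f, dotProduct, Fin.sum_univ_two]
      ring
    have hx : ∀ x : Fin 2 → ℝ, x = (∑ i, x i * a i) • e + (∑ i, x i * b i) • f := fun x => by
      ext i
      fin_cases i <;> simp [e, f, Fin.sum_univ_two] <;> field_simp <;> rw [hDdef] <;> ring
    have hdual : ∀ y : Fin 2 → ℝ, y = (f ⬝ᵥ y) • b + (e ⬝ᵥ y) • a := fun y => by
      ext i
      fin_cases i <;> simp [e, f, dotProduct, Fin.sum_univ_two] <;> field_simp <;>
        rw [hDdef] <;> ring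
    have hsmooth : ∀ v w : Fin 2 → ℝ, ContDiff ℝ (⊤ : ℕ∞) fun s : ℝ => v ⬝ᵥ u (s • w) :=
      fun v w => by
        have hc : ContDiff ℝ (⊤ : ℕ∞) fun s : ℝ => u (s • w) :=
          hu.comp (contDiff_id.smul contDiff_const)
        exact ContDiff.sum fun i _ => contDiff_const.mul (contDiff_pi.1 hc i)
    refine ⟨fun s => f ⬝ᵥ u (s • e), fun t => e ⬝ᵥ u (t • f), hsmooth f e, hsmooth e f,
      fun x => ?_⟩
    have h₁ := hconst f (by rw [hf, zero_mul]) ((∑ i, x i * a i) • e) (∑ i, x i * b i)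
    have h₂ := hconst e (by rw [he, mul_zero]) ((∑ i, x i * b i) • f) (∑ i, x i * a i)
    rw [← hx] at h₁
    rw [add_comm, ← hx] at h₂
    simp only [← h₁, ← h₂]
    exact hdual (u x)
  · rintro ⟨h₁, h₂, hh₁, hh₂, hux⟩ x
    rw [funext hux]
    exact ⟨_, symGrad_planeWaves a b (hh₁.differentiable (by simp))
      (hh₂.differentiable (by simp)) x⟩
end

section
/- Let d ≥ 2, let u : ℝ^d → ℝ^d be smooth and let g : ℝ^d → ℝ be smooth with 𝓔u(x) = g(x) (e₁ ⊙ e₂) for every x ∈ ℝ^d, where e₁, e₂ are the first two standard basis vectors. Then there exist a smooth function h : ℝ² → ℝ and real constants a₃, …, a_d such that g(x) = h(x₁, x₂) + a₃ x₃ + ⋯ + a_d x_d for all x ∈ ℝ^d. -/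
/-- The partial derivative of `f` along the `k`-th standard basis vector. -/
noncomputable def partialDeriv {n : ℕ} (k : Fin n) (f : (Fin n → ℝ) → ℝ) (x : Fin n → ℝ) : ℝ :=
  fderiv ℝ f x (Pi.single k 1)

theorem ContDiff.partialDeriv {n : ℕ} {f : (Fin n → ℝ) → ℝ} (hf : ContDiff ℝ (⊤ : ℕ∞) f)
    (k : Fin n) : ContDiff ℝ (⊤ : ℕ∞) (partialDeriv k f) :=
  (hf.fderiv_right (m := (⊤ : ℕ∞)) (by exact_mod_cast le_top)).clm_apply contDiff_const

theorem partialDeriv_add {n : ℕ} {f g : (Fin n → ℝ) → ℝ} (hf : ContDiff ℝ (⊤ : ℕ∞) f)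
    (hg : ContDiff ℝ (⊤ : ℕ∞) g) (k : Fin n) :
    partialDeriv k (f + g) = partialDeriv k f + partialDeriv k g := by
  funext x
  simp only [partialDeriv, Pi.add_apply]
  rw [fderiv_add (hf.differentiable (by simp) x) (hg.differentiable (by simp) x)]
  rfl

theorem partialDeriv_zero {n : ℕ} (k : Fin n) :
    partialDeriv k (0 : (Fin n → ℝ) → ℝ) = 0 := by
  funext x
  simp [partialDeriv]

theorem partialDeriv_comm {n : ℕ} {f : (Fin n → ℝ) → ℝ} (hf : ContDiff ℝ (⊤ : ℕ∞) f)
    (k l : Fin n) : partialDeriv k (partialDeriv l f) = partialDeriv l (partialDeriv k f) := by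
  funext x
  have hd : DifferentiableAt ℝ (fderiv ℝ f) x :=
    (hf.fderiv_right (m := (⊤ : ℕ∞)) (by exact_mod_cast le_top)).differentiable (by simp) x
  have key (a b : Fin n) : partialDeriv a (partialDeriv b f) x =
      fderiv ℝ (fderiv ℝ f) x (Pi.single a 1) (Pi.single b 1) := by
    change fderiv ℝ (fun y => fderiv ℝ f y (Pi.single b 1)) x (Pi.single a 1) = _
    rw [fderiv_clm_apply hd (differentiableAt_const _)]
    simp
  rw [key, key]
  exact (hf.contDiffAt.isSymmSndFDerivAt
    (by simpa using WithTop.coe_le_coe.2 (le_top : (2 : ℕ∞) ≤ ⊤))) _ _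

theorem fderiv_apply_eq_sum_partialDeriv {n : ℕ} (f : (Fin n → ℝ) → ℝ) (x v : Fin n → ℝ) :
    fderiv ℝ f x v = ∑ k, v k * partialDeriv k f x := by
  conv_lhs => rw [pi_eq_sum_univ' v]
  simp only [map_sum, map_smul, smul_eq_mul, partialDeriv]

/-- The Saint-Venant compatibility conditions for the symmetrized gradient. -/
theorem saintVenant {n : ℕ} {U : Fin n → (Fin n → ℝ) → ℝ} (hU : ∀ i, ContDiff ℝ (⊤ : ℕ∞) (U i))
    {e : Fin n → Fin n → (Fin n → ℝ) → ℝ}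
    (he : ∀ i j, e i j = partialDeriv j (U i) + partialDeriv i (U j)) (i j k l : Fin n) :
    partialDeriv k (partialDeriv l (e i j)) + partialDeriv i (partialDeriv j (e k l)) =
      partialDeriv i (partialDeriv l (e k j)) + partialDeriv k (partialDeriv j (e i l)) := by
  have expand (a b p q : Fin n) : partialDeriv a (partialDeriv b (e p q)) =
      partialDeriv a (partialDeriv b (partialDeriv q (U p))) +
        partialDeriv a (partialDeriv b (partialDeriv p (U q))) := by
    rw [he, partialDeriv_add ((hU p).partialDeriv q) ((hU q).partialDeriv p),
      partialDeriv_add (((hU p).partialDeriv q).partialDeriv b)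
        (((hU q).partialDeriv p).partialDeriv b)]
  rw [expand, expand, expand, expand,
    partialDeriv_comm (hU i) l j, partialDeriv_comm (hU k) j l,
    partialDeriv_comm ((hU j).partialDeriv i) k l, partialDeriv_comm (hU j) k i,
    partialDeriv_comm ((hU j).partialDeriv k) i l,
    partialDeriv_comm ((hU l).partialDeriv i) k j, partialDeriv_comm (hU l) k i,
    partialDeriv_comm ((hU l).partialDeriv k) i j]
  abel

/-- If `𝓔u = g (e₁ ⊙ e₂)`, then every second partial derivative of `g` in which at least one
direction is not `e₁` or `e₂` vanishes. -/
theorem partialDeriv_partialDeriv_eq_zero {d : ℕ}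
    {u : (Fin (d + 2) → ℝ) → (Fin (d + 2) → ℝ)} {g : (Fin (d + 2) → ℝ) → ℝ}
    (hu : ContDiff ℝ (⊤ : ℕ∞) u) (hg : ContDiff ℝ (⊤ : ℕ∞) g)
    (heq : ∀ x, symGrad u x = g x • symTensor (Pi.single 0 1) (Pi.single 1 1))
    {k : Fin (d + 2)} (hk : 2 ≤ (k : ℕ)) (l : Fin (d + 2)) :
    partialDeriv l (partialDeriv k g) = 0 := by
  set U : Fin (d + 2) → (Fin (d + 2) → ℝ) → ℝ := fun i x => u x i with hUdef
  have hU (i : Fin (d + 2)) : ContDiff ℝ (⊤ : ℕ∞) (U i) := contDiff_pi.1 hu i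
  set e : Fin (d + 2) → Fin (d + 2) → (Fin (d + 2) → ℝ) → ℝ :=
    fun i j => partialDeriv j (U i) + partialDeriv i (U j) with hedef
  have hpartial (i j : Fin (d + 2)) (x : Fin (d + 2) → ℝ) :
      partialDeriv j (U i) x = fderiv ℝ u x (Pi.single j 1) i := by
    have hd := hu.differentiable (by simp) x
    simp only [partialDeriv, hUdef]
    rw [fderiv_apply (i := i) hd]
    rfl
  have he (i j : Fin (d + 2)) (x : Fin (d + 2) → ℝ) :
      e i j x = g x * ((Pi.single 0 1 : Fin (d + 2) → ℝ) i * (Pi.single 1 1 : Fin (d + 2) → ℝ) j +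
        (Pi.single 1 1 : Fin (d + 2) → ℝ) i * (Pi.single 0 1 : Fin (d + 2) → ℝ) j) := by
    have h := congrFun (congrFun (heq x) i) j
    simp only [symGrad, Matrix.smul_apply, symTensor, smul_eq_mul] at h
    simp only [hedef, Pi.add_apply, hpartial]
    linarith
  have hk0 : k ≠ 0 := by
    rintro rfl
    simp at hk
  have hk1 : k ≠ 1 := by
    rintro rfl
    simp at hk
  have e01 : e 0 1 = g := by
    funext x
    simp [he]
  have e00 : e 0 0 = 0 := by
    funext x
    simp [he]
  have e11 : e 1 1 = 0 := by
    funext x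
    simp [he]
  have ekl (m : Fin (d + 2)) : e k m = 0 := by
    funext x
    simp [he, hk0, hk1]
  have elk (m : Fin (d + 2)) : e m k = 0 := by
    funext x
    simp [he, hk0, hk1]
  have sv := saintVenant hU (e := e) (fun _ _ => rfl)
  by_cases hl : l = 1
  · subst hl
    simpa [e01, e11, elk, partialDeriv_zero] using sv 0 1 1 k
  · rw [partialDeriv_comm hg]
    have e0l : e 0 l = 0 := by
      funext x
      simp [he, hl]
    simpa [e01, ekl, e0l, partialDeriv_zero] using sv 0 1 k l

/-- A differentiable function whose derivative in the fixed direction `v` is the constant `c`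
grows by `c` from `y` to `y + v`. -/
theorem eq_add_of_fderiv_apply_eq {E : Type*} [NormedAddCommGroup E] [NormedSpace ℝ E]
    {f : E → ℝ} (hf : Differentiable ℝ f) {v : E} {c : ℝ} (h : ∀ z, fderiv ℝ f z v = c) (y : E) :
    f (y + v) = f y + c := by
  have hderiv (t : ℝ) : HasDerivAt (fun t : ℝ => f (y + t • v) - t * c) 0 t := by
    have h1 : HasDerivAt (fun t : ℝ => y + t • v) v t := by
      simpa using ((hasDerivAt_id t).smul_const v).const_add y
    have h2 := (hf (y + t • v)).hasFDerivAt.comp_hasDerivAt t h1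
    rw [h] at h2
    have h3 := h2.sub ((hasDerivAt_id t).mul_const c)
    rw [one_mul, sub_self] at h3
    exact h3
  have hconst := is_const_of_deriv_eq_zero (fun t => (hderiv t).differentiableAt)
    (fun t => (hderiv t).deriv) 1 0
  simp at hconst
  linarith

/-- (`d + 2` plays the role of the dimension `d ≥ 2`.) If `u : ℝ^d → ℝ^d` and
`g : ℝ^d → ℝ` are smooth with `𝓔u(x) = g(x)(e₁ ⊙ e₂)` everywhere, then
`g(x) = h(x₁, x₂) + a₃x₃ + ⋯ + a_d x_d` for a smooth `h : ℝ² → ℝ` and constants `a₃, …, a_d`. -/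
theorem symGrad_e1e2_structure {d : ℕ}
    (u : (Fin (d + 2) → ℝ) → (Fin (d + 2) → ℝ)) (g : (Fin (d + 2) → ℝ) → ℝ)
    (hu : ContDiff ℝ (⊤ : ℕ∞) u) (hg : ContDiff ℝ (⊤ : ℕ∞) g)
    (heq : ∀ x, symGrad u x = g x • symTensor (Pi.single 0 1) (Pi.single 1 1)) :
    ∃ (h : ℝ → ℝ → ℝ) (a : Fin (d + 2) → ℝ),
      ContDiff ℝ (⊤ : ℕ∞) (fun p : ℝ × ℝ => h p.1 p.2) ∧
      ∀ x, g x = h (x 0) (x 1) + ∑ i : Fin (d + 2), (if 2 ≤ (i : ℕ) then a i * x i else 0) := by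
  have hconst (k : Fin (d + 2)) (hk : 2 ≤ (k : ℕ)) (x : Fin (d + 2) → ℝ) :
      partialDeriv k g x = partialDeriv k g 0 := by
    refine is_const_of_fderiv_eq_zero ((hg.partialDeriv k).differentiable (by simp)) (fun y => ?_) x 0
    ext1 v
    rw [fderiv_apply_eq_sum_partialDeriv]
    simp [partialDeriv_partialDeriv_eq_zero hu hg heq hk]
  refine ⟨fun s t => g (Pi.single 0 s + Pi.single 1 t), fun k => partialDeriv k g 0, ?_, fun x => ?_⟩
  · refine hg.comp (ContDiff.add ?_ ?_)
    · exact (ContinuousLinearMap.single ℝ (fun _ : Fin (d + 2) => ℝ) 0).contDiff.comp contDiff_fst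
    · exact (ContinuousLinearMap.single ℝ (fun _ : Fin (d + 2) => ℝ) 1).contDiff.comp contDiff_snd
  · set y : Fin (d + 2) → ℝ := Pi.single 0 (x 0) + Pi.single 1 (x 1) with hy
    have hv (z : Fin (d + 2) → ℝ) : fderiv ℝ g z (x - y) =
        ∑ i : Fin (d + 2), (if 2 ≤ (i : ℕ) then partialDeriv i g 0 * x i else 0) := by
      rw [fderiv_apply_eq_sum_partialDeriv]
      refine Finset.sum_congr rfl fun i _ => ?_
      split_ifs with hi
      · have hi0 : i ≠ 0 := by
          rintro rfl
          simp at hi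
        have hi1 : i ≠ 1 := by
          rintro rfl
          simp at hi
        rw [hconst i hi z]
        simp [hy, hi0, hi1, mul_comm]
      · have hi' : i = 0 ∨ i = 1 := by
          simp only [Fin.ext_iff, Fin.val_zero, Fin.val_one]
          omega
        rcases hi' with rfl | rfl <;> simp [hy]
    simpa using eq_add_of_fderiv_apply_eq (hg.differentiable (by simp)) hv y
end

section
/- Let a, b ∈ ℝ² be linearly independent vectors and let g : ℝ² → ℝ be smooth. Then there exists a smooth function u : ℝ² → ℝ² solving 𝓔u(x) = g(x) (a ⊙ b) for all x ∈ ℝ² if and only if there exist smooth functions h₁, h₂ : ℝ → ℝ such that g(x) = h₁(x·a) + h₂(x·b) for all x ∈ ℝ². -/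
open Matrix


/-- A function on `E` whose derivative in direction `v` vanishes everywhere has a derivative
invariant under translation along `v`. -/
theorem fderiv_add_smul_of_fderiv_apply_eq_zero {E : Type*} [NormedAddCommGroup E]
    [NormedSpace ℝ E] {φ : E → ℝ} (hφ : Differentiable ℝ φ) {v : E}
    (hv : ∀ x, fderiv ℝ φ x v = 0) (x : E) (t : ℝ) :
    fderiv ℝ φ (x + t • v) = fderiv ℝ φ x := by
  have hline (y : E) (s : ℝ) : HasDerivAt (fun s : ℝ => φ (y + s • v)) 0 s := by
    have h := (hφ (y + s • v)).hasFDerivAt.comp_hasDerivAt s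
      (((hasDerivAt_id s).smul_const v).const_add y)
    simpa [hv, Function.comp_def] using h
  have htrans : (fun y => φ (y + t • v)) = φ := by
    funext y
    have h := is_const_of_deriv_eq_zero (fun s => (hline y s).differentiableAt)
      (fun s => (hline y s).deriv) t 0
    simpa using h
  rw [← fderiv_comp_add_right, htrans]

theorem exists_contDiff_hasDerivAt {h : ℝ → ℝ} (hh : ContDiff ℝ (⊤ : ℕ∞) h) :
    ∃ H : ℝ → ℝ, ContDiff ℝ (⊤ : ℕ∞) H ∧ ∀ s, HasDerivAt H (h s) s := by
  have hderiv (s : ℝ) : HasDerivAt (fun s => ∫ r in (0 : ℝ)..s, h r) (h s) s :=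
    hh.continuous.integral_hasStrictDerivAt 0 s |>.hasDerivAt
  refine ⟨_, contDiff_infty_iff_deriv.2 ⟨fun s => (hderiv s).differentiableAt, ?_⟩, hderiv⟩
  rwa [show deriv _ = h from funext fun s => (hderiv s).deriv]

theorem two_mul_dotProduct_symGrad_mulVec {d : ℕ} (u : (Fin d → ℝ) → (Fin d → ℝ))
    (x v w : Fin d → ℝ) :
    2 * (v ⬝ᵥ symGrad u x *ᵥ w) = v ⬝ᵥ fderiv ℝ u x w + w ⬝ᵥ fderiv ℝ u x v := by
  have hexp (v w : Fin d → ℝ) : v ⬝ᵥ fderiv ℝ u x w =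
      ∑ i, ∑ j, v i * (w j * fderiv ℝ u x (Pi.single j 1) i) := by
    conv_lhs => rw [pi_eq_sum_univ' w]
    simp [dotProduct, Finset.mul_sum]
  rw [hexp, hexp w, Finset.sum_comm (f := fun i j => w i * (v j * _)), ← Finset.sum_add_distrib]
  simp only [dotProduct, mulVec, symGrad, Finset.mul_sum]
  refine Finset.sum_congr rfl fun i _ => ?_
  rw [← Finset.sum_add_distrib]
  exact Finset.sum_congr rfl fun j _ => by ring

theorem two_mul_dotProduct_symTensor_mulVec {d : ℕ} (a b v w : Fin d → ℝ) :
    2 * (v ⬝ᵥ symTensor a b *ᵥ w) = (v ⬝ᵥ a) * (w ⬝ᵥ b) + (v ⬝ᵥ b) * (w ⬝ᵥ a) := by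
  simp only [dotProduct, Finset.sum_mul_sum]
  simp only [mulVec, dotProduct, symTensor, Finset.mul_sum]
  rw [← Finset.sum_add_distrib]
  refine Finset.sum_congr rfl fun i _ => ?_
  rw [← Finset.sum_add_distrib]
  exact Finset.sum_congr rfl fun j _ => by ring

/-- If `𝓔u = g (a ⊙ b)` then testing with a pair of vectors determines the symmetric part of
`Du`. -/
theorem dotProduct_fderiv_add_of_symGrad_eq {d : ℕ} {u : (Fin d → ℝ) → (Fin d → ℝ)}
    {x a b : Fin d → ℝ} {c : ℝ} (h : symGrad u x = c • symTensor a b) (v w : Fin d → ℝ) :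
    v ⬝ᵥ fderiv ℝ u x w + w ⬝ᵥ fderiv ℝ u x v =
      c * ((v ⬝ᵥ a) * (w ⬝ᵥ b) + (v ⬝ᵥ b) * (w ⬝ᵥ a)) := by
  rw [← two_mul_dotProduct_symGrad_mulVec, h, smul_mulVec, dotProduct_smul, smul_eq_mul,
    ← two_mul_dotProduct_symTensor_mulVec]
  ring

theorem exists_dual_basis_of_linearIndependent {a b : Fin 2 → ℝ}
    (hab : LinearIndependent ℝ ![a, b]) :
    ∃ p q : Fin 2 → ℝ, p ⬝ᵥ a = 1 ∧ p ⬝ᵥ b = 0 ∧ q ⬝ᵥ a = 0 ∧ q ⬝ᵥ b = 1 ∧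
      ∀ x, x = (x ⬝ᵥ a) • p + (x ⬝ᵥ b) • q := by
  have hdet : a 0 * b 1 - a 1 * b 0 ≠ 0 := by
    have h := ((Matrix.isUnit_iff_isUnit_det _).1
      (Matrix.linearIndependent_rows_iff_isUnit (A := Matrix.of ![a, b]).1 hab)).ne_zero
    simpa [Matrix.det_fin_two] using h
  set D := a 0 * b 1 - a 1 * b 0 with hD
  refine ⟨![b 1 / D, -b 0 / D], ![-a 1 / D, a 0 / D], ?_, ?_, ?_, ?_, fun x => ?_⟩
  case refine_5 =>
    ext i
    fin_cases i <;> simp [dotProduct, Fin.sum_univ_two] <;> field_simp <;> rw [hD] <;> ring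
  all_goals
    simp [dotProduct, Fin.sum_univ_two]
    field_simp
    try rw [hD]
    try ring

theorem hasFDerivAt_dotProduct_right {d : ℕ} (v x : Fin d → ℝ) :
    HasFDerivAt (fun x => x ⬝ᵥ v)
      (∑ i, v i • (ContinuousLinearMap.proj i : (Fin d → ℝ) →L[ℝ] ℝ)) x := by
  refine HasFDerivAt.congr_of_eventuallyEq (ContinuousLinearMap.hasFDerivAt _)
    (Filter.Eventually.of_forall fun y => ?_)
  simp [dotProduct, mul_comm]

theorem symGrad_smul_add_smul {d : ℕ} {H₁ H₂ h₁ h₂ : ℝ → ℝ}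
    (hH₁ : ∀ s, HasDerivAt H₁ (h₁ s) s) (hH₂ : ∀ s, HasDerivAt H₂ (h₂ s) s)
    (a b x : Fin d → ℝ) :
    symGrad (fun x => H₁ (x ⬝ᵥ a) • b + H₂ (x ⬝ᵥ b) • a) x =
      (h₁ (x ⬝ᵥ a) + h₂ (x ⬝ᵥ b)) • symTensor a b := by
  have h := (((hH₁ _).comp_hasFDerivAt x (hasFDerivAt_dotProduct_right a x)).smul_const b).add
    (((hH₂ _).comp_hasFDerivAt x (hasFDerivAt_dotProduct_right b x)).smul_const a)
  ext i j
  have h' := h.fderiv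
  simp only [Function.comp_def] at h'
  simp only [symGrad, symTensor, Matrix.smul_apply]
  erw [h']
  simp [Pi.single_apply]
  ring

/-- Pairing a smooth vector field with `w` and differentiating in direction `v` at `s • v`. -/
theorem contDiff_dotProduct_fderiv_smul {d : ℕ} {u : (Fin d → ℝ) → (Fin d → ℝ)}
    (hu : ContDiff ℝ (⊤ : ℕ∞) u) (v w : Fin d → ℝ) :
    ContDiff ℝ (⊤ : ℕ∞) fun s : ℝ => w ⬝ᵥ fderiv ℝ u (s • v) v := by
  have h : ContDiff ℝ (⊤ : ℕ∞) fun s : ℝ => fderiv ℝ u (s • v) v :=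
    ((hu.fderiv_right (m := (⊤ : ℕ∞)) (by simp)).comp
      (contDiff_id.smul contDiff_const)).clm_apply contDiff_const
  exact ContDiff.sum fun i _ => contDiff_const.mul (contDiff_pi.1 h i)

theorem dotProduct_fderiv_add_smul {d : ℕ} {u : (Fin d → ℝ) → (Fin d → ℝ)}
    (hu : Differentiable ℝ u) {w : Fin d → ℝ} (hw : ∀ x, w ⬝ᵥ fderiv ℝ u x w = 0)
    (x v : Fin d → ℝ) (t : ℝ) :
    w ⬝ᵥ fderiv ℝ u (x + t • w) v = w ⬝ᵥ fderiv ℝ u x v := by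
  have hφ (x : Fin d → ℝ) : HasFDerivAt (fun x => w ⬝ᵥ u x)
      ((∑ i, w i • (ContinuousLinearMap.proj i : (Fin d → ℝ) →L[ℝ] ℝ)) ∘L fderiv ℝ u x) x := by
    have h := (hasFDerivAt_dotProduct_right w (u x)).comp x (hu x).hasFDerivAt
    simpa only [Function.comp_def, dotProduct_comm] using h
  have hφ' (x v : Fin d → ℝ) :
      fderiv ℝ (fun x => w ⬝ᵥ u x) x v = w ⬝ᵥ fderiv ℝ u x v := by
    rw [(hφ x).fderiv]
    simp [dotProduct]
  rw [← hφ', ← hφ', fderiv_add_smul_of_fderiv_apply_eq_zero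
    (fun x => (hφ x).differentiableAt) fun x => (hφ' x w).trans (hw x)]

/-- Let `a, b ∈ ℝ²` be linearly independent and `g : ℝ² → ℝ` smooth. Then
the equation `𝓔u = g (a ⊙ b)` has a smooth solution `u : ℝ² → ℝ²` iff
`g(x) = h₁(x·a) + h₂(x·b)` for smooth `h₁, h₂ : ℝ → ℝ`. -/
theorem solvable_symTensor_iff_split {a b : Fin 2 → ℝ}
    (hab : LinearIndependent ℝ ![a, b])
    (g : (Fin 2 → ℝ) → ℝ) (hg : ContDiff ℝ (⊤ : ℕ∞) g) :
    (∃ u : (Fin 2 → ℝ) → (Fin 2 → ℝ), ContDiff ℝ (⊤ : ℕ∞) u ∧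
        ∀ x, symGrad u x = g x • symTensor a b) ↔
      ∃ h₁ h₂ : ℝ → ℝ, ContDiff ℝ (⊤ : ℕ∞) h₁ ∧ ContDiff ℝ (⊤ : ℕ∞) h₂ ∧
        ∀ x, g x = h₁ (∑ i, x i * a i) + h₂ (∑ i, x i * b i) := by
  change _ ↔ ∃ h₁ h₂ : ℝ → ℝ, ContDiff ℝ (⊤ : ℕ∞) h₁ ∧ ContDiff ℝ (⊤ : ℕ∞) h₂ ∧
    ∀ x, g x = h₁ (x ⬝ᵥ a) + h₂ (x ⬝ᵥ b)
  constructor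
  · rintro ⟨u, hu, hE⟩
    obtain ⟨p, q, hpa, hpb, hqa, hqb, hpq⟩ := exists_dual_basis_of_linearIndependent hab
    have hd : Differentiable ℝ u := hu.differentiable (by simp)
    have hp (x : Fin 2 → ℝ) : p ⬝ᵥ fderiv ℝ u x p = 0 := by
      have h := dotProduct_fderiv_add_of_symGrad_eq (hE x) p p
      rw [hpb] at h
      linarith
    have hq (x : Fin 2 → ℝ) : q ⬝ᵥ fderiv ℝ u x q = 0 := by
      have h := dotProduct_fderiv_add_of_symGrad_eq (hE x) q q
      rw [hqa] at h
      linarith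
    refine ⟨_, _, contDiff_dotProduct_fderiv_smul hu p q, contDiff_dotProduct_fderiv_smul hu q p,
      fun x => ?_⟩
    have h := dotProduct_fderiv_add_of_symGrad_eq (hE x) p q
    rw [hpa, hpb, hqa, hqb] at h
    have h₁ := dotProduct_fderiv_add_smul hd hq ((x ⬝ᵥ a) • p) p (x ⬝ᵥ b)
    have h₂ := dotProduct_fderiv_add_smul hd hp ((x ⬝ᵥ b) • q) q (x ⬝ᵥ a)
    rw [← hpq] at h₁
    rw [add_comm, ← hpq] at h₂
    linarith
  · rintro ⟨h₁, h₂, hh₁, hh₂, hgh⟩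
    obtain ⟨H₁, hH₁, hd₁⟩ := exists_contDiff_hasDerivAt hh₁
    obtain ⟨H₂, hH₂, hd₂⟩ := exists_contDiff_hasDerivAt hh₂
    have hdot (v : Fin 2 → ℝ) : ContDiff ℝ (⊤ : ℕ∞) fun x : Fin 2 → ℝ => x ⬝ᵥ v :=
      ContDiff.sum fun i _ => (contDiff_apply ℝ ℝ i).mul contDiff_const
    refine ⟨fun x => H₁ (x ⬝ᵥ a) • b + H₂ (x ⬝ᵥ b) • a,
      ((hH₁.comp (hdot a)).smul contDiff_const).add ((hH₂.comp (hdot b)).smul contDiff_const),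
      fun x => ?_⟩
    rw [symGrad_smul_add_smul hd₁ hd₂, hgh]
end

section
/- Let g : ℝ² → ℝ be smooth. Then there exists a smooth function u : ℝ² → ℝ² solving 𝓔u(x) = g(x) (e₁ ⊗ e₁) for all x ∈ ℝ² (where e₁ is the first standard basis vector) if and only if there exist smooth functions h, p : ℝ → ℝ such that g(x) = h(x₁) + p(x₁) x₂ for all x = (x₁, x₂) ∈ ℝ². -/
open scoped ContDiff

theorem ContDiff.exists_contDiff_hasDerivAt {f : ℝ → ℝ} (hf : ContDiff ℝ ∞ f) :
    ∃ F : ℝ → ℝ, ContDiff ℝ ∞ F ∧ ∀ t, HasDerivAt F (f t) t := by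
  have hF : ∀ t, HasDerivAt (fun s => ∫ r in (0 : ℝ)..s, f r) (f t) t :=
    fun t => hf.continuous.integral_hasStrictDerivAt 0 t |>.hasDerivAt
  refine ⟨_, contDiff_infty_iff_deriv.2 ⟨fun t => (hF t).differentiableAt, ?_⟩, hF⟩
  rwa [show deriv (fun s => ∫ r in (0 : ℝ)..s, f r) = f from funext fun t => (hF t).deriv]

theorem ContDiff.deriv_infty {f : ℝ → ℝ} (hf : ContDiff ℝ ∞ f) : ContDiff ℝ ∞ (deriv f) :=
  (contDiff_infty_iff_deriv.1 hf).2

theorem hasDerivAt_comp_vec_fst {u : (Fin 2 → ℝ) → (Fin 2 → ℝ)} (hu : Differentiable ℝ u)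
    (i : Fin 2) (t s : ℝ) :
    HasDerivAt (fun r => u ![r, s] i) (fderiv ℝ u ![t, s] (Pi.single 0 1) i) t := by
  have hline : HasDerivAt (fun r : ℝ => (![r, s] : Fin 2 → ℝ)) (Pi.single 0 1) t := by
    refine hasDerivAt_pi.2 fun j => ?_
    fin_cases j
    · simpa using hasDerivAt_id' t
    · simpa using hasDerivAt_const t s
  exact hasDerivAt_pi.1 ((hu ![t, s]).hasFDerivAt.comp_hasDerivAt t hline) i

theorem hasDerivAt_comp_vec_snd {u : (Fin 2 → ℝ) → (Fin 2 → ℝ)} (hu : Differentiable ℝ u)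
    (i : Fin 2) (t s : ℝ) :
    HasDerivAt (fun r => u ![t, r] i) (fderiv ℝ u ![t, s] (Pi.single 1 1) i) s := by
  have hline : HasDerivAt (fun r : ℝ => (![t, r] : Fin 2 → ℝ)) (Pi.single 1 1) s := by
    refine hasDerivAt_pi.2 fun j => ?_
    fin_cases j
    · simpa using hasDerivAt_const s t
    · simpa using hasDerivAt_id' s
  exact hasDerivAt_pi.1 ((hu ![t, s]).hasFDerivAt.comp_hasDerivAt s hline) i

theorem eq_add_mul_of_hasDerivAt_const {f : ℝ → ℝ} {c : ℝ} (hf : ∀ s, HasDerivAt f c s) (s : ℝ) :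
    f s = f 0 + c * s := by
  have hd : ∀ r, HasDerivAt (fun r => f r - c * r) 0 r := fun r => by
    simpa using (hf r).fun_sub ((hasDerivAt_id' r).const_mul c)
  have h := is_const_of_deriv_eq_zero (fun r => (hd r).differentiableAt) (fun r => (hd r).deriv) s 0
  simp only [mul_zero, sub_zero] at h
  linarith

theorem symGrad_eq_smul_e1e1_iff (u : (Fin 2 → ℝ) → (Fin 2 → ℝ)) (x : Fin 2 → ℝ) (c : ℝ) :
    symGrad u x = c • Matrix.vecMulVec (Pi.single 0 1) (Pi.single 0 1) ↔
      fderiv ℝ u x (Pi.single 0 1) 0 = c ∧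
      fderiv ℝ u x (Pi.single 1 1) 0 = - fderiv ℝ u x (Pi.single 0 1) 1 ∧
      fderiv ℝ u x (Pi.single 1 1) 1 = 0 := by
  rw [← Matrix.ext_iff]
  simp only [Fin.forall_fin_two, symGrad, Matrix.smul_apply, Matrix.vecMulVec_apply, smul_eq_mul,
    Pi.single_eq_same, Pi.single_eq_of_ne (one_ne_zero : (1 : Fin 2) ≠ 0), mul_zero, mul_one]
  constructor
  · rintro ⟨⟨h₁, h₂⟩, -, h₃⟩
    refine ⟨?_, ?_, ?_⟩ <;> linarith
  · rintro ⟨h₁, h₂, h₃⟩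
    refine ⟨⟨?_, ?_⟩, ?_, ?_⟩ <;> linarith

/-- For smooth `g : ℝ² → ℝ`, the equation `𝓔u = g (e₁ ⊗ e₁)` has a smooth
solution `u : ℝ² → ℝ²` iff `g(x) = h(x₁) + p(x₁) x₂` for smooth `h, p : ℝ → ℝ`. -/
theorem solvable_e1e1_iff (g : (Fin 2 → ℝ) → ℝ) (hg : ContDiff ℝ (⊤ : ℕ∞) g) :
    (∃ u : (Fin 2 → ℝ) → (Fin 2 → ℝ), ContDiff ℝ (⊤ : ℕ∞) u ∧
        ∀ x, symGrad u x = g x • Matrix.vecMulVec (Pi.single 0 1) (Pi.single 0 1)) ↔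
      ∃ h p : ℝ → ℝ, ContDiff ℝ (⊤ : ℕ∞) h ∧ ContDiff ℝ (⊤ : ℕ∞) p ∧
        ∀ x, g x = h (x 0) + p (x 0) * x 1 := by
  simp only [symGrad_eq_smul_e1e1_iff]
  have hvec : ∀ x : Fin 2 → ℝ, ![x 0, x 1] = x := fun x => by
    ext j; fin_cases j <;> rfl
  constructor
  · rintro ⟨u, hu, hE⟩
    have hud : Differentiable ℝ u := hu.differentiable (by simp)
    have hsmooth : ∀ i, ContDiff ℝ ∞ (fun t : ℝ => u ![t, 0] i) := fun i => by
      refine contDiff_pi.1 (hu.comp (contDiff_pi.2 fun j => ?_)) i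
      fin_cases j
      · exact contDiff_id
      · exact contDiff_const
    set a : ℝ → ℝ := fun t => u ![t, 0] 0
    set b : ℝ → ℝ := fun t => u ![t, 0] 1
    have ha : ContDiff ℝ ∞ (deriv a) := (hsmooth 0).deriv_infty
    have hb : ContDiff ℝ ∞ (deriv b) := (hsmooth 1).deriv_infty
    have hu₁ : ∀ t s, u ![t, s] 1 = b t := fun t s => by
      have := eq_add_mul_of_hasDerivAt_const
        (fun r => (hE ![t, r]).2.2 ▸ hasDerivAt_comp_vec_snd hud 1 t r) s
      simpa using this
    have hb' : ∀ t s, fderiv ℝ u ![t, s] (Pi.single 0 1) 1 = deriv b t := fun t s => by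
      have := hasDerivAt_comp_vec_fst hud 1 t s
      simp only [hu₁] at this
      exact this.deriv.symm
    have hu₀ : ∀ t s, u ![t, s] 0 = a t + -deriv b t * s := fun t s =>
      eq_add_mul_of_hasDerivAt_const (fun r => by
        have := hasDerivAt_comp_vec_snd hud 0 t r
        rwa [(hE ![t, r]).2.1, hb'] at this) s
    refine ⟨deriv a, fun t => -deriv (deriv b) t, ha, hb.deriv_infty.neg, fun x => ?_⟩
    have h₁ := hasDerivAt_comp_vec_fst hud 0 (x 0) (x 1)
    simp only [hu₀, hvec, (hE x).1] at h₁
    have h₂ : HasDerivAt (fun t => a t + -deriv b t * x 1)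
        (deriv a (x 0) + -deriv (deriv b) (x 0) * x 1) (x 0) :=
      (((hsmooth 0).differentiable (by simp)) (x 0)).hasDerivAt.add
        (((hb.differentiable (by simp)) (x 0)).hasDerivAt.neg.mul_const (x 1))
    exact h₁.unique h₂
  · rintro ⟨h, p, hh, hp, hgx⟩
    obtain ⟨H, hH, hH'⟩ := hh.exists_contDiff_hasDerivAt
    obtain ⟨P, hP, hP'⟩ := hp.exists_contDiff_hasDerivAt
    obtain ⟨Q, hQ, hQ'⟩ := hP.exists_contDiff_hasDerivAt
    have hc : ∀ j, ContDiff ℝ ∞ (fun x : Fin 2 → ℝ => x j) := fun j => contDiff_apply ℝ ℝ j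
    set u : (Fin 2 → ℝ) → (Fin 2 → ℝ) := fun x => ![H (x 0) + P (x 0) * x 1, -Q (x 0)]
    have hu : ContDiff ℝ ∞ u := contDiff_pi.2 fun j => by
      fin_cases j
      · exact (hH.comp (hc 0)).add ((hP.comp (hc 0)).mul (hc 1))
      · exact (hQ.comp (hc 0)).neg
    have hud : Differentiable ℝ u := hu.differentiable (by simp)
    refine ⟨u, hu, fun x => ?_⟩
    have h₀₀ := (hasDerivAt_comp_vec_fst hud 0 (x 0) (x 1)).unique
      ((hH' (x 0)).add ((hP' (x 0)).mul_const (x 1)))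
    have h₀₁ := (hasDerivAt_comp_vec_fst hud 1 (x 0) (x 1)).unique (hQ' (x 0)).neg
    have h₁₀ := (hasDerivAt_comp_vec_snd hud 0 (x 0) (x 1)).unique
      (((hasDerivAt_id (x 1)).const_mul (P (x 0))).const_add (H (x 0)))
    have h₁₁ := (hasDerivAt_comp_vec_snd hud 1 (x 0) (x 1)).unique
      (hasDerivAt_const (x 1) (-Q (x 0)))
    rw [hvec] at h₀₀ h₀₁ h₁₀ h₁₁
    exact ⟨h₀₀.trans (hgx x).symm, by rw [h₁₀, h₀₁]; ring, h₁₁⟩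
end

section
/- Let λ₁, λ₂ be nonzero real numbers with the same sign (λ₁ λ₂ > 0), let P = diag(λ₁, λ₂), and let g : ℝ² → ℝ be smooth. Then there exists a smooth function u : ℝ² → ℝ² solving 𝓔u(x) = g(x) P for all x ∈ ℝ² if and only if g satisfies the elliptic equation 𝒜_P g ≡ 0, i.e. λ₂ ∂²g/∂x₁²(x) + λ₁ ∂²g/∂x₂²(x) = 0 for all x ∈ ℝ². -/
/-- The partial derivative `∂_i f(x)` of a scalar function on `ℝ^d`. -/
noncomputable def pderiv' {d : ℕ} (i : Fin d) (f : (Fin d → ℝ) → ℝ) (x : Fin d → ℝ) : ℝ :=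
  fderiv ℝ f x (Pi.single i 1)

theorem ContDiff.pderiv' {d : ℕ} {f : (Fin d → ℝ) → ℝ} (hf : ContDiff ℝ (⊤ : ℕ∞) f)
    (i : Fin d) : ContDiff ℝ (⊤ : ℕ∞) (pderiv' i f) :=
  (contDiff_infty_iff_fderiv.1 hf).2.clm_apply contDiff_const

theorem ContDiff.differentiable_infty {d : ℕ} {f : (Fin d → ℝ) → ℝ}
    (hf : ContDiff ℝ (⊤ : ℕ∞) f) : Differentiable ℝ f :=
  (contDiff_infty_iff_fderiv.1 hf).1

theorem pderiv'_const_mul {d : ℕ} {f : (Fin d → ℝ) → ℝ} (hf : Differentiable ℝ f)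
    (i : Fin d) (c : ℝ) : pderiv' i (fun x => c * f x) = fun x => c * pderiv' i f x := by
  funext x
  simp [pderiv', fderiv_const_mul (hf x)]

theorem pderiv'_neg {d : ℕ} (f : (Fin d → ℝ) → ℝ) (i : Fin d) :
    pderiv' i (fun x => -f x) = fun x => -pderiv' i f x := by
  funext x
  simp [pderiv', fderiv_fun_neg]

/-- Partial derivatives of a smooth function commute. -/
theorem pderiv'_comm {d : ℕ} {f : (Fin d → ℝ) → ℝ} (hf : ContDiff ℝ (⊤ : ℕ∞) f)
    (i j : Fin d) : pderiv' i (pderiv' j f) = pderiv' j (pderiv' i f) := by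
  funext x
  have hd : DifferentiableAt ℝ (fderiv ℝ f) x :=
    (contDiff_infty_iff_fderiv.1 hf).2.differentiable (by simp) x
  have hsnd : ∀ k l : Fin d, pderiv' k (pderiv' l f) x =
      fderiv ℝ (fderiv ℝ f) x (Pi.single k 1) (Pi.single l 1) := by
    intro k l
    change fderiv ℝ (fun y => fderiv ℝ f y (Pi.single l 1)) x (Pi.single k 1) = _
    rw [fderiv_clm_apply hd (differentiableAt_const _)]
    simp
  rw [hsnd, hsnd]
  exact ((contDiff_infty.1 hf 2).contDiffAt.isSymmSndFDerivAt (n := 2) (by simp)).eq _ _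

/-- The Poincaré lemma in the plane: a smooth curl-free vector field is the gradient of a
smooth function. -/
theorem exists_contDiff_pderiv'_eq {a b : (Fin 2 → ℝ) → ℝ} (ha : ContDiff ℝ (⊤ : ℕ∞) a)
    (hb : ContDiff ℝ (⊤ : ℕ∞) b) (hab : pderiv' 1 a = pderiv' 0 b) :
    ∃ f : (Fin 2 → ℝ) → ℝ, ContDiff ℝ (⊤ : ℕ∞) f ∧ pderiv' 0 f = a ∧ pderiv' 1 f = b := by
  let p (i : Fin 2) : (Fin 2 → ℝ) →L[ℝ] ℝ := ContinuousLinearMap.proj i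
  let ω : (Fin 2 → ℝ) → (Fin 2 → ℝ) →L[ℝ] ℝ := fun x => a x • p 0 + b x • p 1
  have hω : ContDiff ℝ (⊤ : ℕ∞) ω :=
    (ha.smul contDiff_const).add (hb.smul contDiff_const)
  have hbasis : ∀ v : Fin 2 → ℝ,
      v = v 0 • Pi.single (0 : Fin 2) (1 : ℝ) + v 1 • Pi.single (1 : Fin 2) (1 : ℝ) := by
    intro v
    funext i
    fin_cases i <;> simp
  have hcoord : ∀ (L : (Fin 2 → ℝ) →L[ℝ] ℝ) (v : Fin 2 → ℝ),
      L v = v 0 * L (Pi.single 0 1) + v 1 * L (Pi.single 1 1) := by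
    intro L v
    conv_lhs => rw [hbasis v]
    simp
  have hfderiv : ∀ x v w, fderiv ℝ ω x v w = fderiv ℝ a x v * w 0 + fderiv ℝ b x v * w 1 := by
    intro x v w
    have h : HasFDerivAt ω
        ((fderiv ℝ a x).smulRight (p 0) + (fderiv ℝ b x).smulRight (p 1)) x :=
      ((ha.differentiable_infty x).hasFDerivAt.smul_const (p 0)).add
        ((hb.differentiable_infty x).hasFDerivAt.smul_const (p 1))
    rw [h.fderiv]
    simp [p]
  obtain ⟨f, hf⟩ := convex_univ.exists_forall_hasFDerivAt_of_fderiv_symmetric isOpen_univ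
    (hω.differentiable (by simp)).differentiableOn (fun x _ v w => by
      have hx : fderiv ℝ a x (Pi.single 1 1) = fderiv ℝ b x (Pi.single 0 1) := congrFun hab x
      rw [hfderiv, hfderiv, hcoord (fderiv ℝ a x) v, hcoord (fderiv ℝ b x) v,
        hcoord (fderiv ℝ a x) w, hcoord (fderiv ℝ b x) w, hx]
      ring)
  have hfω : fderiv ℝ f = ω := funext fun x => (hf x trivial).fderiv
  refine ⟨f, contDiff_infty_iff_fderiv.2
    ⟨fun x => (hf x trivial).differentiableAt, hfω ▸ hω⟩, ?_, ?_⟩ <;>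
  · funext x
    simp [_root_.pderiv', hfω, ω, p]

theorem symGrad_apply {d : ℕ} {u : (Fin d → ℝ) → (Fin d → ℝ)} (hu : Differentiable ℝ u)
    (x : Fin d → ℝ) (i j : Fin d) :
    symGrad u x i j =
      (pderiv' j (fun y => u y i) x + pderiv' i (fun y => u y j) x) / 2 := by
  simp only [symGrad, pderiv', fderiv_apply (hu x)]
  rfl

theorem symGrad_eq_smul_diagonal_iff {u : (Fin 2 → ℝ) → (Fin 2 → ℝ)} (hu : Differentiable ℝ u)
    (x : Fin 2 → ℝ) (c l₁ l₂ : ℝ) :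
    symGrad u x = c • Matrix.diagonal ![l₁, l₂] ↔
      pderiv' 0 (fun y => u y 0) x = l₁ * c ∧ pderiv' 1 (fun y => u y 1) x = l₂ * c ∧
        pderiv' 1 (fun y => u y 0) x = -pderiv' 0 (fun y => u y 1) x := by
  rw [← Matrix.ext_iff]
  simp only [Fin.forall_fin_two, symGrad_apply hu, Matrix.smul_apply, Matrix.diagonal_apply]
  simp
  constructor
  · rintro ⟨⟨h00, h01⟩, -, h11⟩
    exact ⟨by linarith, by linarith, by linarith⟩
  · rintro ⟨h00, h11, h01⟩
    exact ⟨⟨by linarith, by linarith⟩, by linarith, by linarith⟩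

/-- Let `λ₁, λ₂` be nonzero reals of the same sign, `P = diag(λ₁, λ₂)`, and
`g : ℝ² → ℝ` smooth. Then `𝓔u = g P` has a smooth solution `u : ℝ² → ℝ²` iff `g` solves the
elliptic equation `𝒜_P g = λ₂ ∂₁₁ g + λ₁ ∂₂₂ g ≡ 0`. -/
theorem solvable_diag_iff_elliptic (l₁ l₂ : ℝ) (hll : 0 < l₁ * l₂)
    (g : (Fin 2 → ℝ) → ℝ) (hg : ContDiff ℝ (⊤ : ℕ∞) g) :
    (∃ u : (Fin 2 → ℝ) → (Fin 2 → ℝ), ContDiff ℝ (⊤ : ℕ∞) u ∧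
        ∀ x, symGrad u x = g x • Matrix.diagonal ![l₁, l₂]) ↔
      ∀ x, l₂ * pderiv' 0 (pderiv' 0 g) x + l₁ * pderiv' 1 (pderiv' 1 g) x = 0 := by
  constructor
  · rintro ⟨u, hu, h⟩
    have hd : Differentiable ℝ u := (contDiff_infty_iff_fderiv.1 hu).1
    have hu₀ : ContDiff ℝ (⊤ : ℕ∞) (fun y => u y 0) := contDiff_pi.1 hu 0
    have hu₁ : ContDiff ℝ (⊤ : ℕ∞) (fun y => u y 1) := contDiff_pi.1 hu 1
    have hs := fun x => (symGrad_eq_smul_diagonal_iff hd x _ l₁ l₂).1 (h x)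
    have h00 : pderiv' 0 (fun y => u y 0) = fun x => l₁ * g x := funext fun x => (hs x).1
    have h11 : pderiv' 1 (fun y => u y 1) = fun x => l₂ * g x := funext fun x => (hs x).2.1
    have h01 : pderiv' 1 (fun y => u y 0) = fun x => -pderiv' 0 (fun y => u y 1) x :=
      funext fun x => (hs x).2.2
    have e₀ : pderiv' 0 (pderiv' 1 (fun y => u y 0)) = fun x => l₁ * pderiv' 1 g x := by
      rw [pderiv'_comm hu₀, h00, pderiv'_const_mul hg.differentiable_infty]
    have e₁ : pderiv' 1 (pderiv' 0 (fun y => u y 1)) = fun x => l₂ * pderiv' 0 g x := by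
      rw [pderiv'_comm hu₁, h11, pderiv'_const_mul hg.differentiable_infty]
    have key := pderiv'_comm (hu₁.pderiv' 0) 0 1
    rw [e₁, pderiv'_const_mul (hg.pderiv' 0).differentiable_infty] at key
    rw [h01, pderiv'_neg] at e₀
    have e₂ : pderiv' 0 (pderiv' 0 (fun y => u y 1)) = fun x => -l₁ * pderiv' 1 g x := by
      funext x
      have := congrFun e₀ x
      linarith
    rw [e₂, pderiv'_const_mul (hg.pderiv' 1).differentiable_infty] at key
    intro x
    have := congrFun key x
    linarith
  · intro h
    have hg' := hg.differentiable_infty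
    obtain ⟨w, hw, hw₀, hw₁⟩ := exists_contDiff_pderiv'_eq
      (a := fun x => l₁ * pderiv' 1 g x) (b := fun x => -l₂ * pderiv' 0 g x)
      (contDiff_const.mul (hg.pderiv' 1)) (contDiff_const.mul (hg.pderiv' 0)) (by
        rw [pderiv'_const_mul (hg.pderiv' 1).differentiable_infty,
          pderiv'_const_mul (hg.pderiv' 0).differentiable_infty]
        funext x
        linarith [h x])
    obtain ⟨p, hp, hp₀, hp₁⟩ := exists_contDiff_pderiv'_eq
      (a := fun x => l₁ * g x) (b := w) (contDiff_const.mul hg) hw (by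
        rw [pderiv'_const_mul hg', hw₀])
    obtain ⟨q, hq, hq₀, hq₁⟩ := exists_contDiff_pderiv'_eq
      (a := fun x => -w x) (b := fun x => l₂ * g x) hw.neg (contDiff_const.mul hg) (by
        rw [pderiv'_const_mul hg', pderiv'_neg, hw₁]
        funext x
        ring)
    have hu : ContDiff ℝ (⊤ : ℕ∞) (fun x => ![p x, q x]) := by
      rw [contDiff_pi]
      intro i
      fin_cases i
      · exact hp
      · exact hq
    refine ⟨_, hu, fun x => (symGrad_eq_smul_diagonal_iff
      (contDiff_infty_iff_fderiv.1 hu).1 x _ l₁ l₂).2 ?_⟩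
    change pderiv' 0 p x = _ ∧ pderiv' 1 q x = _ ∧ pderiv' 1 p x = -pderiv' 0 q x
    simp [hp₀, hp₁, hq₀, hq₁]
end

section
/- Let h be a locally bounded Borel-measurable real-valued function on the symmetric d×d real matrices which is symmetric-quasiconvex. Then h is convex along symmetric rank-one directions: for all symmetric matrices A₁, A₂ with A₂ − A₁ = a ⊙ b for some a, b ∈ ℝ^d, and all θ ∈ [0,1], one has h(θ A₁ + (1−θ) A₂) ≤ θ h(A₁) + (1−θ) h(A₂). -/
open MeasureTheory

/-- The symmetrized gradient `𝓔ψ(x) = ½(Dψ(x) + Dψ(x)ᵀ)` for maps on Euclidean space. -/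
noncomputable def symGradE {d : ℕ}
    (ψ : EuclideanSpace ℝ (Fin d) → EuclideanSpace ℝ (Fin d))
    (x : EuclideanSpace ℝ (Fin d)) : Matrix (Fin d) (Fin d) ℝ :=
  fun i j => (fderiv ℝ ψ x (EuclideanSpace.single j 1) i
    + fderiv ℝ ψ x (EuclideanSpace.single i 1) j) / 2

/-- `h` is symmetric-quasiconvex: for every symmetric matrix `A` and every smooth test map
`ψ` with (compact) support contained in the open unit ball `B` of `ℝ^d`,
`h(A) · vol(B) ≤ ∫_B h(A + 𝓔ψ(z)) dz`. -/
def SymQuasiconvex {d : ℕ} (h : Matrix (Fin d) (Fin d) ℝ → ℝ) : Prop :=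
  ∀ A : Matrix (Fin d) (Fin d) ℝ, A.IsSymm →
    ∀ ψ : EuclideanSpace ℝ (Fin d) → EuclideanSpace ℝ (Fin d),
      ContDiff ℝ (⊤ : ℕ∞) ψ → tsupport ψ ⊆ Metric.ball 0 1 →
        h A * (volume (Metric.ball (0 : EuclideanSpace ℝ (Fin d)) 1)).toReal ≤
          ∫ z in Metric.ball (0 : EuclideanSpace ℝ (Fin d)) 1, h (A + symGradE ψ z)

section

open Filter Topology Set

/-- The gradient of a real function on Euclidean space, in coordinates. -/
noncomputable def coordGrad {d : ℕ} (q : EuclideanSpace ℝ (Fin d) → ℝ)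
    (x : EuclideanSpace ℝ (Fin d)) : Fin d → ℝ :=
  fun j => fderiv ℝ q x (EuclideanSpace.single j 1)

theorem symGradE_smul_const {d : ℕ} {q : EuclideanSpace ℝ (Fin d) → ℝ}
    {x : EuclideanSpace ℝ (Fin d)} (hq : DifferentiableAt ℝ q x) (a : Fin d → ℝ) :
    symGradE (fun z => q z • WithLp.toLp 2 a) x = symTensor a (coordGrad q x) := by
  ext i j
  simp only [symGradE, symTensor, coordGrad, fderiv_smul_const hq,
    ContinuousLinearMap.smulRight_apply, PiLp.smul_apply, smul_eq_mul]
  ring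

theorem continuous_symTensor_right {d : ℕ} (a : Fin d → ℝ) : Continuous (symTensor a) := by
  refine continuous_pi fun i => continuous_pi fun j => ?_
  simp only [symTensor]
  fun_prop

theorem symTensor_smul_right {d : ℕ} (a b : Fin d → ℝ) (c : ℝ) :
    symTensor a (c • b) = c • symTensor a b := by
  ext i j
  simp only [symTensor, Pi.smul_apply, Matrix.smul_apply, smul_eq_mul]
  ring

theorem symTensor_zero_right {d : ℕ} (a : Fin d → ℝ) : symTensor a 0 = 0 := by
  ext i j
  simp [symTensor]

/-- A smooth `1`-periodic function of mean zero has a smooth bounded primitive. -/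
theorem exists_bounded_primitive_of_periodic {v : ℝ → ℝ} (hv : ContDiff ℝ (⊤ : ℕ∞) v)
    (hper : Function.Periodic v 1) (hmean : ∫ s in (0 : ℝ)..1, v s = 0) :
    ∃ u : ℝ → ℝ, ContDiff ℝ (⊤ : ℕ∞) u ∧ (∀ x, HasDerivAt u (v x) x) ∧
      ∃ C, ∀ x, |u x| ≤ C := by
  have hc : Continuous v := hv.continuous
  have hder : ∀ x, HasDerivAt (fun x => ∫ s in (0 : ℝ)..x, v s) (v x) x := fun x =>
    hc.integral_hasStrictDerivAt 0 x |>.hasDerivAt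
  have huper : Function.Periodic (fun x => ∫ s in (0 : ℝ)..x, v s) 1 := fun x => by
    have h1 := intervalIntegral.integral_add_adjacent_intervals
      (hc.intervalIntegrable (μ := volume) 0 x) (hc.intervalIntegrable (μ := volume) x (x + 1))
    have h2 := hper.intervalIntegral_add_eq x 0
    simp only [zero_add, hmean] at h2
    simp only
    rw [← h1, h2, add_zero]
  have hucont : Continuous (fun x => ∫ s in (0 : ℝ)..x, v s) :=
    continuous_iff_continuousAt.2 fun x => (hder x).continuousAt
  refine ⟨_, ?_, hder, ?_⟩
  · rw [contDiff_infty_iff_deriv]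
    refine ⟨fun x => (hder x).differentiableAt, ?_⟩
    rwa [show deriv (fun x => ∫ s in (0 : ℝ)..x, v s) = v from funext fun x => (hder x).deriv]
  · obtain ⟨C, hC⟩ := (huper.isBounded_of_continuous one_ne_zero hucont).exists_norm_le
    exact ⟨C, fun x => hC _ (mem_range_self x)⟩

/-- A bounded profile `u` is oscillated at frequency `N` in the direction `b` and cut off by `φ`. -/
noncomputable def layeredFun {d : ℕ} (φ : EuclideanSpace ℝ (Fin d) → ℝ) (u : ℝ → ℝ)
    (b : Fin d → ℝ) (N s : ℝ) (z : EuclideanSpace ℝ (Fin d)) : ℝ :=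
  φ z * (N⁻¹ * u (N * inner ℝ (WithLp.toLp 2 b) z + s))

theorem contDiff_layeredFun {d : ℕ} {φ : EuclideanSpace ℝ (Fin d) → ℝ} {u : ℝ → ℝ}
    (hφ : ContDiff ℝ (⊤ : ℕ∞) φ) (hu : ContDiff ℝ (⊤ : ℕ∞) u) (b : Fin d → ℝ) (N s : ℝ) :
    ContDiff ℝ (⊤ : ℕ∞) (layeredFun φ u b N s) := by
  have hb : ContDiff ℝ (⊤ : ℕ∞) fun z => inner ℝ (WithLp.toLp 2 b) z :=
    contDiff_const.inner ℝ contDiff_id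
  unfold layeredFun
  fun_prop

theorem coordGrad_layeredFun {d : ℕ} {φ : EuclideanSpace ℝ (Fin d) → ℝ} {u v : ℝ → ℝ}
    (hφ : Differentiable ℝ φ) (hu : ∀ x, HasDerivAt u (v x) x) (b : Fin d → ℝ) {N : ℝ}
    (hN : N ≠ 0) (s : ℝ) (z : EuclideanSpace ℝ (Fin d)) :
    coordGrad (layeredFun φ u b N s) z =
      (φ z * v (N * inner ℝ (WithLp.toLp 2 b) z + s)) • b +
        (N⁻¹ * u (N * inner ℝ (WithLp.toLp 2 b) z + s)) • coordGrad φ z := by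
  have hl : HasFDerivAt (fun z => N * inner ℝ (WithLp.toLp 2 b) z + s)
      (N • innerSL ℝ (WithLp.toLp 2 b)) z :=
    (((innerSL ℝ (WithLp.toLp 2 b)).hasFDerivAt (x := z)).const_mul N).add_const s
  have h := (hφ z).hasFDerivAt.mul (((hu _).comp_hasFDerivAt z hl).const_mul N⁻¹)
  ext j
  have h' : fderiv ℝ (layeredFun φ u b N s) z = _ := h.fderiv
  simp only [coordGrad, h', Function.comp_apply, Pi.add_apply, Pi.smul_apply, smul_eq_mul,
    add_apply, smul_apply, innerSL_apply_apply,
    EuclideanSpace.inner_single_right]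
  simp
  field_simp

/-- Quasiconvexity with respect to gradients of scalar test functions implies Jensen's inequality
for smooth periodic profiles in a fixed direction. -/
theorem le_integral_periodic_profile {d : ℕ} {P : (Fin d → ℝ) → ℝ} (hP : Measurable P)
    (hbd : ∀ R : ℝ, ∃ M : ℝ, ∀ p, ‖p‖ ≤ R → |P p| ≤ M)
    (hqc : ∀ q : EuclideanSpace ℝ (Fin d) → ℝ, ContDiff ℝ (⊤ : ℕ∞) q →
      tsupport q ⊆ Metric.ball 0 1 →
        P 0 * (volume (Metric.ball (0 : EuclideanSpace ℝ (Fin d)) 1)).toReal ≤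
          ∫ z in Metric.ball (0 : EuclideanSpace ℝ (Fin d)) 1, P (coordGrad q z))
    {v : ℝ → ℝ} (hv : ContDiff ℝ (⊤ : ℕ∞) v) (hper : Function.Periodic v 1)
    (hmean : ∫ s in (0 : ℝ)..1, v s = 0) (b : Fin d → ℝ) :
    P 0 ≤ ∫ s in (0 : ℝ)..1, P (v s • b) := by
  obtain ⟨u, hu, hder, U, hU⟩ := exists_bounded_primitive_of_periodic hv hper hmean
  obtain ⟨V, hV⟩ := (hper.isBounded_of_continuous one_ne_zero hv.continuous).exists_norm_le
  replace hV : ∀ x, |v x| ≤ V := fun x => hV _ (mem_range_self x)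
  have hU0 : 0 ≤ U := (abs_nonneg _).trans (hU 0)
  have hV0 : 0 ≤ V := (abs_nonneg _).trans (hV 0)
  obtain ⟨M, hM⟩ := hbd (V * ‖b‖ + U)
  set B := Metric.ball (0 : EuclideanSpace ℝ (Fin d)) 1 with hB
  have hBfin : volume B ≠ ⊤ := measure_ball_lt_top.ne
  have : IsFiniteMeasure (volume.restrict B) := ⟨by simpa using measure_ball_lt_top⟩
  have hkpos : ∀ k : ℕ, (0 : ℝ) < 1 - 1 / (k + 2) := fun k => by
    rw [sub_pos, div_lt_one (by positivity)]
    have : (0 : ℝ) ≤ k := k.cast_nonneg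
    linarith
  have hklt : ∀ k : ℕ, (1 : ℝ) - 1 / (k + 2) < 1 - 1 / (k + 3) := fun k =>
    sub_lt_sub_left (one_div_lt_one_div_of_lt (by positivity) (by linarith)) 1
  let φ : ℕ → ContDiffBump (0 : EuclideanSpace ℝ (Fin d)) := fun k =>
    ⟨1 - 1 / (k + 2), 1 - 1 / (k + 3), hkpos k, hklt k⟩
  have hφsmooth : ∀ k, ContDiff ℝ (⊤ : ℕ∞) (φ k) := fun k => (φ k).contDiff
  have hgrad : ∀ k, ∃ N : ℝ, 0 < N ∧ ∀ z, ‖coordGrad (φ k) z‖ ≤ N := fun k => by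
    obtain ⟨C, hC⟩ := ((φ k).hasCompactSupport.fderiv (𝕜 := ℝ)).exists_bound_of_continuous
      ((hφsmooth k).continuous_fderiv (by simp))
    have hC0 : 0 ≤ C := (norm_nonneg _).trans (hC 0)
    refine ⟨C + 1, by positivity, fun z => (pi_norm_le_iff_of_nonneg (by positivity)).2 fun j => ?_⟩
    refine ((fderiv ℝ (φ k) z).le_opNorm _).trans ?_
    simp only [PiLp.norm_single, norm_one, mul_one]
    linarith [hC z]
  choose N hN0 hN using hgrad
  have hform := fun k s z => coordGrad_layeredFun ((hφsmooth k).differentiable (by simp)) hder b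
    (hN0 k).ne' s z
  have hbound : ∀ k s z, |P (coordGrad (layeredFun (φ k) u b (N k) s) z)| ≤ M := fun k s z => by
    refine hM _ ?_
    rw [hform]
    refine (norm_add_le _ _).trans (add_le_add ?_ ?_)
    · rw [norm_smul, norm_mul]
      have h1 : ‖φ k z‖ ≤ 1 := by
        rw [Real.norm_of_nonneg (φ k).nonneg]
        exact (φ k).le_one
      have h2 := hV (N k * inner ℝ (WithLp.toLp 2 b) z + s)
      rw [← Real.norm_eq_abs] at h2
      calc _ ≤ 1 * V * ‖b‖ := by gcongr
        _ = _ := by ring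
    · rw [norm_smul, norm_mul, norm_inv, Real.norm_of_nonneg (hN0 k).le]
      have h2 := hU (N k * inner ℝ (WithLp.toLp 2 b) z + s)
      rw [← Real.norm_eq_abs] at h2
      have := hN0 k
      calc _ ≤ (N k)⁻¹ * U * N k := by
            gcongr
            exact hN k z
        _ = U := by field_simp
  have hgcont : ∀ k, Continuous (coordGrad (φ k)) := fun k => continuous_pi fun j =>
    ((hφsmooth k).continuous_fderiv (by simp)).clm_apply continuous_const
  have hmeas : ∀ k, Measurable fun p : ℝ × EuclideanSpace ℝ (Fin d) =>
      P (coordGrad (layeredFun (φ k) u b (N k) p.1) p.2) := fun k => by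
    refine hP.comp (Continuous.measurable ?_)
    simp only [hform]
    have h1 := hv.continuous
    have h2 := hu.continuous
    have h3 := hgcont k
    have h4 := (hφsmooth k).continuous
    fun_prop
  have hle : ∀ k, P 0 * (volume B).toReal ≤
      ∫ z in B, ∫ s in Ioc (0 : ℝ) 1, P (coordGrad (layeredFun (φ k) u b (N k) s) z) := fun k => by
    have hint : Integrable (Function.uncurry fun s z =>
        P (coordGrad (layeredFun (φ k) u b (N k) s) z))
        ((volume.restrict (Ioc (0 : ℝ) 1)).prod (volume.restrict B)) :=
      Integrable.of_bound (hmeas k).aestronglyMeasurable M (ae_of_all _ fun p => hbound k p.1 p.2)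
    rw [← integral_integral_swap hint]
    have hs : ∀ s, P 0 * (volume B).toReal ≤
        ∫ z in B, P (coordGrad (layeredFun (φ k) u b (N k) s) z) := fun s => by
      refine hqc _ (contDiff_layeredFun (hφsmooth k) hu b _ s) ?_
      refine (closure_mono (Function.support_mul_subset_left _ _)).trans ?_
      change tsupport (φ k) ⊆ _
      rw [(φ k).tsupport_eq]
      refine Metric.closedBall_subset_ball ?_
      change (1 : ℝ) - 1 / (k + 3) < 1
      have : (0 : ℝ) < 1 / ((k : ℝ) + 3) := by positivity
      linarith
    calc P 0 * (volume B).toReal = ∫ s in Ioc (0 : ℝ) 1, P 0 * (volume B).toReal := by simp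
      _ ≤ _ := integral_mono (integrable_const _) hint.integral_prod_left hs
  have hlim : Tendsto (fun k => ∫ z in B, ∫ s in Ioc (0 : ℝ) 1,
      P (coordGrad (layeredFun (φ k) u b (N k) s) z)) atTop
      (𝓝 (∫ z in B, ∫ s in (0 : ℝ)..1, P (v s • b))) := by
    refine tendsto_integral_of_dominated_convergence (fun _ => M) (fun k => ?_)
      (integrable_const _) (fun k => ae_of_all _ fun z => ?_) ?_
    · exact ((hmeas k).comp measurable_swap).stronglyMeasurable.integral_prod_right'
        |>.aestronglyMeasurable
    · have := norm_integral_le_of_norm_le_const (μ := volume.restrict (Ioc (0 : ℝ) 1))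
        (ae_of_all _ fun s => (Real.norm_eq_abs _).trans_le (hbound k s z))
      simpa using this
    · refine (ae_restrict_iff' measurableSet_ball).2 (ae_of_all _ fun z hz => ?_)
      refine tendsto_const_nhds.congr' ?_
      rw [mem_ball_zero_iff] at hz
      have h1 : Tendsto (fun k : ℕ => (1 : ℝ) - 1 / (k + 2)) atTop (𝓝 (1 - 0)) := by
        refine tendsto_const_nhds.sub ?_
        have := (tendsto_add_atTop_iff_nat 1).2 (tendsto_one_div_add_atTop_nhds_zero_nat (𝕜 := ℝ))
        refine this.congr fun k => ?_
        push_cast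
        ring
      rw [sub_zero] at h1
      filter_upwards [h1.eventually_const_lt hz] with k hk
      have hzmem : z ∈ Metric.ball (0 : EuclideanSpace ℝ (Fin d)) (φ k).rIn :=
        mem_ball_zero_iff.2 hk
      have hev := (φ k).eventuallyEq_one_of_mem_ball hzmem
      have hg0 : coordGrad (φ k) z = 0 := by
        ext j
        simp [coordGrad, hev.fderiv_eq]
      have hone : φ k z = 1 := hev.eq_of_nhds
      simp only [hform, hg0, hone, one_mul, smul_zero, add_zero]
      have hp : Function.Periodic (fun s => P (v s • b)) 1 := fun s => by simp only [hper s]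
      have h2 := intervalIntegral.integral_comp_add_left (a := 0) (b := 1)
        (fun s => P (v s • b)) (N k * inner ℝ (WithLp.toLp 2 b) z)
      rw [← intervalIntegral.integral_of_le zero_le_one, h2, add_zero,
        hp.intervalIntegral_add_eq _ 0, zero_add]
  have hfin := ge_of_tendsto' hlim hle
  rw [setIntegral_const, smul_eq_mul, mul_comm, Measure.real] at hfin
  refine le_of_mul_le_mul_left hfin ?_
  exact ENNReal.toReal_pos (Metric.measure_ball_pos _ _ one_pos).ne' hBfin

/-- Indicators of centred subintervals of the unit period are limits of smooth periodic functions
with the same mean, which eventually agree with the indicator off the two endpoints. -/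
theorem exists_smooth_periodic_approx_indicator {m : ℝ} (hm : m ∈ Icc (0 : ℝ) 1) :
    ∃ w : ℕ → ℝ → ℝ, (∀ k, ContDiff ℝ (⊤ : ℕ∞) (w k)) ∧ (∀ k, Function.Periodic (w k) 1) ∧
      (∀ k s, w k s ∈ Icc (0 : ℝ) 1) ∧ (∀ k, ∫ s in (0 : ℝ)..1, w k s = m) ∧
      ∀ s ∈ Ioc (0 : ℝ) 1, s ≠ (1 - m) / 2 → s ≠ (1 + m) / 2 →
        ∀ᶠ k in atTop, w k s = (Ioc ((1 - m) / 2) ((1 + m) / 2)).indicator 1 s := by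
  obtain ⟨hm0, hm1⟩ := hm
  have hpi := Real.pi_pos
  set c := Real.cos (Real.pi * m)
  let p : ℝ → ℝ := fun s => Real.cos (2 * Real.pi * (s - 1 / 2))
  have hp : ContDiff ℝ (⊤ : ℕ∞) p := by
    change ContDiff ℝ _ fun s => Real.cos (2 * Real.pi * (s - 1 / 2))
    fun_prop
  have hpper : Function.Periodic p 1 := fun s => by
    change Real.cos _ = Real.cos _
    rw [← Real.cos_add_two_pi (2 * Real.pi * (s - 1 / 2))]
    ring_nf
  have hpabs : ∀ s, p s = Real.cos (2 * Real.pi * |s - 1 / 2|) := fun s => by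
    change Real.cos _ = _
    rw [← Real.cos_abs, abs_mul, abs_of_pos (by positivity : 0 < 2 * Real.pi)]
  have hmem : ∀ s ∈ Icc (0 : ℝ) 1, 2 * Real.pi * |s - 1 / 2| ∈ Icc 0 Real.pi := fun s hs => by
    have : |s - 1 / 2| ≤ 1 / 2 := abs_le.2 ⟨by linarith [hs.1], by linarith [hs.2]⟩
    refine ⟨by positivity, ?_⟩
    nlinarith
  have hmmem : Real.pi * m ∈ Icc 0 Real.pi := ⟨by positivity, by nlinarith⟩
  have hin : ∀ s ∈ Ioo ((1 - m) / 2) ((1 + m) / 2), c < p s := fun s hs => by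
    rw [hpabs]
    refine Real.strictAntiOn_cos (hmem s ⟨by linarith [hs.1], by linarith [hs.2]⟩) hmmem ?_
    have : |s - 1 / 2| < m / 2 := abs_lt.2 ⟨by linarith [hs.1], by linarith [hs.2]⟩
    nlinarith
  have hout : ∀ s ∈ Icc (0 : ℝ) 1, m / 2 < |s - 1 / 2| → p s < c := fun s hs h => by
    rw [hpabs]
    refine Real.strictAntiOn_cos hmmem (hmem s hs) ?_
    nlinarith
  let g : ℝ → ℕ → ℝ → ℝ := fun t k s => Real.smoothTransition ((p s - c) * (k + 1) + t)
  have hg : ∀ t k, ContDiff ℝ (⊤ : ℕ∞) (g t k) := fun t k =>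
    Real.smoothTransition.contDiff.comp (by fun_prop)
  have hgint : ∀ t k, IntervalIntegrable (g t k) volume 0 1 := fun t k =>
    (hg t k).continuous.intervalIntegrable _ _
  have hI : ∫ s in (0 : ℝ)..1, (Ioc ((1 - m) / 2) ((1 + m) / 2)).indicator (1 : ℝ → ℝ) s = m := by
    rw [intervalIntegral.integral_of_le zero_le_one,
      setIntegral_indicator measurableSet_Ioc, inter_eq_self_of_subset_right
        (Ioc_subset_Ioc (by linarith) (by linarith))]
    simp only [Pi.one_apply, setIntegral_const, smul_eq_mul, mul_one, Measure.real,
      Real.volume_Ioc]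
    rw [ENNReal.toReal_ofReal (by linarith)]
    ring
  have hIint : IntervalIntegrable ((Ioc ((1 - m) / 2) ((1 + m) / 2)).indicator (1 : ℝ → ℝ))
      volume 0 1 := by
    rw [intervalIntegrable_iff, uIoc_of_le zero_le_one]
    exact (integrable_const (1 : ℝ)).indicator measurableSet_Ioc
  have hne : ∀ e : ℝ, ∀ᵐ s : ℝ, s ≠ e := fun e => (countable_singleton e).ae_notMem volume
  have hcase : ∀ s ∈ Icc (0 : ℝ) 1, s ≠ (1 - m) / 2 → s ≠ (1 + m) / 2 →
      (c < p s ∧ (Ioc ((1 - m) / 2) ((1 + m) / 2)).indicator (1 : ℝ → ℝ) s = 1) ∨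
      (p s < c ∧ (Ioc ((1 - m) / 2) ((1 + m) / 2)).indicator (1 : ℝ → ℝ) s = 0) := by
    intro s hs h1 h2
    by_cases h : s ∈ Ioc ((1 - m) / 2) ((1 + m) / 2)
    · exact .inl ⟨hin s ⟨h.1, lt_of_le_of_ne h.2 h2⟩, by simp [h]⟩
    · refine .inr ⟨hout s hs ?_, by simp [h]⟩
      rw [lt_abs]
      by_cases h3 : (1 - m) / 2 < s
      · left
        have : (1 + m) / 2 < s := not_le.1 fun h4 => h ⟨h3, h4⟩
        linarith
      · right
        have := lt_of_le_of_ne (not_lt.1 h3) h1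
        linarith
  have hlow : ∀ k, ∫ s in (0 : ℝ)..1, g 0 k s ≤ m := fun k => by
    rw [← hI]
    refine intervalIntegral.integral_mono_ae_restrict zero_le_one (hgint 0 k) hIint ?_
    refine (ae_restrict_iff' measurableSet_Icc).2 ?_
    filter_upwards [hne ((1 - m) / 2), hne ((1 + m) / 2)] with s h1 h2 hs
    rcases hcase s hs h1 h2 with ⟨-, h⟩ | ⟨hlt, h⟩
    · rw [h]
      exact Real.smoothTransition.le_one _
    · rw [h]
      refine (Real.smoothTransition.zero_of_nonpos ?_).le
      rw [add_zero]
      exact mul_nonpos_of_nonpos_of_nonneg (by linarith) (by positivity)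
  have hhigh : ∀ k, m ≤ ∫ s in (0 : ℝ)..1, g 1 k s := fun k => by
    conv_lhs => rw [← hI]
    refine intervalIntegral.integral_mono_ae_restrict zero_le_one hIint (hgint 1 k) ?_
    refine (ae_restrict_iff' measurableSet_Icc).2 ?_
    filter_upwards [hne ((1 - m) / 2), hne ((1 + m) / 2)] with s h1 h2 hs
    rcases hcase s hs h1 h2 with ⟨hlt, h⟩ | ⟨-, h⟩
    · rw [h]
      refine (Real.smoothTransition.one_of_one_le ?_).ge
      have : 0 ≤ (p s - c) * ((k : ℝ) + 1) := mul_nonneg (by linarith) (by positivity)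
      linarith
    · rw [h]
      exact Real.smoothTransition.nonneg _
  have hτ : ∀ k, ∃ α β : ℝ, 0 ≤ α ∧ 0 ≤ β ∧ α + β = 1 ∧
      α * (∫ s in (0 : ℝ)..1, g 0 k s) + β * (∫ s in (0 : ℝ)..1, g 1 k s) = m := fun k => by
    have := Icc_subset_segment (𝕜 := ℝ) ⟨hlow k, hhigh k⟩
    simpa [segment] using this
  choose α β hα hβ hαβ hmean using hτ
  refine ⟨fun k s => α k * g 0 k s + β k * g 1 k s, fun k => ?_, fun k s => ?_, fun k s => ?_,
    fun k => ?_, fun s hs h1 h2 => ?_⟩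
  · exact (contDiff_const.mul (hg 0 k)).add (contDiff_const.mul (hg 1 k))
  · simp only [g, hpper s]
  · have h0 : g 0 k s ∈ Icc (0 : ℝ) 1 :=
      ⟨Real.smoothTransition.nonneg _, Real.smoothTransition.le_one _⟩
    have h1 : g 1 k s ∈ Icc (0 : ℝ) 1 :=
      ⟨Real.smoothTransition.nonneg _, Real.smoothTransition.le_one _⟩
    exact convex_Icc (0 : ℝ) 1 h0 h1 (hα k) (hβ k) (hαβ k)
  · rw [intervalIntegral.integral_add ((hgint 0 k).const_mul _) ((hgint 1 k).const_mul _),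
      intervalIntegral.integral_const_mul, intervalIntegral.integral_const_mul, hmean]
  · have htop : Tendsto (fun k : ℕ => (k : ℝ) + 1) atTop atTop :=
      tendsto_atTop_add_const_right _ _ tendsto_natCast_atTop_atTop
    rcases hcase s (Ioc_subset_Icc_self hs) h1 h2 with ⟨hlt, h⟩ | ⟨hlt, h⟩
    · filter_upwards [(htop.const_mul_atTop (sub_pos.2 hlt)).eventually_ge_atTop 1] with k hk
      have e0 : g 0 k s = 1 := Real.smoothTransition.one_of_one_le (by linarith)
      have e1 : g 1 k s = 1 := Real.smoothTransition.one_of_one_le (by linarith)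
      rw [h, e0, e1, mul_one, mul_one, hαβ]
    · filter_upwards [(htop.const_mul_atTop_of_neg (sub_neg.2 hlt)).eventually_le_atBot (-1)]
        with k hk
      have e0 : g 0 k s = 0 := Real.smoothTransition.zero_of_nonpos (by linarith)
      have e1 : g 1 k s = 0 := Real.smoothTransition.zero_of_nonpos (by linarith)
      rw [h, e0, e1, mul_zero, mul_zero, add_zero]

/-- Jensen's inequality for smooth periodic profiles implies the two-point Jensen inequality. -/
theorem le_two_point_of_le_integral_periodic {f : ℝ → ℝ} (hf : Measurable f) {M : ℝ}
    (hM : ∀ t ∈ Icc (-1 : ℝ) 1, |f t| ≤ M)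
    (hJ : ∀ v : ℝ → ℝ, ContDiff ℝ (⊤ : ℕ∞) v → Function.Periodic v 1 →
      ∫ s in (0 : ℝ)..1, v s = 0 → f 0 ≤ ∫ s in (0 : ℝ)..1, f (v s))
    {m : ℝ} (hm : m ∈ Icc (0 : ℝ) 1) :
    f 0 ≤ (1 - m) * f (-m) + m * f (1 - m) := by
  obtain ⟨w, hw, hper, hmem, hmean, hev⟩ := exists_smooth_periodic_approx_indicator hm
  set T := Ioc ((1 - m) / 2) ((1 + m) / 2) with hT
  have hle : ∀ k, f 0 ≤ ∫ s in Ioc (0 : ℝ) 1, f (w k s - m) := fun k => by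
    rw [← intervalIntegral.integral_of_le zero_le_one]
    refine hJ (fun s => w k s - m) ((hw k).sub contDiff_const) (fun s => by simp only [hper k s]) ?_
    rw [intervalIntegral.integral_sub ((hw k).continuous.intervalIntegrable _ _)
      (by simp), hmean]
    simp
  have hlim : Tendsto (fun k => ∫ s in Ioc (0 : ℝ) 1, f (w k s - m)) atTop
      (𝓝 (∫ s in Ioc (0 : ℝ) 1, f (T.indicator 1 s - m))) := by
    refine tendsto_integral_of_dominated_convergence (fun _ => M) (fun k => ?_)
      (integrable_const _) (fun k => ae_of_all _ fun s => ?_) ?_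
    · exact (hf.comp ((hw k).continuous.measurable.sub_const m)).aestronglyMeasurable
    · exact hM _ ⟨by linarith [(hmem k s).1, hm.2], by linarith [(hmem k s).2, hm.1]⟩
    · refine (ae_restrict_iff' measurableSet_Ioc).2 ?_
      filter_upwards [(countable_singleton ((1 - m) / 2)).ae_notMem volume,
        (countable_singleton ((1 + m) / 2)).ae_notMem volume] with s h1 h2 hs
      refine tendsto_const_nhds.congr' ?_
      filter_upwards [hev s hs h1 h2] with k hk
      rw [hk]
  have hval : ∫ s in Ioc (0 : ℝ) 1, f (T.indicator 1 s - m) = (1 - m) * f (-m) + m * f (1 - m) := by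
    have hrw : ∀ s, f (T.indicator 1 s - m) =
        f (-m) + T.indicator (fun _ => f (1 - m) - f (-m)) s := fun s => by
      by_cases hs : s ∈ T <;> simp [hs]
    simp only [hrw]
    rw [integral_add (integrable_const _) ((integrable_const _).indicator measurableSet_Ioc),
      setIntegral_indicator measurableSet_Ioc, inter_eq_self_of_subset_right
        (Ioc_subset_Ioc (by linarith [hm.2]) (by linarith [hm.2]))]
    simp only [setIntegral_const, smul_eq_mul, Measure.real, Real.volume_Ioc]
    rw [ENNReal.toReal_ofReal (by norm_num), ENNReal.toReal_ofReal (by linarith [hm.1])]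
    ring
  rw [← hval]
  exact ge_of_tendsto' hlim hle

theorem SymQuasiconvex.le_coordGrad {d : ℕ} {h : Matrix (Fin d) (Fin d) ℝ → ℝ}
    (hqc : SymQuasiconvex h) {A : Matrix (Fin d) (Fin d) ℝ} (hA : A.IsSymm) (a : Fin d → ℝ)
    {q : EuclideanSpace ℝ (Fin d) → ℝ} (hq : ContDiff ℝ (⊤ : ℕ∞) q)
    (hsupp : tsupport q ⊆ Metric.ball 0 1) :
    h A * (volume (Metric.ball (0 : EuclideanSpace ℝ (Fin d)) 1)).toReal ≤
      ∫ z in Metric.ball (0 : EuclideanSpace ℝ (Fin d)) 1, h (A + symTensor a (coordGrad q z)) := by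
  have := hqc A hA (fun z => q z • WithLp.toLp 2 a) (hq.smul contDiff_const)
    ((closure_mono (Function.support_smul_subset_left _ _)).trans hsupp)
  simpa only [symGradE_smul_const (hq.differentiable (by simp) _)] using this

end

/-- A locally bounded Borel function `h` on symmetric `d×d` matrices that is
symmetric-quasiconvex is convex along symmetric rank-one directions `a ⊙ b`. -/
theorem symQuasiconvex_convex_along_symTensor {d : ℕ}
    (h : Matrix (Fin d) (Fin d) ℝ → ℝ) (hmeas : Measurable fun v : Fin d → Fin d → ℝ => h (Matrix.of v))
    (hloc : ∀ K : Set (Matrix (Fin d) (Fin d) ℝ), IsCompact K → ∃ M : ℝ, ∀ A ∈ K, |h A| ≤ M)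
    (hqc : SymQuasiconvex h)
    (A₁ A₂ : Matrix (Fin d) (Fin d) ℝ) (hA₁ : A₁.IsSymm) (hA₂ : A₂.IsSymm)
    (a b : Fin d → ℝ) (hab : A₂ - A₁ = symTensor a b)
    (θ : ℝ) (hθ : θ ∈ Set.Icc (0 : ℝ) 1) :
    h (θ • A₁ + (1 - θ) • A₂) ≤ θ * h A₁ + (1 - θ) * h A₂ := by
  set A := θ • A₁ + (1 - θ) • A₂ with hA
  have hAsymm : A.IsSymm := (hA₁.smul θ).add (hA₂.smul (1 - θ))
  have hcont : Continuous fun p : Fin d → ℝ => A + symTensor a p :=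
    continuous_const.add (continuous_symTensor_right a)
  set P : (Fin d → ℝ) → ℝ := fun p => h (A + symTensor a p) with hP
  have hPmeas : Measurable P := by
    refine hmeas.comp (measurable_pi_lambda _ fun i => measurable_pi_lambda _ fun j => ?_)
    exact (continuous_apply_apply i j |>.comp hcont).measurable
  have hPbd : ∀ R : ℝ, ∃ M : ℝ, ∀ p, ‖p‖ ≤ R → |P p| ≤ M := fun R => by
    obtain ⟨M, hM⟩ := hloc _ ((isCompact_closedBall (0 : Fin d → ℝ) R).image hcont)
    exact ⟨M, fun p hp => hM _ ⟨p, mem_closedBall_zero_iff.2 hp, rfl⟩⟩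
  have hP0 : P 0 = h A := by simp only [hP, symTensor_zero_right, add_zero]
  obtain ⟨M, hM⟩ := hPbd ‖b‖
  have key := le_two_point_of_le_integral_periodic (f := fun t => P (t • b)) (M := M)
    (m := 1 - θ) (hPmeas.comp (by fun_prop))
    (fun t ht => hM _ (by
      rw [norm_smul]
      exact mul_le_of_le_one_left (norm_nonneg _) (abs_le.2 ht)))
    (fun v hv hper hmean => by
      rw [zero_smul]
      refine le_integral_periodic_profile hPmeas hPbd (fun q hq hsupp => ?_) hv hper hmean b
      rw [hP0]
      exact hqc.le_coordGrad hAsymm a hq hsupp)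
    ⟨by linarith [hθ.2], by linarith [hθ.1]⟩
  have h1 : A + symTensor a (-(1 - θ) • b) = A₁ := by
    rw [symTensor_smul_right, ← hab, hA]
    module
  have h2 : A + symTensor a ((1 - (1 - θ)) • b) = A₂ := by
    rw [symTensor_smul_right, ← hab, hA]
    module
  simp only [zero_smul, hP0] at key
  simp only [hP, h1, h2] at key
  linarith
end

section
/- Let h be a locally bounded Borel-measurable real-valued function on the symmetric d×d real matrices which is symmetric-quasiconvex and has linear growth at infinity, i.e. there is M > 0 with |h(A)| ≤ M(1 + |A|) for all symmetric A (Frobenius norm). Then h is globally Lipschitz continuous: there exists L > 0 such that |h(A) − h(B)| ≤ L |A − B| for all symmetric d×d matrices A, B. -/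
open MeasureTheory

open Set Filter Topology

/-- The derivative of `Real.smoothTransition` is globally bounded. -/
lemma exists_abs_deriv_smoothTransition_le :
    ∃ K : ℝ, 0 ≤ K ∧ ∀ t, |deriv Real.smoothTransition t| ≤ K := by
  have hc : Continuous (deriv Real.smoothTransition) :=
    (Real.smoothTransition.contDiff (n := 1)).continuous_deriv le_rfl
  obtain ⟨K, hK⟩ := (isCompact_Icc (a := (0 : ℝ)) (b := 1)).exists_bound_of_continuousOn
    hc.continuousOn
  have hK0 : 0 ≤ K := (norm_nonneg _).trans (hK 0 (by simp))
  refine ⟨K, hK0, fun t => ?_⟩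
  by_cases ht : t ∈ Icc (0 : ℝ) 1
  · exact hK t ht
  have hd : deriv Real.smoothTransition t = 0 := by
    rw [mem_Icc, not_and_or, not_le, not_le] at ht
    rcases ht with ht | ht
    · have : Real.smoothTransition =ᶠ[𝓝 t] fun _ => (0 : ℝ) := by
        filter_upwards [Iio_mem_nhds ht] with s hs
        exact Real.smoothTransition.zero_of_nonpos (le_of_lt hs)
      simp [this.deriv_eq]
    · have : Real.smoothTransition =ᶠ[𝓝 t] fun _ => (1 : ℝ) := by
        filter_upwards [Ioi_mem_nhds ht] with s hs
        exact Real.smoothTransition.one_of_one_le (le_of_lt hs)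
      simp [this.deriv_eq]
  simpa [hd] using hK0

lemma frobNorm_nonneg {d : ℕ} (A : Matrix (Fin d) (Fin d) ℝ) : 0 ≤ frobNorm A :=
  Real.sqrt_nonneg _

lemma abs_apply_le_frobNorm {d : ℕ} (A : Matrix (Fin d) (Fin d) ℝ) (i j : Fin d) :
    |A i j| ≤ frobNorm A := by
  refine Real.abs_le_sqrt ?_
  calc A i j ^ 2 ≤ ∑ l, A i l ^ 2 :=
        Finset.single_le_sum (f := fun l => A i l ^ 2) (fun l _ => sq_nonneg _)
          (Finset.mem_univ j)
    _ ≤ _ := Finset.single_le_sum (f := fun k => ∑ l, A k l ^ 2)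
          (fun k _ => Finset.sum_nonneg fun l _ => sq_nonneg _) (Finset.mem_univ i)

lemma frobNorm_le_of_abs_apply_le {d : ℕ} {A : Matrix (Fin d) (Fin d) ℝ} {m : ℝ} (hm : 0 ≤ m)
    (h : ∀ i j, |A i j| ≤ m) : frobNorm A ≤ d * m := by
  refine Real.sqrt_le_iff.2 ⟨by positivity, ?_⟩
  calc ∑ i, ∑ j, A i j ^ 2 ≤ ∑ _i : Fin d, ∑ _j : Fin d, m ^ 2 := by
        refine Finset.sum_le_sum fun i _ => Finset.sum_le_sum fun j _ => ?_
        exact sq_le_sq.2 ((h i j).trans (le_abs_self m))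
    _ = (d * m) ^ 2 := by simp; ring

lemma frobNorm_neg {d : ℕ} (A : Matrix (Fin d) (Fin d) ℝ) : frobNorm (-A) = frobNorm A := by
  simp [frobNorm]

lemma symGradE_isSymm {d : ℕ} (ψ : EuclideanSpace ℝ (Fin d) → EuclideanSpace ℝ (Fin d))
    (x : EuclideanSpace ℝ (Fin d)) : (symGradE ψ x).IsSymm := by
  ext i j
  simp [symGradE, add_comm]

/-- The linear map `x ↦ C x`, cut off smoothly to the open unit ball within a boundary layer of
width comparable to `ε`. -/
noncomputable def cutoffLinear {d : ℕ} (C : Matrix (Fin d) (Fin d) ℝ) (ε : ℝ)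
    (x : EuclideanSpace ℝ (Fin d)) : EuclideanSpace ℝ (Fin d) :=
  Real.smoothTransition ((1 - ‖x‖ ^ 2) / ε - 1) • Matrix.toEuclideanCLM (𝕜 := ℝ) C x

lemma contDiff_cutoffLinear {d : ℕ} (C : Matrix (Fin d) (Fin d) ℝ) (ε : ℝ) :
    ContDiff ℝ (⊤ : ℕ∞) (cutoffLinear C ε) := by
  unfold cutoffLinear
  refine ContDiff.smul (Real.smoothTransition.contDiff.comp ?_) (ContinuousLinearMap.contDiff _)
  exact ((contDiff_const.sub (contDiff_norm_sq ℝ)).div_const ε).sub contDiff_const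

lemma tsupport_cutoffLinear_subset {d : ℕ} (C : Matrix (Fin d) (Fin d) ℝ) {ε : ℝ} (hε : 0 < ε) :
    tsupport (cutoffLinear C ε) ⊆ Metric.ball 0 1 := by
  have hcl : IsClosed {x : EuclideanSpace ℝ (Fin d) | ‖x‖ ^ 2 ≤ 1 - ε} :=
    isClosed_le (by fun_prop) continuous_const
  refine (closure_minimal (fun x hx => ?_) hcl).trans fun x hx => ?_
  · by_contra hx'
    refine hx ?_
    have hx'' : 1 - ε < ‖x‖ ^ 2 := not_le.1 hx'
    have : (1 - ‖x‖ ^ 2) / ε - 1 ≤ 0 := by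
      rw [sub_nonpos, div_le_one hε]; linarith
    simp [cutoffLinear, Real.smoothTransition.zero_of_nonpos this]
  · have hx' : ‖x‖ ^ 2 ≤ 1 - ε := hx
    rw [mem_ball_zero_iff]
    nlinarith [norm_nonneg x]

lemma symGradE_cutoffLinear_apply {d : ℕ} {C : Matrix (Fin d) (Fin d) ℝ} (hC : C.IsSymm) (ε : ℝ)
    (x : EuclideanSpace ℝ (Fin d)) (i j : Fin d) :
    symGradE (cutoffLinear C ε) x i j =
      Real.smoothTransition ((1 - ‖x‖ ^ 2) / ε - 1) * C i j -
        deriv Real.smoothTransition ((1 - ‖x‖ ^ 2) / ε - 1) / ε *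
          (x j * ∑ k, C i k * x k + x i * ∑ k, C j k * x k) := by
  have hφ : HasFDerivAt (fun y : EuclideanSpace ℝ (Fin d) => (1 - ‖y‖ ^ 2) / ε - 1)
      (ε⁻¹ • (-((2 : ℝ) • innerSL ℝ x)) : EuclideanSpace ℝ (Fin d) →L[ℝ] ℝ) x := by
    have := ((((hasStrictFDerivAt_norm_sq x).hasFDerivAt).const_sub 1).const_mul ε⁻¹).sub_const 1
    simpa only [div_eq_inv_mul, ofNat_smul_eq_nsmul, two_smul] using this
  have hg : HasDerivAt Real.smoothTransition _ ((1 - ‖x‖ ^ 2) / ε - 1) :=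
    ((Real.smoothTransition.contDiff (n := 1)).differentiable one_ne_zero _).hasDerivAt
  have hψ : HasFDerivAt (cutoffLinear C ε) _ x :=
    (hg.comp_hasFDerivAt x hφ).smul (Matrix.toEuclideanCLM (𝕜 := ℝ) C).hasFDerivAt
  have hji : C j i = C i j := hC.apply i j
  simp only [symGradE, hψ.fderiv]
  simp [Matrix.mulVec, dotProduct, hji, EuclideanSpace.inner_single_right]
  ring

lemma symGradE_cutoffLinear_of_mem_ball {d : ℕ} {C : Matrix (Fin d) (Fin d) ℝ} (hC : C.IsSymm)
    {ε : ℝ} (hε : 0 < ε) {x : EuclideanSpace ℝ (Fin d)}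
    (hx : x ∈ Metric.ball 0 (1 - 2 * ε)) : symGradE (cutoffLinear C ε) x = C := by
  rw [mem_ball_zero_iff] at hx
  have ht : 1 < (1 - ‖x‖ ^ 2) / ε - 1 := by
    rw [lt_sub_iff_add_lt, lt_div_iff₀ hε]
    nlinarith [norm_nonneg x]
  have hd : deriv Real.smoothTransition ((1 - ‖x‖ ^ 2) / ε - 1) = 0 := by
    have : Real.smoothTransition =ᶠ[𝓝 ((1 - ‖x‖ ^ 2) / ε - 1)] fun _ => (1 : ℝ) := by
      filter_upwards [Ioi_mem_nhds ht] with s hs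
      exact Real.smoothTransition.one_of_one_le (le_of_lt hs)
    simp [this.deriv_eq]
  ext i j
  rw [symGradE_cutoffLinear_apply hC, hd, Real.smoothTransition.one_of_one_le ht.le]
  simp

lemma abs_symGradE_cutoffLinear_apply_le {d : ℕ} {C : Matrix (Fin d) (Fin d) ℝ} (hC : C.IsSymm)
    {K : ℝ} (hK : ∀ t, |deriv Real.smoothTransition t| ≤ K) {ε : ℝ} (hε : 0 < ε)
    {x : EuclideanSpace ℝ (Fin d)} (hx : x ∈ Metric.ball 0 1) (i j : Fin d) :
    |symGradE (cutoffLinear C ε) x i j| ≤ frobNorm C + K / ε * (2 * d * frobNorm C) := by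
  rw [mem_ball_zero_iff] at hx
  have hx1 (k : Fin d) : |x k| ≤ 1 := (PiLp.norm_apply_le x k).trans hx.le
  have hC0 := frobNorm_nonneg C
  have hmul (k l : Fin d) : |x l * ∑ m, C k m * x m| ≤ d * frobNorm C := by
    rw [abs_mul]
    have hsum : |∑ m, C k m * x m| ≤ d * frobNorm C := by
      calc |∑ m, C k m * x m| ≤ ∑ m, |C k m * x m| := Finset.abs_sum_le_sum_abs _ _
        _ ≤ ∑ _m : Fin d, frobNorm C := by
          gcongr with m
          rw [abs_mul]
          simpa using mul_le_mul (abs_apply_le_frobNorm C k m) (hx1 m) (abs_nonneg _) hC0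
        _ = d * frobNorm C := by simp
    simpa using mul_le_mul (hx1 l) hsum (abs_nonneg _) zero_le_one
  have hK0 : 0 ≤ K := (abs_nonneg _).trans (hK 0)
  rw [symGradE_cutoffLinear_apply hC]
  refine (abs_sub _ _).trans (add_le_add ?_ ?_)
  · rw [abs_mul, abs_of_nonneg (Real.smoothTransition.nonneg _)]
    simpa using mul_le_mul (Real.smoothTransition.le_one _) (abs_apply_le_frobNorm C i j)
      (abs_nonneg _) zero_le_one
  · rw [abs_mul, abs_div, abs_of_pos hε]
    refine mul_le_mul (by gcongr; exact hK _) ?_ (abs_nonneg _) (by positivity)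
    refine (abs_add_le _ _).trans ?_
    linarith [hmul i j, hmul j i]

lemma continuous_symGradE {d : ℕ} {ψ : EuclideanSpace ℝ (Fin d) → EuclideanSpace ℝ (Fin d)}
    (hψ : ContDiff ℝ (⊤ : ℕ∞) ψ) : Continuous (symGradE ψ) := by
  have h1 : Continuous (fderiv ℝ ψ) := hψ.continuous_fderiv (by simp)
  refine continuous_matrix fun i j => ?_
  unfold symGradE
  fun_prop

/-- Splitting the unit ball of volume `V` into a ball of radius `r`, on which a function is equal
to `c`, and a remaining layer, on which it is at most `P`, bounds its integral. -/
lemma setIntegral_ball_le {d : ℕ} {f : EuclideanSpace ℝ (Fin d) → ℝ} (hf : Measurable f)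
    {P c r : ℝ} (hr0 : 0 < r) (hr1 : r ≤ 1) (hP : ∀ x ∈ Metric.ball 0 1, |f x| ≤ P)
    (hc : ∀ x ∈ Metric.ball 0 r, f x = c) :
    ∫ x in Metric.ball 0 1, f x ≤
      (r ^ d * c + (1 - r ^ d) * P) *
        (volume (Metric.ball (0 : EuclideanSpace ℝ (Fin d)) 1)).toReal := by
  set V := (volume (Metric.ball (0 : EuclideanSpace ℝ (Fin d)) 1)).toReal
  have hsub : Metric.ball (0 : EuclideanSpace ℝ (Fin d)) r ⊆ Metric.ball 0 1 :=
    Metric.ball_subset_ball hr1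
  have hVr : volume.real (Metric.ball (0 : EuclideanSpace ℝ (Fin d)) r) = r ^ d * V := by
    rw [measureReal_def, Measure.addHaar_ball_of_pos _ _ hr0, ENNReal.toReal_mul,
      ENNReal.toReal_ofReal (by positivity)]
    simp [V]
  have hVd : volume.real (Metric.ball (0 : EuclideanSpace ℝ (Fin d)) 1 \ Metric.ball 0 r) =
      (1 - r ^ d) * V := by
    rw [measureReal_sdiff hsub measurableSet_ball, hVr]
    simp only [V, measureReal_def]
    ring
  have hint : IntegrableOn f (Metric.ball 0 1) :=
    Measure.integrableOn_of_bounded measure_ball_lt_top.ne hf.aestronglyMeasurable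
      ((ae_restrict_iff' measurableSet_ball).2 (ae_of_all _ hP))
  have hlayer : ∫ x in Metric.ball 0 1 \ Metric.ball 0 r, f x ≤ (1 - r ^ d) * V * P := by
    rw [← hVd]
    calc ∫ x in Metric.ball 0 1 \ Metric.ball 0 r, f x
        ≤ ∫ _x in Metric.ball (0 : EuclideanSpace ℝ (Fin d)) 1 \ Metric.ball 0 r, P := by
          refine setIntegral_mono_on (hint.mono_set sdiff_subset) ?_
            (measurableSet_ball.diff measurableSet_ball)
            fun x hx => (le_abs_self _).trans (hP x hx.1)
          exact integrableOn_const
            ((measure_mono sdiff_subset).trans_lt measure_ball_lt_top).ne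
      _ = _ := by simp
  have hsplit := setIntegral_sdiff (f := f) (μ := volume) measurableSet_ball hint hsub
  have hinner : ∫ x in Metric.ball 0 r, f x = r ^ d * V * c := by
    rw [setIntegral_congr_fun measurableSet_ball hc]
    simp [hVr]
  linarith

lemma SymQuasiconvex.le_of_growth {d : ℕ} {h : Matrix (Fin d) (Fin d) ℝ → ℝ}
    (hmeas : Measurable fun v : Fin d → Fin d → ℝ => h (Matrix.of v)) (hqc : SymQuasiconvex h)
    {M : ℝ} (hM : 0 < M)
    (hgrowth : ∀ A : Matrix (Fin d) (Fin d) ℝ, A.IsSymm → |h A| ≤ M * (1 + frobNorm A))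
    {K : ℝ} (hK : ∀ t, |deriv Real.smoothTransition t| ≤ K)
    {A C : Matrix (Fin d) (Fin d) ℝ} (hA : A.IsSymm) (hC : C.IsSymm) {ε : ℝ} (hε : 0 < ε)
    (hε' : ε < 1 / 2) :
    h A ≤ (1 - 2 * ε) ^ d * h (A + C) + (1 - (1 - 2 * ε) ^ d) *
      (M * (1 + d * (frobNorm A + (frobNorm C + K / ε * (2 * d * frobNorm C))))) := by
  have hK0 : 0 ≤ K := (abs_nonneg _).trans (hK 0)
  have hA0 := frobNorm_nonneg A
  have hC0 := frobNorm_nonneg C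
  have hψ := contDiff_cutoffLinear C ε
  have hV : 0 < (volume (Metric.ball (0 : EuclideanSpace ℝ (Fin d)) 1)).toReal :=
    ENNReal.toReal_pos (Metric.measure_ball_pos _ _ one_pos).ne' measure_ball_lt_top.ne
  refine le_of_mul_le_mul_right ((hqc A hA _ hψ (tsupport_cutoffLinear_subset C hε)).trans
    (setIntegral_ball_le ?_ (by linarith) (by linarith) (fun x hx => ?_) fun x hx => ?_)) hV
  · have hcont : Continuous fun z => A + symGradE (cutoffLinear C ε) z :=
      continuous_const.add (continuous_symGradE hψ)
    have hcont' : Continuous fun z => (fun i j => (A + symGradE (cutoffLinear C ε) z) i j :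
        Fin d → Fin d → ℝ) := hcont
    exact hmeas.comp hcont'.measurable
  · refine (hgrowth _ (hA.add (symGradE_isSymm _ _))).trans ?_
    gcongr
    refine frobNorm_le_of_abs_apply_le (by positivity) fun i j => (abs_add_le _ _).trans ?_
    exact add_le_add (abs_apply_le_frobNorm A i j)
      (abs_symGradE_cutoffLinear_apply_le hC hK hε hx i j)
  · rw [symGradE_cutoffLinear_of_mem_ball hC hε hx]

lemma SymQuasiconvex.sub_le_of_growth {d : ℕ} {h : Matrix (Fin d) (Fin d) ℝ → ℝ}
    (hmeas : Measurable fun v : Fin d → Fin d → ℝ => h (Matrix.of v)) (hqc : SymQuasiconvex h)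
    {M : ℝ} (hM : 0 < M)
    (hgrowth : ∀ A : Matrix (Fin d) (Fin d) ℝ, A.IsSymm → |h A| ≤ M * (1 + frobNorm A))
    {K : ℝ} (hK : ∀ t, |deriv Real.smoothTransition t| ≤ K)
    {A B : Matrix (Fin d) (Fin d) ℝ} (hA : A.IsSymm) (hB : B.IsSymm) :
    h A - h B ≤ 4 * M * K * d ^ 3 * frobNorm (A - B) := by
  have hK0 : 0 ≤ K := (abs_nonneg _).trans (hK 0)
  have hA0 := frobNorm_nonneg A
  have hAB := frobNorm_nonneg (A - B)
  set N := frobNorm (A - B)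
  set Q := M * (1 + d * (frobNorm A + N)) + |h B| with hQ
  have hQ0 : 0 ≤ Q := by positivity
  have hkey : ∀ ε : ℝ, 0 < ε → ε < 1 / 2 →
      h A - h B ≤ 4 * M * K * d ^ 3 * N + 2 * d * ε * Q := by
    intro ε hε hε'
    have hle := hqc.le_of_growth hmeas hM hgrowth hK hA (hB.sub hA) hε hε'
    have hN : frobNorm (B - A) = N := by rw [← neg_sub, frobNorm_neg]
    rw [add_sub_cancel, hN] at hle
    have hbern : 1 - (1 - 2 * ε) ^ d ≤ 2 * d * ε := by
      have := one_add_mul_le_pow (a := -(2 * ε)) (by linarith) d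
      rw [← sub_eq_add_neg] at this
      linarith
    set s := (1 - 2 * ε) ^ d
    calc h A - h B
        ≤ (1 - s) * (M * (1 + d * (frobNorm A + (N + K / ε * (2 * d * N)))) - h B) := by
          linarith
      _ ≤ (1 - s) * (Q + M * d * (K / ε * (2 * d * N))) := by
          have hs : s ≤ 1 := pow_le_one₀ (by linarith) (by linarith)
          refine mul_le_mul_of_nonneg_left ?_ (by linarith)
          rw [hQ]
          linarith [neg_le_abs (h B)]
      _ ≤ 2 * d * ε * (Q + M * d * (K / ε * (2 * d * N))) := by gcongr
      _ = 4 * M * K * d ^ 3 * N + 2 * d * ε * Q := by field_simp; ring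
  have hlim : Tendsto (fun ε : ℝ => 4 * M * K * d ^ 3 * N + 2 * d * ε * Q) (𝓝[>] 0)
      (𝓝 (4 * M * K * d ^ 3 * N)) := by
    have : Continuous fun ε : ℝ => 4 * M * K * d ^ 3 * N + 2 * d * ε * Q := by fun_prop
    simpa using (this.tendsto 0).mono_left nhdsWithin_le_nhds
  refine ge_of_tendsto hlim ?_
  filter_upwards [Ioo_mem_nhdsGT (show (0 : ℝ) < 1 / 2 by norm_num)] with ε hε
  exact hkey ε hε.1 hε.2

/-- A locally bounded Borel function `h` on symmetric `d×d` matrices that is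
symmetric-quasiconvex and of linear growth at infinity is globally Lipschitz on symmetric
matrices (with respect to the Frobenius norm). -/
theorem symQuasiconvex_linearGrowth_lipschitz {d : ℕ}
    (h : Matrix (Fin d) (Fin d) ℝ → ℝ) (hmeas : Measurable fun v : Fin d → Fin d → ℝ => h (Matrix.of v))
    (hloc : ∀ K : Set (Matrix (Fin d) (Fin d) ℝ), IsCompact K → ∃ M : ℝ, ∀ A ∈ K, |h A| ≤ M)
    (hqc : SymQuasiconvex h)
    (M : ℝ) (hM : 0 < M)
    (hgrowth : ∀ A : Matrix (Fin d) (Fin d) ℝ, A.IsSymm → |h A| ≤ M * (1 + frobNorm A)) :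
    ∃ L > 0, ∀ A B : Matrix (Fin d) (Fin d) ℝ, A.IsSymm → B.IsSymm →
      |h A - h B| ≤ L * frobNorm (A - B) := by
  obtain ⟨K, hK0, hK⟩ := exists_abs_deriv_smoothTransition_le
  refine ⟨4 * M * K * d ^ 3 + 1, by positivity, fun A B hA hB => ?_⟩
  have h₁ := hqc.sub_le_of_growth hmeas hM hgrowth hK hA hB
  have h₂ := hqc.sub_le_of_growth hmeas hM hgrowth hK hB hA
  rw [← neg_sub A B, frobNorm_neg] at h₂
  rw [abs_sub_le_iff]
  constructor <;> linarith [frobNorm_nonneg (A - B)]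
end

section
/- Let μ be a finite Borel measure on ℝ^d, let t > 1, β > 0 and r > 0. Then μ({ x ∈ ℝ^d : μ(B(x, t r)) ≥ β · μ(B(x, r)) }) ≤ (2(t+1))^d · μ(ℝ^d) / β. -/
open MeasureTheory

theorem lintegral_measure_ball {E : Type*} [NormedAddCommGroup E] [MeasurableSpace E]
    [BorelSpace E] [SecondCountableTopology E] (ν vol : Measure E) [SFinite ν] [SFinite vol]
    [vol.IsAddLeftInvariant] (s : ℝ) :
    ∫⁻ y, ν (Metric.ball y s) ∂vol = vol (Metric.ball 0 s) * ν Set.univ := by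
  have hS : MeasurableSet {p : E × E | dist p.1 p.2 < s} :=
    (isOpen_lt (by fun_prop) continuous_const).measurableSet
  have h := (Measure.prod_apply (μ := ν) (ν := vol) hS).symm.trans (Measure.prod_apply_symm hS)
  have hx (x : E) : vol (Prod.mk x ⁻¹' {p : E × E | dist p.1 p.2 < s})
      = vol (Metric.ball 0 s) := by
    rw [← measure_preimage_add vol (-x) (Metric.ball 0 s)]
    congr 1
    ext y
    simp [dist_eq_norm, norm_sub_rev x y, neg_add_eq_sub]
  simp only [hx, lintegral_const] at h
  exact h.symm

/-- In a set where balls of radius `t * r` have at least `β` times the measure of those of radius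
`r`, a ball of radius `r / 2` has `β` times its measure at most that of a concentric ball of
radius `(t + 1 / 2) * r`. -/
theorem mul_restrict_ball_le {X : Type*} [PseudoMetricSpace X] [MeasurableSpace X]
    [OpensMeasurableSpace X] (μ : Measure X) (b : ENNReal) (t r : ℝ) (y : X) :
    b * μ.restrict {x | b * μ (Metric.ball x r) ≤ μ (Metric.ball x (t * r))}
        (Metric.ball y (r / 2)) ≤ μ (Metric.ball y ((t + 1 / 2) * r)) := by
  rw [Measure.restrict_apply Metric.isOpen_ball.measurableSet]
  obtain h | ⟨x, hxy, hx⟩ := (Metric.ball y (r / 2) ∩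
    {x | b * μ (Metric.ball x r) ≤ μ (Metric.ball x (t * r))}).eq_empty_or_nonempty
  · simp [h]
  rw [Metric.mem_ball] at hxy
  calc _ ≤ b * μ (Metric.ball x r) := by
        gcongr
        refine Set.inter_subset_left.trans (Metric.ball_subset_ball' ?_)
        rw [dist_comm]
        linarith
    _ ≤ μ (Metric.ball x (t * r)) := hx
    _ ≤ _ := measure_mono (Metric.ball_subset_ball' (by linarith))

/-- For a finite Borel measure `μ` on `ℝ^d`, `t > 1`, `β > 0` and `r > 0`,
the set of points `x` with `μ(B(x,tr)) ≥ β μ(B(x,r))` has `μ`-measure at most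
`(2(t+1))^d μ(ℝ^d) / β`. -/
theorem doubling_exceptional_set_bound {d : ℕ}
    (μ : Measure (EuclideanSpace ℝ (Fin d))) [IsFiniteMeasure μ]
    (t β r : ℝ) (ht : 1 < t) (hβ : 0 < β) (hr : 0 < r) :
    μ {x | ENNReal.ofReal β * μ (Metric.ball x r) ≤ μ (Metric.ball x (t * r))}
      ≤ ENNReal.ofReal ((2 * (t + 1)) ^ d / β) * μ Set.univ := by
  set S := {x | ENNReal.ofReal β * μ (Metric.ball x r) ≤ μ (Metric.ball x (t * r))}
  set v := volume (Metric.ball (0 : EuclideanSpace ℝ (Fin d)) (r / 2))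
  have hv : v ≠ 0 := (Metric.measure_ball_pos _ _ (by positivity)).ne'
  have hv' : v ≠ ⊤ := measure_ball_lt_top.ne
  have hβ0 : ENNReal.ofReal β ≠ 0 := by simpa using hβ
  have hball : volume (Metric.ball (0 : EuclideanSpace ℝ (Fin d)) ((t + 1 / 2) * r))
      = ENNReal.ofReal ((2 * t + 1) ^ d) * v := by
    rw [show (t + 1 / 2) * r = (2 * t + 1) * (r / 2) by ring,
      Measure.addHaar_ball_mul_of_pos _ _ (by linarith), finrank_euclideanSpace_fin]
  have key : ENNReal.ofReal β * (v * μ S)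
      ≤ ENNReal.ofReal ((2 * t + 1) ^ d) * v * μ Set.univ := by
    rw [← hball, ← lintegral_measure_ball, ← Measure.restrict_apply_univ S,
      ← lintegral_measure_ball, ← lintegral_const_mul' _ _ ENNReal.ofReal_ne_top]
    exact lintegral_mono (mul_restrict_ball_le μ _ t r)
  rw [mul_left_comm, mul_comm _ v, mul_assoc, ENNReal.mul_le_mul_iff_right hv hv'] at key
  rw [← ENNReal.mul_le_mul_iff_right hβ0 ENNReal.ofReal_ne_top, ← mul_assoc,
    ← ENNReal.ofReal_mul hβ.le, mul_div_cancel₀ _ hβ.ne']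
  refine key.trans ?_
  gcongr
  linarith
end

section
/- Let μ be a nonzero finite Borel measure on ℝ^d. Then for μ-almost every x₀ ∈ ℝ^d there exists a sequence of radii r_n > 0 with r_n → 0 such that μ(B(x₀, r_n)) > 0 for all n and, for every k ∈ ℕ, limsup_{n→∞} μ(B(x₀, k r_n)) / μ(B(x₀, r_n)) < ∞. -/
open MeasureTheory Filter

/-- A bounded function that is at least `c * r ^ d` near `0` admits arbitrarily small radii at which
its growth on larger scales is controlled by the power `d + 1`. -/
lemma exists_radius_forall_ge_pow_mul_le {f : ℝ → ℝ} {M c : ℝ} {d : ℕ}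
    (h_nonneg : ∀ r, 0 ≤ f r) (hM : ∀ r, f r ≤ M) (hc : 0 < c)
    (hf : ∀ᶠ r in nhdsWithin 0 (Set.Ioi 0), c * r ^ d ≤ f r) {δ : ℝ} (hδ : 0 < δ) :
    ∃ r, 0 < r ∧ r < δ ∧ 0 < f r ∧ ∀ s, r ≤ s → f s / s ^ (d + 1) ≤ 2 * (f r / r ^ (d + 1)) := by
  have hM0 : 0 ≤ M := (h_nonneg 0).trans (hM 0)
  have hbound : ∀ t, 0 < t → ∀ s, t ≤ s → f s / s ^ (d + 1) ≤ M / t ^ (d + 1) := by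
    intro t ht s hs
    have := hM s
    gcongr
  set S := M / δ ^ (d + 1) with hS
  have hS0 : 0 ≤ S := by positivity
  obtain ⟨t, ⟨hft, htc⟩, ht⟩ := ((hf.and (Ioo_mem_nhdsGT
    (show (0 : ℝ) < c / (2 * S + 1) by positivity))).and self_mem_nhdsWithin).exists
  have ht0 : (0 : ℝ) < t := ht
  have hgt : 2 * S < f t / t ^ (d + 1) := by
    have h1 : t * (2 * S + 1) < c := (lt_div_iff₀ (by positivity)).1 htc.2
    rw [lt_div_iff₀ (by positivity), pow_succ]
    have : 0 < t ^ d := by positivity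
    nlinarith
  set A := (fun s => f s / s ^ (d + 1)) '' Set.Ici t with hA
  have hbdd : BddAbove A := by
    refine ⟨M / t ^ (d + 1), ?_⟩
    rintro _ ⟨s, hs, rfl⟩
    exact hbound t ht0 s hs
  have htA : f t / t ^ (d + 1) ≤ sSup A := le_csSup hbdd ⟨t, Set.self_mem_Ici, rfl⟩
  obtain ⟨_, ⟨r, hr, rfl⟩, hlt⟩ := exists_lt_of_lt_csSup (s := A)
    ⟨_, t, Set.self_mem_Ici, rfl⟩ (show sSup A / 2 < sSup A by linarith)
  simp only at hlt
  have hr0 : 0 < r := ht0.trans_le hr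
  have hgr : S < f r / r ^ (d + 1) := by linarith
  refine ⟨r, hr0, ?_, ?_, fun s hs => ?_⟩
  · by_contra! h
    exact absurd (hbound δ hδ r h) (not_le.2 hgr)
  · have : 0 < f r / r ^ (d + 1) := hS0.trans_lt hgr
    exact (div_pos_iff_of_pos_right (by positivity)).1 this
  · have : f s / s ^ (d + 1) ≤ sSup A := le_csSup hbdd ⟨s, le_trans hr hs, rfl⟩
    linarith

/-- At almost every point, a finite measure has positive lower density with respect to an additive
Haar measure. -/
lemma ae_exists_mul_pow_le_measureReal_ball {E : Type*} [NormedAddCommGroup E]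
    [NormedSpace ℝ E] [FiniteDimensional ℝ E] [MeasurableSpace E] [BorelSpace E]
    (μ : Measure E) [IsFiniteMeasure μ] :
    ∀ᵐ x ∂μ, ∃ c : ℝ, 0 < c ∧ ∀ᶠ r in nhdsWithin (0 : ℝ) (Set.Ioi 0),
      c * r ^ Module.finrank ℝ E ≤ μ.real (Metric.ball x r) := by
  set ν : Measure E := Measure.addHaar
  filter_upwards [Besicovitch.ae_tendsto_rnDeriv ν μ, ν.rnDeriv_lt_top μ] with x hx hxt
  obtain ⟨C, hC, hCt⟩ := ENNReal.lt_iff_exists_nnreal_btwn.1 hxt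
  set v := ν.real (Metric.ball (0 : E) 1)
  have hv : 0 < v := ENNReal.toReal_pos (Metric.measure_ball_pos ν 0 one_pos).ne'
    measure_ball_lt_top.ne
  have hC0 : 0 < C := by exact_mod_cast (zero_le (a := ν.rnDeriv μ x)).trans_lt hC
  have hhalf : Tendsto (fun r : ℝ => r / 2) (nhdsWithin 0 (Set.Ioi 0))
      (nhdsWithin 0 (Set.Ioi 0)) := by
    refine tendsto_nhdsWithin_iff.2 ⟨?_, ?_⟩
    · exact ((continuous_id.div_const 2).tendsto' 0 0 (by simp)).mono_left nhdsWithin_le_nhds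
    · filter_upwards [self_mem_nhdsWithin] with r hr using half_pos (Set.mem_Ioi.1 hr)
  refine ⟨v / (C * 2 ^ Module.finrank ℝ E), by positivity, ?_⟩
  filter_upwards [hhalf.eventually (hx.eventually_lt_const hC), self_mem_nhdsWithin] with r hr hr0
  have hr0 : 0 < r := hr0
  have h1 : ν (Metric.closedBall x (r / 2)) ≤ C * μ (Metric.closedBall x (r / 2)) :=
    (ENNReal.div_le_iff_le_mul (Or.inr ENNReal.coe_ne_top) (Or.inl (measure_ne_top _ _))).1 hr.le
  have h2 := ENNReal.toReal_mono
    (ENNReal.mul_ne_top ENNReal.coe_ne_top (measure_ne_top _ _)) h1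
  rw [Measure.addHaar_closedBall ν x (half_pos hr0).le, ENNReal.toReal_mul, ENNReal.toReal_mul,
    ENNReal.toReal_ofReal (by positivity), ENNReal.coe_toReal] at h2
  have h3 : μ.real (Metric.closedBall x (r / 2)) ≤ μ.real (Metric.ball x r) :=
    measureReal_mono (Metric.closedBall_subset_ball (half_lt_self hr0))
  have h4 : (r / 2) ^ Module.finrank ℝ E * v ≤ C * μ.real (Metric.ball x r) :=
    h2.trans (mul_le_mul_of_nonneg_left h3 C.2)
  rw [div_pow, div_mul_eq_mul_div, div_le_iff₀ (by positivity)] at h4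
  rw [div_mul_eq_mul_div, div_le_iff₀ (by positivity)]
  linarith

/-- For a nonzero finite Borel measure `μ` on `ℝ^d`, at `μ`-almost every
point `x₀` there are radii `r_n ↓ 0` with `μ(B(x₀,r_n)) > 0` and, for every `k ∈ ℕ`,
`limsup_n μ(B(x₀, k r_n)) / μ(B(x₀, r_n)) < ∞`. -/
theorem ae_exists_radii_bounded_doubling_ratio {d : ℕ}
    (μ : Measure (EuclideanSpace ℝ (Fin d))) [IsFiniteMeasure μ] (hμ : μ ≠ 0) :
    ∀ᵐ x₀ ∂μ, ∃ r : ℕ → ℝ,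
      (∀ n, 0 < r n) ∧ Tendsto r atTop (nhds 0) ∧
      (∀ n, 0 < μ (Metric.ball x₀ (r n))) ∧
      ∀ k : ℕ,
        atTop.limsup (fun n => μ (Metric.ball x₀ ((k : ℝ) * r n)) / μ (Metric.ball x₀ (r n)))
          < ⊤ := by
  filter_upwards [ae_exists_mul_pow_le_measureReal_ball μ] with x ⟨c, hc, hx⟩
  choose r hr0 hrδ hpos hr using fun n : ℕ => exists_radius_forall_ge_pow_mul_le
    (fun _ => measureReal_nonneg) (fun r => measureReal_mono (Set.subset_univ (Metric.ball x r)))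
    hc hx (Nat.one_div_pos_of_nat (α := ℝ) (n := n))
  have hpos' : ∀ n, 0 < μ (Metric.ball x (r n)) := fun n => (ENNReal.toReal_pos_iff.1 (hpos n)).1
  refine ⟨r, hr0, squeeze_zero (fun n => (hr0 n).le) (fun n => (hrδ n).le)
    tendsto_one_div_add_atTop_nhds_zero_nat, hpos', fun k => ?_⟩
  rcases Nat.eq_zero_or_pos k with rfl | hk
  · simp
  set D := Module.finrank ℝ (EuclideanSpace ℝ (Fin d)) + 1
  refine (limsup_le_of_le (a := ENNReal.ofReal (2 * k ^ D)) (by isBoundedDefault)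
    (Eventually.of_forall fun n => ?_)).trans_lt ENNReal.ofReal_lt_top
  have hk1 : (1 : ℝ) ≤ k := by exact_mod_cast hk
  have hrn := hr0 n
  have h := hr n (k * r n) (le_mul_of_one_le_left hrn.le hk1)
  rw [mul_pow, div_le_iff₀ (by positivity)] at h
  have h' : μ.real (Metric.ball x (k * r n)) ≤ 2 * k ^ D * μ.real (Metric.ball x (r n)) := by
    refine h.trans_eq ?_
    field_simp
  refine ENNReal.div_le_of_le_mul ?_
  rw [← ofReal_measureReal, ← ofReal_measureReal (s := Metric.ball x (r n)),
    ← ENNReal.ofReal_mul (by positivity)]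
  exact ENNReal.ofReal_le_ofReal h'
end

section
/- Let μ be a locally finite Borel measure on ℝ^d. Then for μ-almost every x₀ ∈ ℝ^d there exist a sequence of radii r_n > 0 with r_n → 0, positive numbers c_n > 0, and a nonzero locally finite Borel measure τ on ℝ^d such that the rescaled blow-up measures c_n · (T^{(x₀,r_n)})_* μ converge to τ in the local weak* sense: for every continuous f : ℝ^d → ℝ with compact support, c_n ∫ f((x − x₀)/r_n) dμ(x) → ∫ f dτ as n → ∞. (In other words, the set of tangent measures Tan(μ, x₀) contains a non-zero measure at μ-almost every point.) -/
open MeasureTheory Filter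

open Metric Topology Set in
theorem abs_integral_le_of_eqOn_zero_compl {X : Type*} [MeasurableSpace X] {ν : Measure X}
    {s : Set X} {f : X → ℝ} {M b : ℝ} (hf : ∀ x ∉ s, f x = 0) (hM : ∀ x ∈ s, |f x| ≤ M)
    (hM0 : 0 ≤ M) (hb : 0 ≤ b) (hν : ν s ≤ ENNReal.ofReal b) : |∫ x, f x ∂ν| ≤ M * b := by
  rw [← setIntegral_eq_integral_of_forall_compl_eq_zero hf]
  refine (norm_setIntegral_le_of_norm_le_const (f := f) (hν.trans_lt ENNReal.ofReal_lt_top) hM).trans ?_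
  gcongr
  exact ENNReal.toReal_le_of_le_ofReal hb hν

open Metric in
theorem isFiniteMeasureOnCompacts_of_closedBall_lt_top {X : Type*} [PseudoMetricSpace X]
    [MeasurableSpace X] {ν : Measure X} (x₀ : X) (hν : ∀ k : ℕ, ν (closedBall x₀ k) < ⊤) :
    IsFiniteMeasureOnCompacts ν := ⟨fun K hK => by
  obtain ⟨R, hR⟩ := hK.isBounded.subset_closedBall x₀
  obtain ⟨k, hk⟩ := exists_nat_ge R
  exact (measure_mono (hR.trans (closedBall_subset_closedBall hk))).trans_lt (hν k)⟩

open Metric Topology Set in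
/-- A sequence of measures that is bounded on each ball of a countable exhaustion has a
subsequence along which the integral of every compactly supported continuous function converges. -/
theorem exists_subseq_tendsto_integral {X : Type*} [MetricSpace X] [ProperSpace X]
    [MeasurableSpace X] [BorelSpace X] (x₀ : X) (ν : ℕ → Measure X) (b : ℕ → ℝ)
    (hb : ∀ k, 0 ≤ b k) (hν : ∀ n (k : ℕ), ν n (closedBall x₀ k) ≤ ENNReal.ofReal (b k)) :
    ∃ φ : ℕ → ℕ, StrictMono φ ∧ ∀ f : X → ℝ, Continuous f → HasCompactSupport f →
      ∃ l, Tendsto (fun n => ∫ x, f x ∂(ν (φ n))) atTop (𝓝 l) := by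
  have hlf : ∀ n, IsFiniteMeasureOnCompacts (ν n) := fun n =>
    isFiniteMeasureOnCompacts_of_closedBall_lt_top x₀ fun k =>
      (hν n k).trans_lt ENNReal.ofReal_lt_top
  let S : ℕ → Set C(X, ℝ) := fun k => {f | ∀ x ∉ closedBall x₀ k, f x = 0}
  have hSne : ∀ k, Nonempty (S k) := fun k => ⟨0, fun _ _ => rfl⟩
  let g : ℕ × ℕ → C(X, ℝ) := fun p => (TopologicalSpace.denseSeq (S p.1) p.2 : C(X, ℝ))
  have hg : ∀ p, ∀ x ∉ closedBall x₀ p.1, g p x = 0 :=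
    fun p => (TopologicalSpace.denseSeq (S p.1) p.2).2
  have hcpt : ∀ k (f : C(X, ℝ)), f ∈ S k → HasCompactSupport f := fun k f hf =>
    HasCompactSupport.intro (isCompact_closedBall x₀ k) hf
  have hbdd : ∀ p, ∃ M, 0 ≤ M ∧ ∀ x, |g p x| ≤ M := fun p => by
    obtain ⟨M, hM⟩ := (hcpt p.1 _ (hg p)).exists_bound_of_continuous (g p).continuous
    exact ⟨max M 0, le_max_right _ _, fun x => (hM x).trans (le_max_left _ _)⟩
  choose M hM0 hM using hbdd
  obtain ⟨l, -, φ, hφ, hl⟩ := (isCompact_univ_pi (fun p : ℕ × ℕ =>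
    isCompact_Icc (a := -(M p * b p.1)) (b := M p * b p.1))).tendsto_subseq
    (x := fun n p => ∫ x, g p x ∂(ν n)) (fun n p _ => abs_le.1
      (abs_integral_le_of_eqOn_zero_compl (hg p) (fun x _ => hM p x) (hM0 p) (hb _) (hν n _)))
  rw [tendsto_pi_nhds] at hl
  refine ⟨φ, hφ, fun f hf hfc => cauchySeq_tendsto_of_complete ?_⟩
  obtain ⟨R, hR⟩ := hfc.isBounded.subset_closedBall x₀
  obtain ⟨k, hk⟩ := exists_nat_ge R
  have hfS : (⟨f, hf⟩ : C(X, ℝ)) ∈ S k := fun x hx => image_eq_zero_of_notMem_tsupport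
    fun h => hx (closedBall_subset_closedBall hk (hR h))
  rw [Metric.cauchySeq_iff']
  intro ε hε
  set δ := ε / 4 / (b k + 1) with hδ
  have hbk := hb k
  have hδ0 : 0 < δ := by positivity
  have hδb : δ * b k ≤ ε / 4 := by
    rw [hδ, div_mul_eq_mul_div, div_le_iff₀ (by positivity)]
    nlinarith
  obtain ⟨j, hj⟩ : ∃ j, ∀ x ∈ closedBall x₀ k, |f x - g (k, j) x| ≤ δ := by
    have : CompactSpace (closedBall x₀ (k : ℝ)) :=
      isCompact_iff_compactSpace.1 (isCompact_closedBall _ _)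
    have hc : Continuous fun h : S k => (h : C(X, ℝ)).restrict (closedBall x₀ (k : ℝ)) :=
      (ContinuousMap.continuous_restrict _).comp continuous_subtype_val
    obtain ⟨j, hj⟩ := (TopologicalSpace.denseRange_denseSeq (S k)).exists_mem_open
      (isOpen_ball.preimage hc)
      ⟨⟨⟨f, hf⟩, hfS⟩, mem_ball_self (x := ContinuousMap.restrict _ ⟨f, hf⟩) hδ0⟩
    refine ⟨j, fun x hx => ?_⟩
    have := (ContinuousMap.dist_apply_le_dist ⟨x, hx⟩).trans (mem_ball.1 hj).le
    rwa [dist_comm, Real.dist_eq] at this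
  have happ : ∀ n, |∫ x, f x ∂(ν n) - ∫ x, g (k, j) x ∂(ν n)| ≤ ε / 4 := fun n => by
    rw [← integral_sub (hf.integrable_of_hasCompactSupport hfc)
      ((g (k, j)).continuous.integrable_of_hasCompactSupport (hcpt k _ (hg (k, j))))]
    refine (abs_integral_le_of_eqOn_zero_compl (s := closedBall x₀ k) (fun x hx => ?_) hj hδ0.le
      hbk (hν n k)).trans hδb
    have h1 := hfS x hx
    have h2 := hg (k, j) x hx
    simp only [ContinuousMap.coe_mk] at h1
    rw [h1, h2, sub_zero]
  obtain ⟨N, hN⟩ := Metric.cauchySeq_iff'.1 (hl (k, j)).cauchySeq (ε / 4) (by positivity)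
  refine ⟨N, fun n hn => ?_⟩
  have h1 := abs_le.1 (happ (φ n))
  have h2 := abs_le.1 (happ (φ N))
  have h3 := hN n hn
  simp only [Function.comp, Real.dist_eq] at h3 ⊢
  rw [abs_lt] at h3 ⊢
  constructor <;> linarith [h1.1, h1.2, h2.1, h2.2, h3.1, h3.2]

open Metric Topology Set in
/-- Local weak* sequential compactness of measures which are uniformly bounded on balls. -/
theorem exists_subseq_tendsto_integral_measure {X : Type*} [MetricSpace X] [ProperSpace X]
    [MeasurableSpace X] [BorelSpace X] (x₀ : X) (ν : ℕ → Measure X) (b : ℕ → ℝ)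
    (hb : ∀ k, 0 ≤ b k) (hν : ∀ n (k : ℕ), ν n (closedBall x₀ k) ≤ ENNReal.ofReal (b k)) :
    ∃ (φ : ℕ → ℕ) (τ : Measure X), StrictMono φ ∧ IsLocallyFiniteMeasure τ ∧
      ∀ f : X → ℝ, Continuous f → HasCompactSupport f →
        Tendsto (fun n => ∫ x, f x ∂(ν (φ n))) atTop (𝓝 (∫ x, f x ∂τ)) := by
  obtain ⟨φ, hφ, hlim⟩ := exists_subseq_tendsto_integral x₀ ν b hb hν
  have hlf : ∀ n, IsFiniteMeasureOnCompacts (ν n) := fun n =>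
    isFiniteMeasureOnCompacts_of_closedBall_lt_top x₀ fun k =>
      (hν n k).trans_lt ENNReal.ofReal_lt_top
  have hint : ∀ (f : CompactlySupportedContinuousMap X ℝ) n, Integrable f (ν n) := fun f n =>
    f.continuous.integrable_of_hasCompactSupport f.hasCompactSupport
  have hex : ∀ f : CompactlySupportedContinuousMap X ℝ,
      ∃ l, Tendsto (fun n => ∫ x, f x ∂(ν (φ n))) atTop (𝓝 l) := fun f =>
    hlim f f.continuous f.hasCompactSupport
  choose L hL using hex
  let Λ : CompactlySupportedContinuousMap X ℝ →ₚ[ℝ] ℝ := PositiveLinearMap.mk₀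
    { toFun := L
      map_add' := fun f h => tendsto_nhds_unique (hL (f + h)) <|
        ((hL f).add (hL h)).congr fun n => (integral_add (hint f _) (hint h _)).symm
      map_smul' := fun c f => tendsto_nhds_unique (hL (c • f)) <|
        ((hL f).const_smul c).congr fun n => (integral_smul c _).symm }
    fun f hf => ge_of_tendsto' (hL f) fun n => integral_nonneg fun x => hf x
  refine ⟨φ, RealRMK.rieszMeasure Λ, hφ, inferInstance, fun f hf hfc => ?_⟩
  have := hL ⟨⟨f, hf⟩, hfc⟩
  rwa [show L ⟨⟨f, hf⟩, hfc⟩ = ∫ x, f x ∂(RealRMK.rieszMeasure Λ) from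
    (RealRMK.integral_rieszMeasure Λ ⟨⟨f, hf⟩, hfc⟩).symm] at this

open Metric in
theorem measurable_measure_closedBall {X : Type*} [PseudoMetricSpace X]
    [SecondCountableTopology X] [MeasurableSpace X] [OpensMeasurableSpace X]
    (μ : Measure X) [SFinite μ] (s : ℝ) : Measurable fun x => μ (closedBall x s) :=
  measurable_measure_prodMk_left (s := {p : X × X | dist p.2 p.1 ≤ s})
    (isClosed_le (continuous_snd.dist continuous_fst) continuous_const).measurableSet

open Metric Set in
/-- On average, the ratio of the measures of two concentric balls is at most the corresponding
ratio of volumes. -/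
theorem setLIntegral_measure_closedBall_div_le {E : Type*} [NormedAddCommGroup E]
    [NormedSpace ℝ E] [FiniteDimensional ℝ E] [MeasurableSpace E] [BorelSpace E]
    (μ : Measure E) [SFinite μ] {A U : Set E} (hA : MeasurableSet A)
    {k r : ℝ} (hk : 0 ≤ k) (hr : 0 < r) (hAU : ∀ x ∈ A, closedBall x (k * r) ⊆ U) :
    ∫⁻ x in A, μ (closedBall x (k * r)) / μ (closedBall x r) ∂μ ≤
      ENNReal.ofReal ((2 * (k + 1)) ^ Module.finrank ℝ E) * μ U := by
  have : ProperSpace E := FiniteDimensional.proper_real E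
  let m : Measure E := Measure.addHaar
  set s := (2 * (k + 1)) * (r / 2) with hs
  set g : E → ENNReal := fun x => μ (closedBall x (k * r)) / μ (closedBall x r)
  have hg : Measurable g :=
    (measurable_measure_closedBall μ _).div (measurable_measure_closedBall μ _)
  set v := m (closedBall 0 (r / 2)) with hv
  have hv0 : v ≠ 0 := (measure_closedBall_pos m 0 (by positivity)).ne'
  have hvt : v ≠ ⊤ := measure_closedBall_lt_top.ne
  have hD : ∀ t : ℝ, MeasurableSet {p : E × E | dist p.2 p.1 ≤ t} := fun t =>
    (isClosed_le (continuous_snd.dist continuous_fst) continuous_const).measurableSet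
  have hinner : ∀ y, ∫⁻ x in A, {p : E × E | dist p.2 p.1 ≤ r / 2}.indicator
      (fun p => g p.1) (x, y) ∂μ ≤ μ.restrict U (closedBall y s) := fun y => by
    calc _ ≤ ∫⁻ x in A, (closedBall y (r / 2)).indicator (fun _ =>
          μ.restrict U (closedBall y s) / μ (closedBall y (r / 2))) x ∂μ := by
          refine setLIntegral_mono' hA fun x hx => ?_
          by_cases hxy : dist y x ≤ r / 2
          · rw [indicator_of_mem (by exact hxy),
              indicator_of_mem (by rwa [mem_closedBall, dist_comm])]
            refine ENNReal.div_le_div ?_ (measure_mono ?_)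
            · rw [Measure.restrict_apply measurableSet_closedBall]
              refine measure_mono (subset_inter (closedBall_subset_closedBall' ?_) (hAU x hx))
              rw [dist_comm, hs]
              nlinarith
            · exact closedBall_subset_closedBall' (by linarith)
          · rw [indicator_of_notMem (by exact hxy)]
            exact zero_le
      _ ≤ ∫⁻ x, (closedBall y (r / 2)).indicator (fun _ =>
          μ.restrict U (closedBall y s) / μ (closedBall y (r / 2))) x ∂μ :=
          setLIntegral_le_lintegral _ _
      _ ≤ _ := by
          rw [lintegral_indicator_const measurableSet_closedBall, mul_comm]
          exact ENNReal.mul_div_le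
  rw [← ENNReal.mul_le_mul_iff_left hv0 hvt]
  calc (∫⁻ x in A, g x ∂μ) * v
      = ∫⁻ x in A, ∫⁻ y, {p : E × E | dist p.2 p.1 ≤ r / 2}.indicator
          (fun p => g p.1) (x, y) ∂m ∂μ := by
        rw [← lintegral_mul_const _ hg]
        refine lintegral_congr fun x => ?_
        rw [hv, ← Measure.addHaar_closedBall_center m x,
          ← lintegral_indicator_const measurableSet_closedBall]
        rfl
    _ = ∫⁻ y, ∫⁻ x in A, {p : E × E | dist p.2 p.1 ≤ r / 2}.indicator
          (fun p => g p.1) (x, y) ∂μ ∂m :=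
        lintegral_lintegral_swap ((hg.comp measurable_fst).indicator (hD _)).aemeasurable
    _ ≤ ∫⁻ y, μ.restrict U (closedBall y s) ∂m := lintegral_mono hinner
    _ = ∫⁻ y, ∫⁻ x in U, {p : E × E | dist p.2 p.1 ≤ s}.indicator 1 (y, x) ∂μ ∂m := by
        refine lintegral_congr fun y => ?_
        rw [← lintegral_indicator_one measurableSet_closedBall]
        rfl
    _ = ∫⁻ x in U, ∫⁻ y, {p : E × E | dist p.2 p.1 ≤ s}.indicator 1 (y, x) ∂m ∂μ :=
        lintegral_lintegral_swap (measurable_one.indicator (hD _)).aemeasurable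
    _ = ∫⁻ x in U, m (closedBall x s) ∂μ := by
        refine lintegral_congr fun x => ?_
        rw [← lintegral_indicator_one measurableSet_closedBall]
        refine lintegral_congr fun y => ?_
        simp only [indicator, mem_ofPred_eq, mem_closedBall, dist_comm x y, Pi.one_apply]
    _ = ENNReal.ofReal ((2 * (k + 1)) ^ Module.finrank ℝ E) * μ U * v := by
        simp_rw [hs, Measure.addHaar_closedBall_mul_of_pos m _ (by positivity : 0 < 2 * (k + 1))]
        rw [setLIntegral_const]
        ring

open Metric Topology Set ENNReal in
/-- Almost every point admits a sequence of small scales at which the measure is doubling, with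
constants depending on the dilation factor but not on the scale. -/
theorem ae_exists_radii_measure_closedBall_div_le {E : Type*} [NormedAddCommGroup E]
    [NormedSpace ℝ E] [FiniteDimensional ℝ E] [MeasurableSpace E] [BorelSpace E]
    (μ : Measure E) [IsLocallyFiniteMeasure μ] :
    ∀ᵐ x ∂μ, ∃ r : ℕ → ℝ, (∀ n, 0 < r n) ∧ Tendsto r atTop (𝓝 0) ∧
      ∀ k : ℕ, ∃ C ≠ ⊤, ∀ n, μ (closedBall x (k * r n)) / μ (closedBall x (r n)) ≤ C := by
  have : ProperSpace E := FiniteDimensional.proper_real E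
  let ρ : ℕ → ℝ := fun n => 1 / ((n : ℝ) + 1)
  have hρ : ∀ n, 0 < ρ n := fun n => Nat.one_div_pos_of_nat
  have hρ1 : ∀ n, ρ n ≤ 1 := fun n => by
    refine div_le_one_of_le₀ ?_ (by positivity)
    simp
  have hρt : Tendsto ρ atTop (𝓝 0) := tendsto_one_div_add_atTop_nhds_zero_nat
  suffices h : ∀ R : ℕ, ∀ᵐ x ∂μ, x ∈ closedBall (0 : E) R → ∃ r : ℕ → ℝ, (∀ n, 0 < r n) ∧
      Tendsto r atTop (𝓝 0) ∧ ∀ k : ℕ, ∃ C ≠ ⊤, ∀ n,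
        μ (closedBall x (k * r n)) / μ (closedBall x (r n)) ≤ C by
    filter_upwards [ae_all_iff.2 h] with x hx
    obtain ⟨R, hR⟩ := exists_nat_ge ‖x‖
    exact hx R (mem_closedBall_zero_iff.2 hR)
  intro R
  rw [← ae_restrict_iff' measurableSet_closedBall]
  let g : ℕ → ℕ → E → ℝ≥0∞ := fun k n x =>
    μ (closedBall x (k * ρ n)) / μ (closedBall x (ρ n))
  have hg : ∀ k n, Measurable (g k n) := fun k n =>
    (measurable_measure_closedBall μ _).div (measurable_measure_closedBall μ _)
  let K : ℕ → ℝ≥0∞ := fun k =>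
    ENNReal.ofReal ((2 * ((k : ℝ) + 1)) ^ Module.finrank ℝ E) * μ (closedBall 0 (R + k))
  obtain ⟨δ, hδ0, hδ⟩ := exists_pos_tsum_mul_lt_of_countable one_ne_zero K
    fun k => mul_ne_top ofReal_ne_top measure_closedBall_lt_top.ne
  have hF : ∀ n, Measurable fun x => ∑' k, g k n x * δ k := fun n =>
    Measurable.tsum fun k => (hg k n).mul_const _
  have hint : ∀ n, ∫⁻ x in closedBall (0 : E) R, ∑' k, g k n x * δ k ∂μ ≤ 1 := fun n => by
    rw [lintegral_tsum fun k => ((hg k n).mul_const _).aemeasurable]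
    refine le_trans (ENNReal.tsum_le_tsum fun k => ?_) hδ.le
    rw [lintegral_mul_const _ (hg k n)]
    gcongr
    refine setLIntegral_measure_closedBall_div_le μ measurableSet_closedBall
      k.cast_nonneg (hρ n) fun x hx => closedBall_subset_closedBall' ?_
    nlinarith [mem_closedBall.1 hx, hρ1 n, (k.cast_nonneg : (0 : ℝ) ≤ k)]
  have hliminf : ∫⁻ x in closedBall (0 : E) R,
      liminf (fun n => ∑' k, g k n x * δ k) atTop ∂μ ≤ 1 :=
    (lintegral_liminf_le hF).trans <|
      (liminf_le_liminf (Eventually.of_forall hint)).trans_eq (liminf_const 1)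
  filter_upwards [ae_lt_top (Measurable.liminf hF) (hliminf.trans_lt one_lt_top).ne] with x hx
  obtain ⟨M, hM, hMt⟩ := exists_between hx
  obtain ⟨φ, hφ, hφM⟩ := extraction_of_frequently_atTop (frequently_lt_of_liminf_lt (h := hM))
  refine ⟨ρ ∘ φ, fun n => hρ _, hρt.comp hφ.tendsto_atTop, fun k =>
    ⟨M / δ k, (div_lt_top hMt.ne (by exact_mod_cast (hδ0 k).ne')).ne, fun n => ?_⟩⟩
  rw [ENNReal.le_div_iff_mul_le (Or.inl (by exact_mod_cast (hδ0 k).ne')) (Or.inl coe_ne_top)]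
  exact (ENNReal.le_tsum (f := fun k => g k (φ n) x * δ k) k).trans (hφM n).le

/-- **Preiss.** For a locally finite Borel measure `μ` on `ℝ^d`, at `μ`-almost
every point `x₀` there exist radii `r_n ↓ 0`, scalings `c_n > 0` and a nonzero locally finite
Borel measure `τ` such that the blow-ups `c_n (T^{(x₀,r_n)})_* μ` converge to `τ` in the local
weak* sense, i.e. tested against every continuous compactly supported function. In other
words, `Tan(μ, x₀)` contains a non-zero measure at `μ`-a.e. `x₀`. -/
theorem ae_exists_nonzero_tangent_measure {d : ℕ}
    (μ : Measure (EuclideanSpace ℝ (Fin d))) [IsLocallyFiniteMeasure μ] :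
    ∀ᵐ x₀ ∂μ, ∃ (r : ℕ → ℝ) (c : ℕ → ℝ) (τ : Measure (EuclideanSpace ℝ (Fin d))),
      (∀ n, 0 < r n) ∧ Tendsto r atTop (nhds 0) ∧ (∀ n, 0 < c n) ∧
      τ ≠ 0 ∧ IsLocallyFiniteMeasure τ ∧
      ∀ f : EuclideanSpace ℝ (Fin d) → ℝ, Continuous f → HasCompactSupport f →
        Tendsto (fun n => c n * ∫ x, f ((r n)⁻¹ • (x - x₀)) ∂μ) atTop
          (nhds (∫ x, f x ∂τ)) := by
  filter_upwards [ae_exists_radii_measure_closedBall_div_le μ, μ.support_mem_ae]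
    with x₀ ⟨r, hr0, hr, hbd⟩ hx₀
  choose C hC hrC using hbd
  have hpos : ∀ n, 0 < μ (Metric.closedBall x₀ (r n)) := fun n =>
    (Measure.mem_support_iff_forall x₀).1 hx₀ _ (Metric.closedBall_mem_nhds x₀ (hr0 n))
  have hfin : ∀ n, μ (Metric.closedBall x₀ (r n)) ≠ ⊤ := fun n => measure_closedBall_lt_top.ne
  let ν : ℕ → Measure (EuclideanSpace ℝ (Fin d)) := fun n =>
    (μ (Metric.closedBall x₀ (r n)))⁻¹ • μ.map fun x => (r n)⁻¹ • (x - x₀)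
  have hT : ∀ n, Continuous fun x => (r n)⁻¹ • (x - x₀) := fun n => by fun_prop
  have hνball : ∀ n (s : ℝ), ν n (Metric.closedBall 0 s) =
      μ (Metric.closedBall x₀ (s * r n)) / μ (Metric.closedBall x₀ (r n)) := fun n s => by
    rw [Measure.smul_apply, Measure.map_apply (hT n).measurable measurableSet_closedBall,
      smul_eq_mul, mul_comm, div_eq_mul_inv]
    congr 2
    ext x
    rw [Set.mem_preimage, mem_closedBall_zero_iff, norm_smul, norm_inv, Real.norm_eq_abs,
      abs_of_pos (hr0 n), inv_mul_le_iff₀ (hr0 n), Metric.mem_closedBall, dist_eq_norm, mul_comm]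
  have hνC : ∀ n (k : ℕ), ν n (Metric.closedBall 0 k) ≤ C k := fun n k =>
    (hνball n k).trans_le (hrC k n)
  obtain ⟨φ, τ, hφ, hτ, hlim⟩ := exists_subseq_tendsto_integral_measure 0 ν
    (fun k => (C k).toReal) (fun k => ENNReal.toReal_nonneg) fun n k =>
      (hνC n k).trans_eq (ENNReal.ofReal_toReal (hC k)).symm
  refine ⟨r ∘ φ, fun n => ((μ (Metric.closedBall x₀ (r (φ n)))).toReal)⁻¹, τ, fun n => hr0 _,
    hr.comp hφ.tendsto_atTop, fun n => inv_pos.2 (ENNReal.toReal_pos (hpos _).ne' (hfin _)), ?_,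
    hτ, fun f hf hfc => (hlim f hf hfc).congr fun n => ?_⟩
  · rintro rfl
    obtain ⟨f, hf1, hfc, -, hf01⟩ := exists_continuousMap_one_of_isCompact_subset_isOpen
      (isCompact_closedBall (0 : EuclideanSpace ℝ (Fin d)) 1) isOpen_univ (Set.subset_univ _)
    have hge : ∀ n, 1 ≤ ∫ x, f x ∂(ν (φ n)) := fun n => by
      have : IsFiniteMeasureOnCompacts (ν (φ n)) :=
        isFiniteMeasureOnCompacts_of_closedBall_lt_top 0 fun k =>
          (hνC _ k).trans_lt (hC k).lt_top
      have hone : (ν (φ n)).real (Metric.closedBall 0 1) = 1 := by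
        rw [measureReal_def, hνball, one_mul, ENNReal.div_self (hpos _).ne' (hfin _),
          ENNReal.toReal_one]
      rw [← hone, ← integral_indicator_one measurableSet_closedBall]
      refine integral_mono_of_nonneg (ae_of_all _ fun x => Set.indicator_nonneg (by simp) x)
        (f.continuous.integrable_of_hasCompactSupport hfc) (ae_of_all _ fun x => ?_)
      exact Set.indicator_le' (fun y hy => (hf1 hy).ge) (fun y _ => (hf01 y).1) x
    have := ge_of_tendsto' (hlim f f.continuous hfc) hge
    rw [integral_zero_measure] at this
    linarith
  · rw [integral_smul_measure, integral_map (hT _).measurable.aemeasurable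
      hf.aestronglyMeasurable, ENNReal.toReal_inv, smul_eq_mul]
    rfl
end
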